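/- arXiv:1304.6576 — 6 statements merged into one kernel-verified Lean document; each statement's English description precedes it below -/
import Mathlib

section
/- Let f and g be transcendental entire functions that are topologically equivalent, and suppose that the singular set S(f) consists of exactly two points. Then ρ(f) = ρ(g). -/
open Complex Set Filter Topology Metric MeasureTheory
open scoped ENNReal Real

noncomputable def logPlus (x : ℝ) : ℝ := max 0 (Real.log x)

noncomputable def entireOrder (f : ℂ → ℂ) : ℝ≥0∞ :=
  Filter.limsup
    (fun z : ℂ => ENNReal.ofReal (logPlus (logPlus ‖f z‖) / Real.log ‖z‖))
    (Filter.comap (fun z : ℂ => ‖z‖) Filter.atTop)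

def IsRegularValue (f : ℂ → ℂ) (w : ℂ) : Prop :=
  ∃ U : Set ℂ, IsOpen U ∧ w ∈ U ∧
    ∀ z ∈ f ⁻¹' U,
      ∃ e : ↥(connectedComponentIn (f ⁻¹' U) z) ≃ₜ ↥U,
        ∀ x : ↥(connectedComponentIn (f ⁻¹' U) z), (e x : ℂ) = f ↑x

def singularSet (f : ℂ → ℂ) : Set ℂ := {w : ℂ | ¬ IsRegularValue f w}

def TranscendentalEntire (f : ℂ → ℂ) : Prop :=
  Differentiable ℂ f ∧ ¬ ∃ p : Polynomial ℂ, ∀ z, f z = p.eval z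

def TopEquiv (f g : ℂ → ℂ) : Prop :=
  ∃ φ ψ : ℂ ≃ₜ ℂ, ∀ z, ψ (f z) = g (φ z)

noncomputable def cylArea (A : Set ℂ) : ℝ≥0∞ :=
  ∫⁻ z in A, ENNReal.ofReal (1 / ‖z‖ ^ 2)

def AreaProperty (f : ℂ → ℂ) : Prop :=
  ∀ K : Set ℂ, IsCompact K → K ⊆ (singularSet f)ᶜ →
    cylArea (f ⁻¹' K \ Metric.ball (0 : ℂ) 1) < ⊤

namespace FreeGroup

/-- The endomorphism of the free group on two letters fixing the letter `false` and conjugating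
the letter `true` by `v`. -/
def conjSecond (v : FreeGroup Bool) : FreeGroup Bool →* FreeGroup Bool :=
  FreeGroup.lift fun i => cond i (v * of true * v⁻¹) (of false)

theorem conjSecond_mk_false (v : FreeGroup Bool) (ε : Bool) :
    conjSecond v (mk [(false, ε)]) = mk [(false, ε)] := by
  cases ε
  · have : (mk [(false, false)] : FreeGroup Bool) = (of false)⁻¹ := rfl
    rw [this, _root_.map_inv]; simp [conjSecond]
  · exact (lift_apply_of ..)

theorem conjSecond_mk_true (v : FreeGroup Bool) (ε : Bool) :
    conjSecond v (mk [(true, ε)]) = v * mk [(true, ε)] * v⁻¹ := by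
  cases ε
  · have : (mk [(true, false)] : FreeGroup Bool) = (of true)⁻¹ := rfl
    rw [this, _root_.map_inv]; simp [conjSecond, mul_assoc]
  · exact (lift_apply_of ..)

theorem conjSecond_mk_cons {v : FreeGroup Bool}
    (hhead : ∀ p ∈ v.toWord.head?, p.1 = true) (hlast : ∀ p ∈ v.toWord.getLast?, p.1 = false)
    (hv : v ≠ 1) (w : List (Bool × Bool)) : ∀ (i ε : Bool), IsReduced ((i, ε) :: w) →
      ∃ z, IsReduced ((cond i v.toWord []) ++ (i, ε) :: z) ∧
        conjSecond v (mk ((i, ε) :: w)) = mk ((cond i v.toWord []) ++ (i, ε) :: z) := by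
  have hV : IsReduced v.toWord := isReduced_toWord
  have hV' : IsReduced v⁻¹.toWord := isReduced_toWord
  obtain ⟨p, V, hpV⟩ := List.exists_cons_of_ne_nil (fun h => hv (toWord_eq_nil_iff.1 h))
  have hp : p.1 = true := hhead p (by simp [hpV])
  have hlast' : ∀ q ∈ v⁻¹.toWord.getLast?, q.1 = true := by
    intro q hq
    rw [toWord_inv, hpV] at hq
    simp [invRev] at hq
    rw [← hq]; exact hp
  have hhead' : ∀ q ∈ v⁻¹.toWord.head?, q.1 = false := by
    intro q hq
    rw [toWord_inv] at hq
    simp only [invRev, List.head?_reverse, List.getLast?_map, Option.mem_def,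
      Option.map_eq_some_iff] at hq
    obtain ⟨r, hr, rfl⟩ := hq
    exact hlast r hr
  have hjoin : ∀ (ε : Bool) (L : List (Bool × Bool)), IsReduced L →
      (∀ q ∈ L.head?, q.1 = true → q.2 = ε) → IsReduced (v.toWord ++ (true, ε) :: L) := by
    intro ε L hL h
    refine List.isChain_append.2 ⟨hV, List.isChain_cons.2 ⟨fun q hq hq' => ?_, hL⟩, ?_⟩
    · exact (h q hq hq'.symm).symm
    · intro x hx y hy hxy
      simp at hy
      subst hy
      simp [hlast x hx] at hxy
  have hmkv : mk v.toWord = v := mk_toWord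
  have hmkv' : mk v⁻¹.toWord = v⁻¹ := mk_toWord
  have hsplit : ∀ (q : Bool × Bool) (L : List (Bool × Bool)), mk (q :: L) = mk [q] * mk L :=
    fun q L => by simp
  induction w with
  | nil =>
    intro i ε _
    cases i
    · exact ⟨[], IsReduced.singleton, conjSecond_mk_false v ε⟩
    · refine ⟨v⁻¹.toWord, hjoin ε _ hV' fun q hq hq' => ?_, ?_⟩
      · simp [hhead' q hq] at hq'
      · rw [conjSecond_mk_true]
        simp only [cond_true]
        rw [← mul_mk, hsplit _ v⁻¹.toWord, hmkv, hmkv', mul_assoc]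
  | cons r w ih =>
    intro i ε hr
    obtain ⟨j, δ⟩ := r
    have hchain := (List.isChain_cons.1 hr)
    obtain ⟨z, hz, hzeq⟩ := ih j δ hchain.2
    have hδ : i = j → ε = δ := fun h => hchain.1 (j, δ) (by simp) h
    rw [hsplit, _root_.map_mul, hzeq]
    cases i
    · rw [conjSecond_mk_false]
      refine ⟨(cond j v.toWord []) ++ (j, δ) :: z, ?_, by simp⟩
      refine List.isChain_cons.2 ⟨fun q hq hq' => ?_, hz⟩
      cases j
      · simp at hq
        subst hq
        exact hδ rfl
      · simp [hpV] at hq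
        subst hq
        simp [hp] at hq'
    · rw [conjSecond_mk_true]
      cases j
      · refine ⟨v⁻¹.toWord ++ (false, δ) :: z, hjoin ε _ ?_ ?_, ?_⟩
        · refine List.isChain_append.2 ⟨hV', hz, ?_⟩
          intro x hx y hy hxy
          simp at hy
          subst hy
          simp [hlast' x hx] at hxy
        · intro q hq hq'
          rw [List.head?_append] at hq
          rcases h : v⁻¹.toWord.head? with _ | x
          · rw [h] at hq
            simp at hq
            subst hq
            simp at hq'
          · rw [h] at hq
            simp at hq
            subst hq
            simp [hhead' x h] at hq'
        · simp only [cond_true, cond_false, List.nil_append]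
          rw [← mul_mk, hsplit _ (v⁻¹.toWord ++ _), ← mul_mk, hmkv, hmkv']
          simp only [mul_assoc]
      · obtain rfl := hδ rfl
        refine ⟨(true, ε) :: z, hjoin ε _ ?_ ?_, ?_⟩
        · exact (List.isChain_append.1 hz).2.1
        · intro q hq _
          simp at hq
          subst hq
          rfl
        · simp only [cond_true]
          rw [← mul_mk, ← mul_mk, hmkv, hsplit _ (_ :: _)]
          simp only [mul_assoc, inv_mul_cancel_left]

theorem eq_one_of_conjSecond_surjective {v : FreeGroup Bool}
    (hhead : ∀ p ∈ v.toWord.head?, p.1 = true) (hlast : ∀ p ∈ v.toWord.getLast?, p.1 = false)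
    (hs : Function.Surjective (conjSecond v)) : v = 1 := by
  by_contra hv
  obtain ⟨x, hx⟩ := hs (of true)
  rcases hw : x.toWord with _ | ⟨⟨i, ε⟩, w⟩
  · rw [toWord_eq_nil_iff] at hw
    subst hw
    rw [_root_.map_one] at hx
    exact one_ne_of _ hx
  · have hred : IsReduced ((i, ε) :: w) := hw ▸ isReduced_toWord
    obtain ⟨z, hz, hzeq⟩ := conjSecond_mk_cons hhead hlast hv w i ε hred
    rw [← hw, mk_toWord, hx] at hzeq
    have h := congrArg toWord hzeq
    rw [toWord_of, toWord_mk, hz.reduce_eq] at h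
    cases i
    · simp at h
    · have hlen := congrArg List.length h
      have : v.toWord.length ≠ 0 := fun h0 =>
        hv (toWord_eq_nil_iff.1 (List.length_eq_zero_iff.1 h0))
      simp at hlen
      omega

/-- A surjective endomorphism of the free group on two letters which maps each letter to a
conjugate of itself is inner. -/
theorem exists_eq_conj_of_surjective (β : FreeGroup Bool →* FreeGroup Bool)
    (hs : Function.Surjective β) {u v : FreeGroup Bool}
    (ha : β (of false) = u * of false * u⁻¹) (hb : β (of true) = v * of true * v⁻¹) :
    ∃ w, ∀ x, β x = w * x * w⁻¹ := by
  obtain ⟨⟨k, l⟩, -, hmin⟩ := exists_minimalFor_of_wellFoundedLT (fun _ => True)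
    (fun kl : ℤ × ℤ => (of false ^ kl.1 * (u⁻¹ * v) * of true ^ kl.2).norm) ⟨(0, 0), trivial⟩
  replace hmin : ∀ k' l' : ℤ, (of false ^ k * (u⁻¹ * v) * of true ^ l).norm ≤
      (of false ^ k' * (u⁻¹ * v) * of true ^ l').norm := fun k' l' => by
    rcases le_total (of false ^ k * (u⁻¹ * v) * of true ^ l).norm
      (of false ^ k' * (u⁻¹ * v) * of true ^ l').norm with h | h
    · exact h
    · exact hmin (j := (k', l')) trivial h
  obtain ⟨v₀, hv₀⟩ : ∃ v₀, v₀ = of false ^ k * (u⁻¹ * v) * of true ^ l := ⟨_, rfl⟩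
  obtain ⟨r, hr⟩ : ∃ r, r = u * of false ^ (-k) := ⟨_, rfl⟩
  have hβ : ∀ x, β x = r * conjSecond v₀ x * r⁻¹ := by
    have : β = (MulAut.conj r).toMonoidHom.comp (conjSecond v₀) := by
      ext i
      cases i
      · have : conjSecond v₀ (of false) = of false := conjSecond_mk_false v₀ true
        rw [ha, MonoidHom.comp_apply, this]
        change _ = r * of false * r⁻¹
        rw [hr]
        group
      · have : conjSecond v₀ (of true) = v₀ * of true * v₀⁻¹ := conjSecond_mk_true v₀ true
        rw [hb, MonoidHom.comp_apply, this]
        change _ = r * (v₀ * of true * v₀⁻¹) * r⁻¹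
        rw [hr, hv₀]
        group
    intro x
    rw [this]
    rfl
  have hone : v₀ = 1 := by
    refine eq_one_of_conjSecond_surjective ?_ ?_ fun y => ?_
    · intro p hp
      rcases hw : v₀.toWord with _ | ⟨⟨i, ε⟩, V⟩
      · simp [hw] at hp
      · simp [hw] at hp
        subst hp
        cases i
        · exfalso
          obtain ⟨n, hn⟩ : ∃ n : ℤ, of false ^ n = (mk [(false, !ε)] : FreeGroup Bool) := by
            cases ε
            · exact ⟨1, by simp; rfl⟩
            · exact ⟨-1, by simp; rfl⟩
          have h1 : of false ^ n * v₀ = mk V := by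
            rw [hn, ← mk_toWord (x := v₀), hw, mul_mk]
            exact Quot.sound (by simp)
          have h2 := hmin (n + k) l
          rw [zpow_add, mul_assoc (of false ^ n), mul_assoc (of false ^ n), ← hv₀, h1] at h2
          have h3 := norm_mk_le (L₁ := V)
          have h4 : v₀.norm = V.length + 1 := by rw [norm, hw]; rfl
          omega
        · rfl
    · intro p hp
      rcases List.eq_nil_or_concat v₀.toWord with hw | ⟨V, ⟨i, ε⟩, hw⟩
      · simp [hw] at hp
      · simp [hw] at hp
        subst hp
        cases i
        · rfl
        · exfalso
          obtain ⟨n, hn⟩ : ∃ n : ℤ, of true ^ n = (mk [(true, !ε)] : FreeGroup Bool) := by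
            cases ε
            · exact ⟨1, by simp; rfl⟩
            · exact ⟨-1, by simp; rfl⟩
          have h1 : v₀ * of true ^ n = mk V := by
            rw [hn, ← mk_toWord (x := v₀), hw, mul_mk]
            exact Quot.sound (by simpa using Red.Step.not (L₁ := V) (L₂ := []) (x := true) (b := ε))
          have h2 := hmin k (l + n)
          rw [zpow_add, ← mul_assoc (of false ^ k * (u⁻¹ * v)) (of true ^ l) (of true ^ n), ← hv₀, h1] at h2
          have h3 := norm_mk_le (L₁ := V)
          have h4 : v₀.norm = V.length + 1 := by rw [norm, hw]; simp
          omega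
    · obtain ⟨x, hx⟩ := hs (r * y * r⁻¹)
      rw [hβ] at hx
      exact ⟨x, by simpa using hx⟩
  refine ⟨r, fun x => ?_⟩
  have hid : conjSecond 1 = MonoidHom.id _ := by
    ext i
    cases i <;> simp [conjSecond]
  rw [hβ, hone, hid]
  rfl

end FreeGroup

instance : TopologicalSpace (FreeGroup Bool) := ⊥

instance : DiscreteTopology (FreeGroup Bool) := ⟨rfl⟩

namespace TwicePunctured

open FreeGroup Bundle

/-- The plane with the points `0` and `1` removed. -/
abbrev Base : Type := ↥({0, 1}ᶜ : Set ℂ)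

/-- The three simply connected pieces of the twice punctured plane: the plane slit along
`(-∞, 0]` and `[1, ∞)`, and two half-planes. -/
def piece : Option Bool → Set Base
  | none => {x | x.1.im ≠ 0 ∨ 0 < x.1.re ∧ x.1.re < 1}
  | some false => {x | x.1.re < 0}
  | some true => {x | 1 < x.1.re}

/-- The transition cocycle of the universal covering. -/
noncomputable def cocycle : Option Bool → Base → FreeGroup Bool
  | none, _ => 1
  | some i, x => if x.1.im < 0 then (of i)⁻¹ else 1

theorem isOpen_piece (i : Option Bool) : IsOpen (piece i) := by
  have hre : Continuous fun x : Base => x.1.re := Complex.continuous_re.comp continuous_subtype_val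
  have him : Continuous fun x : Base => x.1.im := Complex.continuous_im.comp continuous_subtype_val
  rcases i with _ | _ | _
  · exact (isOpen_ne_fun him continuous_const).union
      ((isOpen_lt continuous_const hre).inter (isOpen_lt hre continuous_const))
  · exact isOpen_lt hre continuous_const
  · exact isOpen_lt continuous_const hre

theorem im_ne_zero_of_mem {i j : Option Bool} (hij : i ≠ j) {x : Base} (hi : x ∈ piece i)
    (hj : x ∈ piece j) : x.1.im ≠ 0 := by
  rcases i with _ | _ | _ <;> rcases j with _ | _ | _ <;>
    simp [piece] at * <;> intro h <;> simp_all <;> linarith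

theorem eventually_cocycle_eq (i : Option Bool) {x : Base} (hx : x.1.im ≠ 0) :
    ∀ᶠ y in 𝓝 x, cocycle i y = cocycle i x := by
  have him : Continuous fun x : Base => x.1.im := Complex.continuous_im.comp continuous_subtype_val
  rcases i with _ | i
  · exact Eventually.of_forall fun _ => rfl
  · rcases hx.lt_or_gt with h | h
    · filter_upwards [him.continuousAt.eventually_lt_const h] with y hy
      simp [cocycle, h, hy]
    · filter_upwards [him.continuousAt.eventually_const_lt h] with y hy
      simp [cocycle, h.not_gt, hy.not_gt]

open Classical in
/-- The bundle core of the universal covering of the twice punctured plane. -/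
noncomputable def core : FiberBundleCore (Option Bool) Base (FreeGroup Bool) where
  baseSet := piece
  isOpen_baseSet := isOpen_piece
  indexAt x := if x ∈ piece none then none else some (0 ≤ x.1.re)
  mem_baseSet_at x := by
    by_cases h : x ∈ piece none
    · simp [h]
    · have hx := x.2
      simp only [piece, mem_ofPred_eq, not_or, not_not, not_and, not_lt] at h
      have h0 : x.1.re ≠ 0 := fun h0 => hx (Or.inl (Complex.ext h0 h.1))
      have h1 : x.1.re ≠ 1 := fun h1 => hx (Or.inr (Complex.ext h1 h.1))
      rw [if_neg (by simpa [piece, h.1] using h.2)]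
      by_cases h2 : 0 ≤ x.1.re
      · simp only [h2, decide_true]
        exact lt_of_le_of_ne (h.2 (lt_of_le_of_ne h2 h0.symm)) h1.symm
      · simp only [h2, decide_false]
        exact not_le.1 h2
  coordChange i j x v := v * (cocycle i x)⁻¹ * cocycle j x
  coordChange_self i x _ v := by simp
  continuousOn_coordChange i j := by
    by_cases hij : i = j
    · subst hij
      simpa using continuousOn_snd
    · rintro ⟨x, v⟩ ⟨⟨hi, hj⟩, -⟩
      refine ContinuousAt.continuousWithinAt ?_
      have him := im_ne_zero_of_mem hij hi hj
      have : ∀ᶠ p : Base × FreeGroup Bool in 𝓝 (x, v),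
          p.2 * (cocycle i p.1)⁻¹ * cocycle j p.1 = v * (cocycle i x)⁻¹ * cocycle j x := by
        have h2 : ∀ᶠ w in 𝓝 v, w = v := by simp
        filter_upwards [(eventually_cocycle_eq i him).prod_nhds h2,
          (eventually_cocycle_eq j him).prod_nhds h2] with p h1 h2
        rw [h1.1, h2.1, h1.2]
      exact (continuousAt_const (y := v * (cocycle i x)⁻¹ * cocycle j x)).congr (this.mono fun _ h => h.symm)
  coordChange_comp i j k x _ v := by simp [mul_assoc]

/-- The universal covering space of the twice punctured plane. -/
abbrev Cover : Type := core.TotalSpace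

/-- The covering projection. -/
noncomputable abbrev proj : Cover → Base := core.proj

/-- The point of the covering space over `x` with coordinate `v` in the slit plane. -/
def pt (x : Base) (v : FreeGroup Bool) : Cover := ⟨x, v⟩

/-- The coordinate of a point in the slit plane. -/
def coord (e : Cover) : FreeGroup Bool := e.2

@[simp] theorem proj_pt (x : Base) (v : FreeGroup Bool) : proj (pt x v) = x := rfl

@[simp] theorem coord_pt (x : Base) (v : FreeGroup Bool) : coord (pt x v) = v := rfl

@[simp] theorem pt_proj_coord (e : Cover) : pt (proj e) (coord e) = e := rfl

theorem isCoveringMap_proj : IsCoveringMap proj :=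
  FiberBundle.isCoveringMap (F := FreeGroup Bool) (E := core.Fiber)

theorem cocycle_indexAt (x : Base) : cocycle (core.indexAt x) x = 1 := by
  by_cases h : x ∈ piece none
  · simp [core, h, cocycle]
  · simp only [core, h, if_false, cocycle]
    simp only [piece, mem_ofPred_eq, not_or, not_not, not_and, not_lt] at h
    simp [h.1]

theorem localTriv_apply (i : Option Bool) (e : Cover) :
    core.localTriv i e = (proj e, coord e * cocycle i (proj e)) := by
  rw [FiberBundleCore.localTriv_apply]
  change (_, coord e * (cocycle (core.indexAt (proj e)) (proj e))⁻¹ * _) = _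
  rw [cocycle_indexAt]
  simp

theorem localTriv_symm_apply (i : Option Bool) (x : Base) (w : FreeGroup Bool) :
    (core.localTriv i).toOpenPartialHomeomorph.symm (x, w) = pt x (w * (cocycle i x)⁻¹) := by
  rw [FiberBundleCore.localTriv_symm_apply]
  change pt x (w * (cocycle i x)⁻¹ * cocycle (core.indexAt x) x) = _
  rw [cocycle_indexAt, mul_one]

theorem continuousOn_section (i : Option Bool) (w : FreeGroup Bool) :
    ContinuousOn (fun x => pt x (w * (cocycle i x)⁻¹)) (piece i) := by
  have h := (core.localTriv i).toOpenPartialHomeomorph.continuousOn_symm.comp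
    (f := fun x : Base => (x, w)) (s := piece i) (by fun_prop) 
    (fun x hx => (core.mem_localTriv_target i (x, w)).2 hx)
  refine h.congr fun x _ => ?_
  exact (localTriv_symm_apply i x w).symm

theorem continuous_of_section {Y : Type*} [TopologicalSpace Y] {P : Cover → Y}
    (h : ∀ i w, ContinuousOn (fun x => P (pt x (w * (cocycle i x)⁻¹))) (piece i)) :
    Continuous P := by
  refine continuous_iff_continuousAt.2 fun e => ?_
  set i := core.indexAt (proj e) with hi
  have he : e ∈ (core.localTriv i).source := core.mem_localTriv_source i e |>.2
    (core.mem_baseSet_at (proj e))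
  have hopen := (core.localTriv i).open_target
  have h1 : ContinuousOn (P ∘ (core.localTriv i).toOpenPartialHomeomorph.symm)
      (core.localTriv i).target := by
    rintro ⟨x, w⟩ hxw
    have hx : x ∈ piece i := (core.mem_localTriv_target i (x, w)).1 hxw
    have h2 : ∀ᶠ p : Base × FreeGroup Bool in 𝓝 (x, w), p.2 = w := by
      have : ∀ᶠ v in 𝓝 w, v = w := by simp
      exact (continuous_snd.tendsto (x, w)).eventually this
    have h3 : ContinuousAt ((fun x => P (pt x (w * (cocycle i x)⁻¹))) ∘
        (Prod.fst : Base × FreeGroup Bool → Base)) (x, w) :=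
      ContinuousAt.comp ((h i w).continuousAt ((isOpen_piece i).mem_nhds hx))
        continuous_fst.continuousAt
    refine (h3.congr ?_).continuousWithinAt
    filter_upwards [h2] with p hp
    simp only [Function.comp_apply]
    rw [← hp, ← localTriv_symm_apply]
  have h2 := h1.continuousAt (hopen.mem_nhds
    ((core.localTriv i).toOpenPartialHomeomorph.map_source he))
  have h3 := ContinuousAt.comp h2 ((core.localTriv i).toOpenPartialHomeomorph.continuousAt he)
  refine h3.congr ?_
  filter_upwards [(core.localTriv i).open_source.mem_nhds he] with y hy
  simp only [Function.comp_apply]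
  exact congrArg P ((core.localTriv i).toOpenPartialHomeomorph.left_inv hy)

instance : LocallyPathConnectedSpace Base :=
  (((finite_singleton (1 : ℂ)).insert 0).isClosed.isOpen_compl).locallyPathConnectedSpace

theorem image_piece_none : (Subtype.val '' piece none : Set ℂ) =
    {z | z.im ≠ 0 ∨ 0 < z.re ∧ z.re < 1} := by
  ext z
  constructor
  · rintro ⟨x, hx, rfl⟩
    exact hx
  · intro hz
    refine ⟨⟨z, ?_⟩, hz, rfl⟩
    rintro (rfl | rfl) <;> simp at hz

theorem image_piece_false : (Subtype.val '' piece (some false) : Set ℂ) = {z | z.re < 0} := by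
  ext z
  constructor
  · rintro ⟨x, hx, rfl⟩
    exact hx
  · intro hz
    refine ⟨⟨z, ?_⟩, hz, rfl⟩
    rintro (rfl | rfl) <;> norm_num at hz

theorem image_piece_true : (Subtype.val '' piece (some true) : Set ℂ) = {z | 1 < z.re} := by
  ext z
  constructor
  · rintro ⟨x, hx, rfl⟩
    exact hx
  · intro hz
    refine ⟨⟨z, ?_⟩, hz, rfl⟩
    rintro (rfl | rfl) <;> norm_num at hz

theorem exists_starConvex_piece (i : Option Bool) :
    ∃ c ∈ Subtype.val '' piece i, StarConvex ℝ c (Subtype.val '' piece i) := by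
  rcases i with _ | _ | _
  · rw [image_piece_none]
    refine ⟨1 / 2, by norm_num, fun z hz s t hs ht hst => ?_⟩
    have hre : (s • (1 / 2 : ℂ) + t • z).re = s * (1 / 2) + t * z.re := by simp
    have him : (s • (1 / 2 : ℂ) + t • z).im = t * z.im := by simp
    simp only [mem_ofPred_eq] at hz ⊢
    rw [hre, him]
    rcases ht.eq_or_lt with rfl | ht
    · right
      obtain rfl : s = 1 := by linarith
      norm_num
    rcases hz with hz | hz
    · exact Or.inl (mul_ne_zero ht.ne' hz)
    · right
      constructor <;> nlinarith
  · rw [image_piece_false]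
    exact ⟨-1, by norm_num, (convex_halfSpace_re_lt 0).starConvex (by norm_num)⟩
  · rw [image_piece_true]
    exact ⟨2, by norm_num, (convex_halfSpace_re_gt 1).starConvex (by norm_num)⟩

theorem isPreconnected_piece (i : Option Bool) : IsPreconnected (piece i) := by
  obtain ⟨c, hc, hs⟩ := exists_starConvex_piece i
  rw [← Topology.IsInducing.subtypeVal.isPreconnected_image]
  exact (hs.isPathConnected hc).isConnected.isPreconnected

theorem exists_section {Y : Type*} [TopologicalSpace Y] {q : Y → Base} (hq : IsCoveringMap q)
    {i : Option Bool} {y : Y} (hy : q y ∈ piece i) :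
    ∃ s : Base → Y, ContinuousOn s (piece i) ∧ (∀ x ∈ piece i, q (s x) = x) ∧ s (q y) = y := by
  classical
  obtain ⟨c, hc, hs⟩ := exists_starConvex_piece i
  have h1 : ContractibleSpace (Subtype.val '' piece i : Set ℂ) := hs.contractibleSpace ⟨c, hc⟩
  have h2 : ContractibleSpace (piece i) :=
    (Topology.IsEmbedding.subtypeVal.homeomorphImage (piece i)).contractibleSpace
  have h3 : LocallyPathConnectedSpace (piece i) := (isOpen_piece i).locallyPathConnectedSpace
  obtain ⟨F, ⟨hF1, hF2⟩, -⟩ := hq.existsUnique_continuousMap_lifts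
    (⟨Subtype.val, continuous_subtype_val⟩ : C(piece i, Base)) ⟨q y, hy⟩ y rfl
  refine ⟨fun x => if h : x ∈ piece i then F ⟨x, h⟩ else y, ?_, fun x hx => ?_, ?_⟩
  · rw [continuousOn_iff_continuous_domRestrict]
    refine F.continuous.congr fun x => ?_
    simp
  · simp only [hx, dif_pos]
    exact congrFun hF2 ⟨x, hx⟩
  · simp only [hy, dif_pos]
    exact hF1

section Lift

variable {Y : Type*} [TopologicalSpace Y] {q : Y → Base} (hq : IsCoveringMap q)

open Classical in
/-- The section of `q` over a piece through a given point. -/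
noncomputable def sect (i : Option Bool) (y : Y) : Base → Y :=
  if h : q y ∈ piece i then (exists_section hq h).choose else fun _ => y

variable {i : Option Bool} {y : Y}

theorem continuousOn_sect (hy : q y ∈ piece i) : ContinuousOn (sect hq i y) (piece i) := by
  rw [sect, dif_pos hy]
  exact (exists_section hq hy).choose_spec.1

theorem proj_sect (hy : q y ∈ piece i) {x : Base} (hx : x ∈ piece i) : q (sect hq i y x) = x := by
  rw [sect, dif_pos hy]
  exact (exists_section hq hy).choose_spec.2.1 x hx

theorem proj_sect_mem (hy : q y ∈ piece i) {j : Option Bool} {x : Base} (hx : x ∈ piece i)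
    (hx' : x ∈ piece j) : q (sect hq i y x) ∈ piece j := by
  rwa [proj_sect hq hy hx]

theorem sect_self (hy : q y ∈ piece i) : sect hq i y (q y) = y := by
  rw [sect, dif_pos hy]
  exact (exists_section hq hy).choose_spec.2.2

theorem sect_self' (hy : q y ∈ piece i) {x : Base} (hx : q y = x) : sect hq i y x = y :=
  hx ▸ sect_self hq hy

theorem sect_sect (hy : q y ∈ piece i) {x x' : Base} (hx : x ∈ piece i) (hx' : x' ∈ piece i) :
    sect hq i (sect hq i y x) x' = sect hq i y x' := by
  have h := proj_sect hq hy hx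
  have h' := proj_sect_mem hq hy hx hx
  refine hq.eqOn_of_comp_eqOn (isPreconnected_piece i) (continuousOn_sect hq h')
    (continuousOn_sect hq hy) (fun z hz => ?_) hx (sect_self' hq h' h) hx'
  simp only [Function.comp_apply]
  rw [proj_sect hq h' hz, proj_sect hq hy hz]

/-- The base point. -/
noncomputable def basePt : Base := ⟨1 / 2, by rintro (h | h) <;> norm_num at h⟩

/-- A point above (`ε = 1`) or below (`ε = -1`) the slit with index `i`. -/
noncomputable def corner (i : Bool) (ε : ℤˣ) : Base :=
  ⟨⟨cond i 2 (-1), (ε : ℤ)⟩, by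
    rintro (h | h) <;> have := congrArg Complex.re h <;> cases i <;> norm_num at this⟩

theorem basePt_mem : basePt ∈ piece none := by
  right; norm_num [basePt]

theorem corner_mem_none (i : Bool) (ε : ℤˣ) : corner i ε ∈ piece none := by
  left; simp [corner]

theorem corner_mem_some (i : Bool) (ε : ℤˣ) : corner i ε ∈ piece (some i) := by
  cases i <;> norm_num [corner, piece]

/-- Moving along the loop which crosses the slit with index `i`. -/
noncomputable def loopStep (i : Bool) (ε : ℤˣ) (y : Y) : Y :=
  sect hq none (sect hq (some i) (sect hq none y (corner i ε)) (corner i (-ε))) basePt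

theorem proj_loopStep (i : Bool) (ε : ℤˣ) {y : Y} (hy : q y = basePt) :
    q (loopStep hq i ε y) = basePt := by
  have h0 : q y ∈ piece none := hy ▸ basePt_mem
  have h1 := proj_sect_mem hq h0 (corner_mem_none i ε) (corner_mem_some i ε)
  have h2 := proj_sect_mem hq h1 (corner_mem_some i (-ε)) (corner_mem_none i (-ε))
  exact proj_sect hq h2 basePt_mem

theorem sect_loopStep (i : Bool) (ε : ℤˣ) {y : Y} (hy : q y = basePt) :
    sect hq none (loopStep hq i ε y) (corner i (-ε)) =
      sect hq (some i) (sect hq none y (corner i ε)) (corner i (-ε)) := by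
  have h0 : q y ∈ piece none := hy ▸ basePt_mem
  have h1 := proj_sect_mem hq h0 (corner_mem_none i ε) (corner_mem_some i ε)
  have h2 := proj_sect_mem hq h1 (corner_mem_some i (-ε)) (corner_mem_none i (-ε))
  rw [loopStep, sect_sect hq h2 basePt_mem (corner_mem_none i (-ε)),
    sect_self' hq h2 (proj_sect hq h1 (corner_mem_some i (-ε)))]

theorem loopStep_loopStep (i : Bool) (ε : ℤˣ) {y : Y} (hy : q y = basePt) :
    loopStep hq i (-ε) (loopStep hq i ε y) = y := by
  have h0 : q y ∈ piece none := hy ▸ basePt_mem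
  have h1 := proj_sect_mem hq h0 (corner_mem_none i ε) (corner_mem_some i ε)
  rw [loopStep, sect_loopStep hq i ε hy, neg_neg,
    sect_sect hq h1 (corner_mem_some i (-ε)) (corner_mem_some i ε),
    sect_self' hq h1 (proj_sect hq h0 (corner_mem_none i ε)),
    sect_sect hq h0 (corner_mem_none i ε) basePt_mem, sect_self' hq h0 hy]

/-- The monodromy permutation of the fibre over the base point. -/
noncomputable def loopPerm (i : Bool) : Equiv.Perm {y : Y // q y = basePt} where
  toFun y := ⟨loopStep hq i 1 y, proj_loopStep hq i 1 y.2⟩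
  invFun y := ⟨loopStep hq i (-1) y, proj_loopStep hq i (-1) y.2⟩
  left_inv y := Subtype.ext (loopStep_loopStep hq i 1 y.2)
  right_inv y := Subtype.ext (by simpa using loopStep_loopStep hq i (-1) y.2)

/-- The points of the fibre over the base point hit by the lift of the universal covering. -/
noncomputable def fibrePt (y₀ : {y : Y // q y = basePt}) (v : FreeGroup Bool) :
    {y : Y // q y = basePt} :=
  FreeGroup.lift (fun i => (loopPerm hq i)⁻¹) v⁻¹ y₀

theorem fibrePt_mem (y₀ : {y : Y // q y = basePt}) (v : FreeGroup Bool) :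
    q (fibrePt hq y₀ v).1 ∈ piece none := by
  rw [(fibrePt hq y₀ v).2]
  exact basePt_mem

theorem fibrePt_mul_of (y₀ : {y : Y // q y = basePt}) (v : FreeGroup Bool) (i : Bool) :
    fibrePt hq y₀ (v * of i) = loopPerm hq i (fibrePt hq y₀ v) := by
  simp [fibrePt]

/-- The lift of the universal covering through `q`. -/
noncomputable def liftCover (y₀ : {y : Y // q y = basePt}) (e : Cover) : Y :=
  match core.indexAt (proj e) with
  | none => sect hq none (fibrePt hq y₀ (coord e)).1 (proj e)
  | some i => sect hq (some i) (sect hq none (fibrePt hq y₀ (coord e)).1 (corner i 1)) (proj e)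

theorem indexAt_of_mem_none {x : Base} (hx : x ∈ piece none) : core.indexAt x = none := by
  simp [core, hx]

theorem eq_of_mem_some {i j : Bool} {x : Base} (hi : x ∈ piece (some i))
    (hj : x ∈ piece (some j)) : i = j := by
  cases i <;> cases j <;> simp [piece] at * <;> linarith

theorem indexAt_of_not_mem_none {x : Base} (hx : x ∉ piece none) {i : Bool}
    (hi : x ∈ piece (some i)) : core.indexAt x = some i := by
  have h := core.mem_baseSet_at x
  rcases hj : core.indexAt x with _ | j
  · rw [hj] at h
    exact absurd h hx
  · rw [hj] at h
    rw [eq_of_mem_some h hi]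

theorem isPreconnected_half (i : Bool) (ε : ℤˣ) :
    IsPreconnected {x | x ∈ piece (some i) ∧ 0 < ((ε : ℤ) : ℝ) * x.1.im} := by
  rw [← Topology.IsInducing.subtypeVal.isPreconnected_image]
  have : (Subtype.val '' {x : Base | x ∈ piece (some i) ∧ 0 < ((ε : ℤ) : ℝ) * x.1.im} : Set ℂ) =
      Subtype.val '' piece (some i) ∩ {z | 0 < ((ε : ℤ) : ℝ) * z.im} := by
    ext z
    constructor
    · rintro ⟨x, hx, rfl⟩
      exact ⟨⟨x, hx.1, rfl⟩, hx.2⟩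
    · rintro ⟨⟨x, hx, rfl⟩, h⟩
      exact ⟨x, ⟨hx, h⟩, rfl⟩
  rw [this]
  refine Convex.isPreconnected (Convex.inter ?_ ?_)
  · cases i
    · rw [image_piece_false]
      exact convex_halfSpace_re_lt 0
    · rw [image_piece_true]
      exact convex_halfSpace_re_gt 1
  · rcases Int.units_eq_one_or ε with rfl | rfl
    · simpa using convex_halfSpace_im_gt 0
    · simpa using convex_halfSpace_im_lt 0

theorem liftCover_pt_none (y₀ : {y : Y // q y = basePt}) {x : Base} (hx : x ∈ piece none)
    (w : FreeGroup Bool) :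
    liftCover hq y₀ (pt x w) = sect hq none (fibrePt hq y₀ w).1 x := by
  simp only [liftCover, proj_pt, indexAt_of_mem_none hx, coord_pt]

theorem sect_corner_eqOn {y : Y} (hy : q y = basePt) (i : Bool) (ε : ℤˣ) {y' : Y}
    (hy' : q y' = basePt)
    (h : sect hq none y' (corner i ε) = sect hq (some i) (sect hq none y (corner i 1)) (corner i ε))
    {x : Base} (hx : x ∈ piece (some i)) (hε : 0 < ((ε : ℤ) : ℝ) * x.1.im) :
    sect hq none y' x = sect hq (some i) (sect hq none y (corner i 1)) x := by
  have h0 : q y ∈ piece none := hy ▸ basePt_mem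
  have h0' : q y' ∈ piece none := hy' ▸ basePt_mem
  have h1 := proj_sect_mem hq h0 (corner_mem_none i 1) (corner_mem_some i 1)
  have hn : ∀ z : Base, z ∈ piece (some i) ∧ 0 < ((ε : ℤ) : ℝ) * z.1.im → z ∈ piece none :=
    fun z hz => Or.inl (right_ne_zero_of_mul hz.2.ne')
  refine hq.eqOn_of_comp_eqOn (isPreconnected_half i ε)
    ((continuousOn_sect hq h0').mono hn) ((continuousOn_sect hq h1).mono fun z hz => hz.1)
    (fun z hz => ?_) (a := corner i ε) ⟨corner_mem_some i ε, ?_⟩ h ⟨hx, hε⟩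
  · simp only [Function.comp_apply]
    rw [proj_sect hq h0' (hn z hz), proj_sect hq h1 hz.1]
  · rcases Int.units_eq_one_or ε with rfl | rfl <;> simp [corner]

theorem liftCover_pt_some (y₀ : {y : Y // q y = basePt}) {i : Bool} {x : Base}
    (hx : x ∈ piece (some i)) (w : FreeGroup Bool) :
    liftCover hq y₀ (pt x (w * (cocycle (some i) x)⁻¹)) =
      sect hq (some i) (sect hq none (fibrePt hq y₀ w).1 (corner i 1)) x := by
  by_cases hn : x ∈ piece none
  · rw [liftCover_pt_none hq y₀ hn]
    have h0 : q (fibrePt hq y₀ w).1 ∈ piece none := fibrePt_mem hq y₀ w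
    have h1 := proj_sect_mem hq h0 (corner_mem_none i 1) (corner_mem_some i 1)
    have him : x.1.im ≠ 0 := im_ne_zero_of_mem (by simp) hn hx
    rcases him.lt_or_gt with h | h
    · have hc : cocycle (some i) x = (of i)⁻¹ := if_pos h
      rw [hc, inv_inv, fibrePt_mul_of]
      refine sect_corner_eqOn hq (fibrePt hq y₀ w).2 i (-1) (proj_loopStep hq i 1 ?_) ?_ hx ?_
      · exact (fibrePt hq y₀ w).2
      · exact sect_loopStep hq i 1 (fibrePt hq y₀ w).2
      · simpa using h
    · have hc : cocycle (some i) x = 1 := if_neg h.not_gt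
      rw [hc, inv_one, mul_one]
      refine sect_corner_eqOn hq (fibrePt hq y₀ w).2 i 1 (fibrePt hq y₀ w).2 ?_ hx ?_
      · rw [sect_self' hq h1 (proj_sect hq h0 (corner_mem_none i 1))]
      · simpa using h
  · have h := cocycle_indexAt x
    rw [indexAt_of_not_mem_none hn hx] at h
    rw [h, inv_one, mul_one]
    simp only [liftCover, proj_pt, indexAt_of_not_mem_none hn hx, coord_pt]

theorem continuous_liftCover (y₀ : {y : Y // q y = basePt}) : Continuous (liftCover hq y₀) := by
  refine continuous_of_section fun i w => ?_
  have h0 : q (fibrePt hq y₀ w).1 ∈ piece none := fibrePt_mem hq y₀ w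
  rcases i with _ | i
  · refine (continuousOn_sect hq h0).congr fun x hx => ?_
    simpa [cocycle] using liftCover_pt_none hq y₀ hx w
  · have h1 := proj_sect_mem hq h0 (corner_mem_none i 1) (corner_mem_some i 1)
    exact (continuousOn_sect hq h1).congr fun x hx => liftCover_pt_some hq y₀ hx w

theorem proj_liftCover (y₀ : {y : Y // q y = basePt}) (e : Cover) :
    q (liftCover hq y₀ e) = proj e := by
  have h0 : q (fibrePt hq y₀ (coord e)).1 ∈ piece none := fibrePt_mem hq y₀ _
  have h := core.mem_baseSet_at (proj e)
  rcases hi : core.indexAt (proj e) with _ | i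
  · rw [hi] at h
    simp only [liftCover, hi]
    exact proj_sect hq h0 h
  · rw [hi] at h
    simp only [liftCover, hi]
    exact proj_sect hq (proj_sect_mem hq h0 (corner_mem_none i 1) (corner_mem_some i 1)) h

theorem liftCover_base (y₀ : {y : Y // q y = basePt}) : liftCover hq y₀ (pt basePt 1) = y₀ := by
  rw [liftCover_pt_none hq y₀ basePt_mem, sect_self' hq]
  · simp [fibrePt]
  · exact fibrePt_mem hq y₀ 1
  · exact (fibrePt hq y₀ 1).2

end Lift

/-- The deck transformation given by an element of the free group. -/
noncomputable def deck (g : FreeGroup Bool) (e : Cover) : Cover := pt (proj e) (g * coord e)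

@[simp] theorem proj_deck (g : FreeGroup Bool) (e : Cover) : proj (deck g e) = proj e := rfl

theorem deck_pt (g : FreeGroup Bool) (x : Base) (v : FreeGroup Bool) :
    deck g (pt x v) = pt x (g * v) := rfl

theorem deck_deck (g g' : FreeGroup Bool) (e : Cover) : deck g (deck g' e) = deck (g * g') e := by
  simp [deck, mul_assoc]

theorem deck_injective {g g' : FreeGroup Bool} {e : Cover} (h : deck g e = deck g' e) :
    g = g' :=
  mul_right_cancel (congrArg coord h)

theorem exists_deck_eq {e e' : Cover} (h : proj e = proj e') : ∃ g, deck g e = e' := by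
  refine ⟨coord e' * (coord e)⁻¹, ?_⟩
  rw [deck, h]
  simp

theorem continuous_deck (g : FreeGroup Bool) : Continuous (deck g) := by
  refine continuous_of_section fun i w => ?_
  simpa [deck_pt, mul_assoc] using continuousOn_section i (g * w)

instance : PreconnectedSpace Cover := by
  refine preconnectedSpace_of_forall_constant fun f hf => ?_
  have hconst : ∀ i w, ∀ x ∈ piece i, ∀ x' ∈ piece i,
      f (pt x (w * (cocycle i x)⁻¹)) = f (pt x' (w * (cocycle i x')⁻¹)) := by
    intro i w x hx x' hx'
    exact (isPreconnected_piece i).constant (f := fun x => f (pt x (w * (cocycle i x)⁻¹)))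
      (hf.comp_continuousOn (continuousOn_section i w)) hx hx'
  have h0 : ∀ w, ∀ x ∈ piece none, f (pt x w) = f (pt basePt w) := fun w x hx => by
    simpa [cocycle] using hconst none w x hx basePt basePt_mem
  have hof : ∀ i w, f (pt basePt (w * of i)) = f (pt basePt w) := by
    intro i w
    have h1 : cocycle (some i) (corner i 1) = 1 := by simp [cocycle, corner]
    have h2 : cocycle (some i) (corner i (-1)) = (of i)⁻¹ := by simp [cocycle, corner]
    have h := hconst (some i) w _ (corner_mem_some i 1) _ (corner_mem_some i (-1))
    rw [h1, h2, inv_one, mul_one, inv_inv, h0 _ _ (corner_mem_none i 1),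
      h0 _ _ (corner_mem_none i (-1))] at h
    exact h.symm
  have hall : ∀ g w, f (pt basePt (w * g)) = f (pt basePt w) := by
    intro g
    induction g using FreeGroup.induction_on with
    | C1 => simp
    | of i => exact hof i
    | inv_of i _ => intro w; rw [← hof i (w * (of i)⁻¹), inv_mul_cancel_right]
    | mul g g' h h' => intro w; rw [← mul_assoc, h', h]
  have hbase : ∀ e : Cover, f e = f (pt basePt 1) := by
    intro e
    obtain ⟨x, v, rfl⟩ : ∃ x v, e = pt x v := ⟨proj e, coord e, rfl⟩
    have hx := core.mem_baseSet_at x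
    rcases hi : core.indexAt x with _ | i
    · rw [hi] at hx
      rw [h0 _ _ hx]
      simpa using hall v 1
    · have h1 := cocycle_indexAt x
      rw [hi] at hx h1
      have h2 : cocycle (some i) (corner i 1) = 1 := by simp [cocycle, corner]
      have h := hconst (some i) v _ hx _ (corner_mem_some i 1)
      rw [h1, h2, inv_one, mul_one, h0 _ _ (corner_mem_none i 1)] at h
      rw [h]
      simpa using hall v 1
  intro e e'
  rw [hbase, hbase e']

theorem exists_lift_sect {Y : Type*} [TopologicalSpace Y] {q : Y → Base} (hq : IsCoveringMap q)
    {e : Cover} (h : ∀ y, q y = proj e →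
      ∃ P : Cover → Y, Continuous P ∧ (∀ e, q (P e) = proj e) ∧ P e = y)
    {i : Option Bool} (he : proj e ∈ piece i) {x : Base} (hx : x ∈ piece i) (y : Y)
    (hy : q y = x) : ∃ P : Cover → Y, Continuous P ∧ (∀ e, q (P e) = proj e) ∧
      P (sect isCoveringMap_proj i e x) = y := by
  subst hy
  obtain ⟨P, hPc, hP, hPe⟩ := h (sect hq i y (proj e)) (proj_sect hq hx he)
  refine ⟨P, hPc, hP, ?_⟩
  have h1 := hq.eqOn_of_comp_eqOn (isPreconnected_piece i)
    (g₁ := P ∘ sect isCoveringMap_proj i e) (g₂ := sect hq i y)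
    (hPc.comp_continuousOn (continuousOn_sect isCoveringMap_proj he))
    (continuousOn_sect hq hx) (fun z hz => ?_) he ?_ hx
  · rw [sect_self hq hx] at h1
    exact h1
  · simp only [Function.comp_apply]
    rw [hP, proj_sect isCoveringMap_proj he hz, proj_sect hq hx hz]
  · simp only [Function.comp_apply]
    rw [sect_self isCoveringMap_proj he, hPe]

/-- The universal covering lifts through every covering of the twice punctured plane. -/
theorem exists_lift {Y : Type*} [TopologicalSpace Y] {q : Y → Base} (hq : IsCoveringMap q)
    {e : Cover} {y : Y} (h : q y = proj e) :
    ∃ P : Cover → Y, Continuous P ∧ (∀ e, q (P e) = proj e) ∧ P e = y := by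
  have h0 : ∀ e : Cover, proj e = basePt → ∀ y, q y = proj e →
      ∃ P : Cover → Y, Continuous P ∧ (∀ e, q (P e) = proj e) ∧ P e = y := by
    intro e he y hy
    refine ⟨liftCover hq ⟨y, hy.trans he⟩ ∘ deck (coord e)⁻¹,
      (continuous_liftCover hq _).comp (continuous_deck _), fun e => ?_, ?_⟩
    · exact proj_liftCover hq _ _
    · have : deck (coord e)⁻¹ e = pt basePt 1 := by simp [deck, he]
      rw [Function.comp_apply, this, liftCover_base]
  have h1 : ∀ e : Cover, proj e ∈ piece none → ∀ y, q y = proj e →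
      ∃ P : Cover → Y, Continuous P ∧ (∀ e, q (P e) = proj e) ∧ P e = y := by
    intro e he y hy
    have hm := proj_sect isCoveringMap_proj he basePt_mem
    have := exists_lift_sect hq (h0 _ hm)
      (proj_sect_mem isCoveringMap_proj he basePt_mem basePt_mem) he y hy
    rwa [sect_sect isCoveringMap_proj he basePt_mem he, sect_self isCoveringMap_proj he] at this
  have hx := core.mem_baseSet_at (proj e)
  rcases hi : core.indexAt (proj e) with _ | i
  · rw [hi] at hx
    exact h1 e hx y h
  · rw [hi] at hx
    have hx' : proj e ∈ piece (some i) := hx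
    have hm := proj_sect_mem isCoveringMap_proj hx' (corner_mem_some i 1) (corner_mem_none i 1)
    have := exists_lift_sect hq (h1 _ hm)
      (proj_sect_mem isCoveringMap_proj hx' (corner_mem_some i 1) (corner_mem_some i 1)) hx' y h
    rwa [sect_sect isCoveringMap_proj hx' (corner_mem_some i 1) hx',
      sect_self isCoveringMap_proj hx'] at this

end TwicePunctured

namespace TwicePunctured

open FreeGroup

/-- The parametrisation of a punctured neighbourhood of the puncture with index `i` by a left
half-plane. -/
noncomputable def cuspMap (i : Bool) (w : ℂ) : ℂ := cond i (1 - Complex.exp w) (Complex.exp w)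

theorem cuspMap_add (i : Bool) (w : ℂ) : cuspMap i (w + 2 * π * I) = cuspMap i w := by
  cases i <;> simp [cuspMap, Complex.exp_add]

theorem continuous_cuspMap (i : Bool) : Continuous (cuspMap i) := by
  cases i
  · exact Complex.continuous_exp
  · exact continuous_const.sub Complex.continuous_exp

theorem coord_mul_cocycle_eq {T : Set ℂ} (hT : IsPreconnected T) {l : ℂ → Cover}
    (hl : ContinuousOn l T) {i : Option Bool} (hi : ∀ w ∈ T, proj (l w) ∈ piece i) {w w' : ℂ}
    (hw : w ∈ T) (hw' : w' ∈ T) :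
    coord (l w) * cocycle i (proj (l w)) = coord (l w') * cocycle i (proj (l w')) := by
  have h := (core.localTriv i).continuousOn.comp hl
    fun w hw => (core.mem_localTriv_source i (l w)).2 (hi w hw)
  have h2 := hT.constant (continuous_snd.comp_continuousOn h) hw hw'
  simpa only [Function.comp_apply, localTriv_apply] using h2

theorem cuspMap_mem_none {i : Bool} {w : ℂ} (hw : w.re < 0) (h1 : -π < w.im) (h2 : w.im < π)
    {x : Base} (hx : x.1 = cuspMap i w) : x ∈ piece none := by
  change x.1.im ≠ 0 ∨ 0 < x.1.re ∧ x.1.re < 1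
  rw [hx]
  by_cases h0 : w.im = 0
  · right
    have h3 := Real.exp_pos w.re
    have h4 := Real.exp_lt_one_iff.2 hw
    cases i <;> simp [cuspMap, Complex.exp_re, h0, hw, h3]
  · left
    have h3 : Real.sin w.im ≠ 0 := by
      rw [Ne, Real.sin_eq_zero_iff_of_lt_of_lt h1 h2]
      exact h0
    cases i <;> simp [cuspMap, Complex.exp_im, h3, (Real.exp_pos w.re).ne']

theorem cuspMap_mem_some {i : Bool} {w : ℂ} (h1 : π / 2 < w.im) (h2 : w.im < 3 * π / 2)
    {x : Base} (hx : x.1 = cuspMap i w) : x ∈ piece (some i) := by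
  have h3 : Real.cos w.im < 0 :=
    Real.cos_neg_of_pi_div_two_lt_of_lt h1 (by linarith)
  have h4 := mul_neg_of_pos_of_neg (Real.exp_pos w.re) h3
  cases i
  · change x.1.re < 0
    rw [hx]
    simpa [cuspMap, Complex.exp_re] using h4
  · change 1 < x.1.re
    rw [hx]
    simp only [cuspMap, cond_true, Complex.sub_re, Complex.one_re, Complex.exp_re]
    linarith

theorem convex_strip (a b : ℝ) : Convex ℝ {w : ℂ | w.re < 0 ∧ a < w.im ∧ w.im < b} :=
  (convex_halfSpace_re_lt 0).inter ((convex_halfSpace_im_gt a).inter (convex_halfSpace_im_lt b))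

theorem exists_peripheral {i : Bool} {l : ℂ → Cover} (hl : ContinuousOn l {w | w.re < 0})
    (hproj : ∀ w : ℂ, w.re < 0 → (proj (l w)).1 = cuspMap i w) :
    ∃ (u : FreeGroup Bool) (ε : ℤˣ), ∀ w : ℂ, w.re < 0 →
      l (w + 2 * π * I) = deck (u * of i ^ (ε : ℤ) * u⁻¹) (l w) := by
  have hπ := Real.pi_pos
  have hper : ∀ w : ℂ, w.re < 0 → proj (l (w + 2 * π * I)) = proj (l w) := fun w hw =>
    Subtype.ext (by rw [hproj w hw, hproj _ (by simpa using hw), cuspMap_add])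
  obtain ⟨g, hg⟩ := exists_deck_eq (hper (-1) (by simp)).symm
  have hall : ∀ w : ℂ, w.re < 0 → l (w + 2 * π * I) = deck g (l w) := by
    intro w hw
    refine isCoveringMap_proj.eqOn_of_comp_eqOn (g₁ := fun w => l (w + 2 * π * I))
      (g₂ := fun w => deck g (l w)) (convex_halfSpace_re_lt 0).isPreconnected ?_ ?_ ?_
      (a := -1) (by simp) hg.symm hw
    · exact hl.comp (by fun_prop) fun w hw => by simpa using hw
    · exact (continuous_deck g).comp_continuousOn hl
    · intro w hw
      exact hper w hw
  have hnone : ∀ w w' : ℂ, w.re < 0 → -π < w.im → w.im < π → w'.re < 0 → -π < w'.im →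
      w'.im < π → coord (l w) = coord (l w') := by
    intro w w' h1 h2 h3 h4 h5 h6
    have := coord_mul_cocycle_eq (i := none) (convex_strip (-π) π).isPreconnected
      (hl.mono fun w hw => hw.1) (fun w hw => cuspMap_mem_none hw.1 hw.2.1 hw.2.2
        (hproj w hw.1)) (w := w) (w' := w') ⟨h1, h2, h3⟩ ⟨h4, h5, h6⟩
    simpa [cocycle] using this
  have hnone' : ∀ w w' : ℂ, w.re < 0 → π < w.im → w.im < 3 * π → w'.re < 0 → π < w'.im →
      w'.im < 3 * π → coord (l w) = coord (l w') := by
    intro w w' h1 h2 h3 h4 h5 h6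
    have := coord_mul_cocycle_eq (i := none) (convex_strip π (3 * π)).isPreconnected
      (hl.mono fun w hw => hw.1) (fun w hw => cuspMap_mem_none (i := i) (w := w - 2 * π * I)
        (by simpa using hw.1) (by simpa using by linarith [hw.2.1])
        (by simpa using by linarith [hw.2.2])
        (by rw [hproj w hw.1, ← cuspMap_add i (w - _), sub_add_cancel]))
      (w := w) (w' := w') ⟨h1, h2, h3⟩ ⟨h4, h5, h6⟩
    simpa [cocycle] using this
  have hsome := coord_mul_cocycle_eq (i := some i) (convex_strip (π / 2) (3 * π / 2)).isPreconnected
      (hl.mono fun w hw => hw.1) (fun w hw => cuspMap_mem_some hw.2.1 hw.2.2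
        (hproj w hw.1)) (w := ⟨-1, 3 * π / 4⟩) (w' := ⟨-1, 5 * π / 4⟩)
        ⟨by norm_num, by dsimp only; linarith, by dsimp only; linarith⟩
        ⟨by norm_num, by dsimp only; linarith, by dsimp only; linarith⟩
  rw [← hnone (-1) ⟨-1, 3 * π / 4⟩ (by norm_num) (by simpa) (by simpa) (by norm_num)
      (by dsimp only; linarith) (by dsimp only; linarith),
    ← hnone' (-1 + 2 * π * I) ⟨-1, 5 * π / 4⟩ (by norm_num) (by simp; linarith)
      (by simp; linarith) (by norm_num) (by dsimp only; linarith) (by dsimp only; linarith),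
    hall (-1) (by simp)] at hsome
  have hs1 : 0 < Real.sin (3 * π / 4) := Real.sin_pos_of_pos_of_lt_pi (by linarith) (by linarith)
  have hs2 : Real.sin (5 * π / 4) < 0 := by
    rw [show 5 * π / 4 = π / 4 + π by ring, Real.sin_add_pi]
    linarith [Real.sin_pos_of_pos_of_lt_pi (x := π / 4) (by linarith) (by linarith)]
  have he := Real.exp_pos (-1)
  have hc1 : cocycle (some i) (proj (l ⟨-1, 3 * π / 4⟩)) = cond i (of i)⁻¹ 1 := by
    have h := mul_pos he hs1
    cases i <;>
      simp [cocycle, hproj ⟨-1, 3 * π / 4⟩ (by norm_num), cuspMap, Complex.exp_im] <;> linarith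
  have hc2 : cocycle (some i) (proj (l ⟨-1, 5 * π / 4⟩)) = cond i 1 (of i)⁻¹ := by
    have h := mul_neg_of_pos_of_neg he hs2
    cases i <;>
      simp [cocycle, hproj ⟨-1, 5 * π / 4⟩ (by norm_num), cuspMap, Complex.exp_im] <;> linarith
  rw [hc1, hc2] at hsome
  change _ = g * coord (l (-1)) * _ at hsome
  refine ⟨coord (l (-1)), cond i (-1) 1, fun w hw => ?_⟩
  rw [hall w hw]
  congr 1
  rw [eq_mul_inv_iff_mul_eq]
  cases i
  · simp only [cond_false, mul_one] at hsome ⊢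
    rw [eq_mul_inv_iff_mul_eq] at hsome
    simpa using hsome.symm
  · simp only [cond_true, mul_one] at hsome ⊢
    simpa using hsome.symm

end TwicePunctured

/-- A function `h` preserves the orientation if `(p, w) ↦ h (p + exp w) - h p` has a continuous
logarithm which commutes with translation by `2πi` in `w`. -/
def PreservesOrientation (h : ℂ → ℂ) : Prop :=
  ∃ K : ℂ × ℂ → ℂ, Continuous K ∧ (∀ p w, Complex.exp (K (p, w)) = h (p + Complex.exp w) - h p) ∧
    ∀ p w, K (p, w + 2 * π * I) = K (p, w) + 2 * π * I

theorem exists_eq_int_mul_of_exp_eq_one {X : Type*} [TopologicalSpace X] [PreconnectedSpace X]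
    [Nonempty X] {D : X → ℂ} (hD : Continuous D) (h : ∀ x, Complex.exp (D x) = 1) :
    ∃ n : ℤ, ∀ x, D x = n * (2 * π * I) := by
  obtain ⟨x₀⟩ := ‹Nonempty X›
  obtain ⟨n, hn⟩ := Complex.exp_eq_one_iff.1 (h x₀)
  have := Complex.isCoveringMap_exp.eq_of_comp_eq hD (continuous_const (y := D x₀))
    (funext fun x => Subtype.ext ((h x).trans (h x₀).symm)) x₀ rfl
  exact ⟨n, fun x => by rw [congrFun this x, hn]⟩

theorem Homeomorph.exists_log_sub (h : ℂ ≃ₜ ℂ) :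
    ∃ (K : ℂ × ℂ → ℂ) (n : ℤ), Continuous K ∧
      (∀ p w, Complex.exp (K (p, w)) = h (p + Complex.exp w) - h p) ∧
      ∀ p w, K (p, w + 2 * π * I) = K (p, w) + n * (2 * π * I) := by
  have hsc : IsSimplyConnected (univ : Set (ℂ × ℂ)) := by
    have : ContractibleSpace (univ : Set (ℂ × ℂ)) := convex_univ.contractibleSpace univ_nonempty
    exact SimplyConnectedSpace.ofContractible _
  obtain ⟨K, hK, hexp⟩ := Complex.exists_continuousOn_eqOn_exp_comp hsc isOpen_univ
    (g := fun p => h (p.1 + Complex.exp p.2) - h p.1) (by fun_prop) (by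
      rintro ⟨p, -, hp⟩
      simp [sub_eq_zero] at hp)
  rw [continuousOn_univ] at hK
  have hexp' : ∀ p w, Complex.exp (K (p, w)) = h (p + Complex.exp w) - h p :=
    fun p w => hexp (mem_univ (p, w))
  obtain ⟨n, hn⟩ := exists_eq_int_mul_of_exp_eq_one
    (D := fun p : ℂ × ℂ => K (p.1, p.2 + 2 * π * I) - K (p.1, p.2)) (by fun_prop) (by
      rintro ⟨p, w⟩
      rw [Complex.exp_sub, hexp', hexp', Complex.exp_periodic, div_self]
      rw [← hexp']
      exact Complex.exp_ne_zero _)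
  exact ⟨K, n, hK, hexp', fun p w => by rw [← hn (p, w)]; simp⟩

theorem Homeomorph.preservesOrientation_or (h : ℂ ≃ₜ ℂ) :
    PreservesOrientation h ∨ PreservesOrientation fun z => starRingEnd ℂ (h z) := by
  obtain ⟨K, n, hK, hexp, hper⟩ := h.exists_log_sub
  obtain ⟨L, m, hL, hexp', hper'⟩ := h.symm.exists_log_sub
  have hper'' : ∀ p w, ∀ k : ℤ, L (p, w + k * (2 * π * I)) = L (p, w) + k * (m * (2 * π * I)) := by
    intro p w k
    induction k with
    | zero => simp
    | succ k ih =>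
      have := hper' p (w + k * (2 * π * I))
      push_cast at ih ⊢
      rw [ih] at this
      rw [add_mul, one_mul, ← add_assoc, this]
      ring
    | pred k ih =>
      have := hper' p (w + (-k - 1) * (2 * π * I))
      push_cast at ih ⊢
      rw [show w + (-(k : ℂ) - 1) * (2 * π * I) + 2 * π * I = w + -k * (2 * π * I) by ring, ih]
        at this
      linear_combination -this
  obtain ⟨c, hc⟩ := exists_eq_int_mul_of_exp_eq_one
    (D := fun w : ℂ => L (h 0, K (0, w)) - w) (by fun_prop) (fun w => by
      rw [Complex.exp_sub, hexp', hexp, add_sub_cancel]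
      simp)
  have h1 := hc (0 + 2 * π * I)
  have h0 := hc 0
  rw [hper, hper''] at h1
  have h2 : (n * m : ℂ) = 1 := by
    have h3 : (n * m : ℂ) * (2 * π * I) = 1 * (2 * π * I) := by linear_combination h1 - h0
    exact mul_right_cancel₀ Complex.two_pi_I_ne_zero h3
  have h3 : n * m = 1 := by exact_mod_cast h2
  rcases Int.isUnit_iff.1 (IsUnit.of_mul_eq_one _ h3) with rfl | rfl
  · exact Or.inl ⟨K, hK, hexp, fun p w => by simpa using hper p w⟩
  · refine Or.inr ⟨fun p => starRingEnd ℂ (K p), Complex.continuous_conj.comp hK, fun p w => ?_,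
      fun p w => ?_⟩
    · rw [Complex.exp_conj, hexp, map_sub]
    · dsimp only
      rw [hper]
      simp only [Int.cast_neg, Int.cast_one, map_add, map_mul, map_neg, map_one, Complex.conj_I,
        Complex.conj_ofReal, map_ofNat]
      ring

namespace TwicePunctured

open FreeGroup

theorem exists_cusp_lift {h : ℂ → ℂ} (hor : PreservesOrientation h) (h0 : h 0 = 0) (h1 : h 1 = 1)
    (i : Bool) : ∃ K : ℂ → ℂ, Continuous K ∧ (∀ w, h (cuspMap i w) = cuspMap i (K w)) ∧
      ∀ w, K (w + 2 * π * I) = K w + 2 * π * I := by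
  obtain ⟨K, hK, hexp, hper⟩ := hor
  cases i
  · refine ⟨fun w => K (0, w), by fun_prop, fun w => ?_, hper 0⟩
    simp [cuspMap, hexp, h0]
  · refine ⟨fun w => K (1, w + π * I) + π * I, by fun_prop, fun w => ?_, fun w => ?_⟩
    · simp [cuspMap, Complex.exp_add, hexp, h1, sub_eq_add_neg]
    · dsimp only
      rw [add_right_comm w, hper]
      ring

end TwicePunctured

namespace TwicePunctured

open FreeGroup

theorem cuspMap_mem (i : Bool) {w : ℂ} (hw : w.re < 0) : cuspMap i w ∈ ({0, 1}ᶜ : Set ℂ) := by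
  have h1 : Complex.exp w ≠ 1 := fun h => by
    have := congrArg (‖·‖) h
    simp only [Complex.norm_exp, NormOneClass.norm_one, Real.exp_eq_one_iff] at this
    exact hw.ne this
  have h0 := Complex.exp_ne_zero w
  cases i <;> simp [cuspMap, h0, h1, sub_eq_zero, Ne.symm h1]

theorem exists_lift_cuspMap (i : Bool) : ∃ l : ℂ → Cover, ContinuousOn l {w | w.re < 0} ∧
    ∀ w : ℂ, w.re < 0 → (proj (l w)).1 = cuspMap i w := by
  classical
  let T : Set ℂ := {w | w.re < 0}
  have hT : Convex ℝ T := convex_halfSpace_re_lt 0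
  have hTo : IsOpen T := isOpen_lt Complex.continuous_re continuous_const
  have hne : (-1 : ℂ) ∈ T := by simp [T]
  have h1 : ContractibleSpace T := hT.contractibleSpace ⟨_, hne⟩
  have h3 : LocallyPathConnectedSpace T := hTo.locallyPathConnectedSpace
  let F : C(T, Base) := ⟨fun w => ⟨cuspMap i w, cuspMap_mem i w.2⟩,
    ((continuous_cuspMap i).comp continuous_subtype_val).subtype_mk _⟩
  obtain ⟨L, ⟨-, hL⟩, -⟩ := isCoveringMap_proj.existsUnique_continuousMap_lifts F ⟨_, hne⟩
    (pt (F ⟨_, hne⟩) 1) rfl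
  refine ⟨fun w => if h : w ∈ T then L ⟨w, h⟩ else L ⟨_, hne⟩, ?_, fun w hw => ?_⟩
  · rw [continuousOn_iff_continuous_domRestrict]
    refine L.continuous.congr fun x => ?_
    have hx : x.1 ∈ T := x.2
    simp [T, show x.1.re < 0 from hx]
  · have hw' : w ∈ T := hw
    simp only [hw', dif_pos]
    exact congrArg Subtype.val (congrFun hL ⟨w, hw'⟩)

theorem exists_re_lt {h : ℂ → ℂ} (hc : Continuous h) (h0 : h 0 = 0) (h1 : h 1 = 1) (i : Bool)
    {K : ℂ → ℂ} (hK : ∀ w, h (cuspMap i w) = cuspMap i (K w)) :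
    ∃ c < 0, ∀ w : ℂ, w.re < c → (K w).re < 0 := by
  have hp : h (cond i 1 0) = cond i 1 0 := by cases i <;> simp [h0, h1]
  have hn : ∀ w, ‖cuspMap i w - cond i 1 0‖ = Real.exp w.re := by
    intro w
    cases i <;> simp [cuspMap, Complex.norm_exp]
  obtain ⟨δ, hδ, H⟩ := Metric.continuous_iff.1 hc (cond i 1 0) 1 one_pos
  refine ⟨min (-1) (Real.log δ), min_lt_of_left_lt (by norm_num), fun w hw => ?_⟩
  have := H (cuspMap i w) (by
    rw [dist_eq_norm, hn, ← Real.lt_log_iff_exp_lt hδ]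
    exact hw.trans_le (min_le_right _ _))
  rwa [hp, hK, dist_eq_norm, hn, Real.exp_lt_one_iff] at this

theorem exists_eq_conj_of_equivariant {h : ℂ → ℂ} (hc : Continuous h) (hor : PreservesOrientation h)
    (h0 : h 0 = 0) (h1 : h 1 = 1) {k : Cover → Cover} (hk : Continuous k)
    (hkp : ∀ e, (proj (k e)).1 = h (proj e).1) {β : FreeGroup Bool →* FreeGroup Bool}
    (hβ : ∀ g e, k (deck g e) = deck (β g) (k e)) (i : Bool) :
    ∃ v, β (of i) = v * of i * v⁻¹ := by
  obtain ⟨l, hl, hlp⟩ := exists_lift_cuspMap i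
  obtain ⟨u, ε, hu⟩ := exists_peripheral hl hlp
  obtain ⟨K, hKc, hK, hper⟩ := exists_cusp_lift hor h0 h1 i
  obtain ⟨c, hc0, hc⟩ := exists_re_lt hc h0 h1 i hK
  let T : Set ℂ := {w | w.re < c}
  have hT : IsPreconnected T := (convex_halfSpace_re_lt c).isPreconnected
  have hlift : ∀ w ∈ T, proj (k (l w)) = proj (l (K w)) := fun w hw => Subtype.ext <| by
    rw [hkp, hlp _ (hw.trans hc0), hK, hlp _ (hc w hw)]
  let w₀ : ℂ := ((c - 1 : ℝ) : ℂ)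
  have hw₀ : w₀ ∈ T := by simp [w₀, T]
  have hw₁ : w₀ + 2 * π * I ∈ T := by simp [w₀, T]
  obtain ⟨d, hd⟩ := exists_deck_eq (hlift w₀ hw₀)
  have hE := isCoveringMap_proj.eqOn_of_comp_eqOn hT (g₁ := fun w => deck d (k (l w)))
    (g₂ := fun w => l (K w))
    (((continuous_deck d).comp hk).comp_continuousOn (hl.mono fun w hw => hw.trans hc0))
    (hl.comp hKc.continuousOn hc) (fun w hw => hlift w hw) hw₀ hd
  have h2 : deck d (k (l (w₀ + 2 * π * I))) = l (K (w₀ + 2 * π * I)) := hE hw₁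
  rw [hu _ (hw₀.trans hc0), hβ, hper, hu _ (hc w₀ hw₀), ← hd, deck_deck, deck_deck] at h2
  have h3 := deck_injective h2
  refine ⟨(β u)⁻¹ * d⁻¹ * u, ?_⟩
  have h4 : β (of i) ^ (ε : ℤ) =
      ((β u)⁻¹ * d⁻¹ * u) * of i ^ (ε : ℤ) * ((β u)⁻¹ * d⁻¹ * u)⁻¹ := by
    rw [MonoidHom.map_mul, MonoidHom.map_mul, MonoidHom.map_zpow, MonoidHom.map_inv] at h3
    have : β (of i) ^ (ε : ℤ) =
        (β u)⁻¹ * d⁻¹ * (d * (β u * β (of i) ^ (ε : ℤ) * (β u)⁻¹)) * β u := by group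
    rw [this, h3]
    group
  rcases Int.units_eq_one_or ε with rfl | rfl
  · simpa using h4
  · rw [← conj_zpow] at h4
    simpa only [Units.val_neg, Units.val_one, zpow_neg, zpow_one, inv_inj] using h4

theorem exists_equivariant_lift (h : ℂ ≃ₜ ℂ) (hor : PreservesOrientation h) (h0 : h 0 = 0)
    (h1 : h 1 = 1) : ∃ k : Cover → Cover, Continuous k ∧ (∀ e, (proj (k e)).1 = h (proj e).1) ∧
      ∀ g e, k (deck g e) = deck g (k e) := by
  let hB : Base ≃ₜ Base := h.subtype fun x => by
    rw [mem_compl_iff, mem_compl_iff, not_iff_not]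
    simp only [mem_insert_iff, mem_singleton_iff]
    rw [← h.injective.eq_iff (a := x) (b := 0), ← h.injective.eq_iff (a := x) (b := 1), h0, h1]
  have hBv : ∀ x, (hB x).1 = h x.1 := fun x => rfl
  have lift : ∀ (H : Base ≃ₜ Base) (e e' : Cover), proj e' = H (proj e) →
      ∃ P : Cover → Cover, Continuous P ∧ (∀ e, proj (P e) = H (proj e)) ∧ P e = e' := by
    intro H e e' he
    obtain ⟨P, hP, hPp, hPe⟩ := exists_lift (isCoveringMap_proj.homeomorph_comp H.symm)
      (e := e) (y := e') (by simp [he])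
    refine ⟨P, hP, fun e => ?_, hPe⟩
    rw [← hPp e]
    simp
  let e₀ : Cover := pt basePt 1
  obtain ⟨k, hk, hkp, hke⟩ := lift hB e₀ (pt (hB (proj e₀)) 1) rfl
  obtain ⟨k', hk', hkp', hke'⟩ := lift hB.symm (k e₀) e₀ (by rw [hkp]; simp)
  have hkk' : k ∘ k' = id := isCoveringMap_proj.eq_of_comp_eq (hk.comp hk') continuous_id
    (funext fun e => by simp [hkp, hkp']) (k e₀) (by simp [hke'])
  have key : ∀ g : FreeGroup Bool, ∃ g', ∀ e, k (deck g e) = deck g' (k e) := by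
    intro g
    obtain ⟨g', hg'⟩ := exists_deck_eq (e := k e₀) (e' := k (deck g e₀)) (by simp [hkp])
    exact ⟨g', congrFun (isCoveringMap_proj.eq_of_comp_eq (g₁ := k ∘ deck g) (g₂ := deck g' ∘ k)
      (hk.comp (continuous_deck g)) ((continuous_deck g').comp hk)
      (funext fun e => by simp [hkp]) e₀ hg'.symm)⟩
  choose b hb using key
  let β : FreeGroup Bool →* FreeGroup Bool := MonoidHom.mk' b fun x y => by
    apply deck_injective (e := k e₀)
    rw [← hb, ← deck_deck, hb, hb, deck_deck]
  have hβ : ∀ g e, k (deck g e) = deck (β g) (k e) := hb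
  have hs : Function.Surjective β := fun g => by
    obtain ⟨g', hg'⟩ := exists_deck_eq (e := e₀) (e' := k' (deck g (k e₀))) (by
      rw [hkp', proj_deck, hkp]; simp)
    refine ⟨g', deck_injective (e := k e₀) ?_⟩
    rw [← hβ, hg']
    exact congrFun hkk' _
  obtain ⟨u, hu⟩ := exists_eq_conj_of_equivariant h.continuous hor h0 h1 hk
    (fun e => by rw [hkp, hBv]) hβ false
  obtain ⟨v, hv⟩ := exists_eq_conj_of_equivariant h.continuous hor h0 h1 hk
    (fun e => by rw [hkp, hBv]) hβ true
  obtain ⟨w, hw⟩ := FreeGroup.exists_eq_conj_of_surjective β hs hu hv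
  refine ⟨fun e => deck w⁻¹ (k e), (continuous_deck _).comp hk, fun e => ?_, fun g e => ?_⟩
  · rw [proj_deck, hkp, hBv]
  · dsimp only
    rw [hβ, hw, deck_deck, deck_deck]
    congr 1
    group

end TwicePunctured

theorem IsCoveringMap.surjective_of_comp {E Y B : Type*} [TopologicalSpace E] [TopologicalSpace Y]
    [TopologicalSpace B] [Nonempty E] [PathConnectedSpace Y] {q : E → B} {p : Y → B} {P : E → Y}
    (hq : IsCoveringMap q) (hp : IsCoveringMap p) (hP : Continuous P) (h : ∀ e, p (P e) = q e) :
    Function.Surjective P := by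
  intro y
  obtain ⟨e₀⟩ := ‹Nonempty E›
  let γ := PathConnectedSpace.somePath (P e₀) y
  obtain ⟨Γ, hΓ, hΓ0⟩ := hq.exists_path_lifts (ContinuousMap.comp ⟨p, hp.continuous⟩ γ) e₀
    (by simp [h])
  have := hp.eq_of_comp_eq (g₁ := P ∘ Γ) (g₂ := γ) (hP.comp Γ.continuous) γ.continuous
    (funext fun t => (h _).trans (congrFun hΓ t)) 0 (by simp [hΓ0])
  exact ⟨Γ 1, (congrFun this 1).trans γ.target⟩

namespace TwicePunctured

theorem eq_iff_deck {Y : Type*} [TopologicalSpace Y] {p : Y → Base} (hp : IsCoveringMap p)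
    {P : Cover → Y} (hP : Continuous P) (h : ∀ e, p (P e) = proj e) (g : FreeGroup Bool)
    (e e' : Cover) : P (deck g e) = P e ↔ P (deck g e') = P e' := by
  have key : ∀ e e' : Cover, P (deck g e) = P e → P (deck g e') = P e' := fun e e' he =>
    congrFun (hp.eq_of_comp_eq (g₁ := P ∘ deck g) (hP.comp (continuous_deck g)) hP
      (funext fun x => by simp [h]) e he) e'
  exact ⟨key e e', key e' e⟩

theorem exists_lift_of_conj {X Y : Type*} [TopologicalSpace X] [TopologicalSpace Y]
    [PathConnectedSpace X] {p : X → Base} {q : Y → Base} (hp : IsCoveringMap p)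
    (φ : X ≃ₜ Y) (h : ℂ ≃ₜ ℂ)
    (hor : PreservesOrientation h)
    (h0 : h 0 = 0) (h1 : h 1 = 1) (hφ : ∀ x, h (p x).1 = (q (φ x)).1) :
    ∃ θ : X → Y, Continuous θ ∧ Function.Bijective θ ∧ ∀ x, q (θ x) = p x := by
  obtain ⟨k, hk, hkp, hkd⟩ := exists_equivariant_lift h hor h0 h1
  obtain ⟨x₀⟩ : Nonempty X := inferInstance
  obtain ⟨P, hP, hPp, -⟩ := exists_lift hp (e := pt (p x₀) 1) (y := x₀) rfl
  have : Nonempty Cover := ⟨pt basePt 1⟩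
  have hPs : Function.Surjective P := isCoveringMap_proj.surjective_of_comp hp hP hPp
  let hB : Base ≃ₜ Base := h.subtype fun x => by
    rw [mem_compl_iff, mem_compl_iff, not_iff_not]
    simp only [mem_insert_iff, mem_singleton_iff]
    rw [← h.injective.eq_iff (a := x) (b := 0), ← h.injective.eq_iff (a := x) (b := 1), h0, h1]
  have hBv : ∀ e, proj (k e) = hB (proj e) := fun e => Subtype.ext (hkp e)
  have hcov : IsCoveringMap (fun e => hB (proj e)) := isCoveringMap_proj.homeomorph_comp hB
  have hPk : ∀ e, p (P (k e)) = hB (proj e) := fun e => (hPp _).trans (hBv e)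
  have hPks : Function.Surjective (P ∘ k) :=
    hcov.surjective_of_comp hp (hP.comp hk) hPk
  have hloc : IsLocalHomeomorph (P ∘ k) := IsLocalHomeomorph.of_comp (g := p)
    (by
      have : p ∘ (P ∘ k) = fun e => hB (proj e) := funext hPk
      rw [this]
      exact hcov.isLocalHomeomorph) hp.isLocalHomeomorph (hP.comp hk)
  have hquot : IsQuotientMap (P ∘ k) := hloc.isOpenMap.isQuotientMap (hP.comp hk) hPks
  have hfib : ∀ e e', P (k e) = P (k e') ↔ P e = P e' := by
    intro e e'
    have hproj : (P (k e) = P (k e') ∨ P e = P e') → proj e = proj e' := by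
      rintro (h | h)
      · apply hB.injective
        rw [← hPk, ← hPk, h]
      · rw [← hPp, ← hPp, h]
    constructor <;> intro H
    · obtain ⟨g, rfl⟩ := exists_deck_eq (hproj (Or.inl H))
      rw [hkd, eq_comm, eq_iff_deck hp hP hPp g _ e] at H
      exact H.symm
    · obtain ⟨g, rfl⟩ := exists_deck_eq (hproj (Or.inr H))
      rw [eq_comm, eq_iff_deck hp hP hPp g _ (k e), ← hkd] at H
      exact H.symm
  choose s hs' using hPks
  have hsk : ∀ e, P (s (P (k e))) = P e := fun e => (hfib _ _).1 (hs' (P (k e)))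
  refine ⟨fun x => φ (P (s x)), ?_, ⟨fun x x' hx => ?_, fun y => ?_⟩, fun x => ?_⟩
  · rw [hquot.continuous_iff]
    exact (φ.continuous.comp hP).congr fun e => by simp [hsk]
  · have := φ.injective hx
    rw [← hfib] at this
    exact (hs' x).symm.trans (this.trans (hs' x'))
  · obtain ⟨e, he⟩ := hPs (φ.symm y)
    exact ⟨P (k e), by simp [hsk, he]⟩
  · apply Subtype.ext
    rw [← hφ, hPp, ← hkp, ← hPp]
    exact congrArg (fun x => (p x).1) (hs' x)

end TwicePunctured

theorem isCoveringMapOn_singularSet_compl {f : ℂ → ℂ} (hf : Continuous f) :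
    IsCoveringMapOn f (singularSet f)ᶜ := by
  intro w hw
  obtain ⟨U, hU, hwU, h⟩ : IsRegularValue f w := by
    by_contra h
    exact hw h
  rcases (f ⁻¹' U).eq_empty_or_nonempty with hne | ⟨z₀, hz₀⟩
  · exact (IsEvenlyCovered.of_preimage_eq_empty Empty (hU.mem_nhds hwU)
      hne).to_isEvenlyCovered_preimage
  let C : f ⁻¹' U → Set ℂ := fun z => connectedComponentIn (f ⁻¹' U) z
  have hC : ∀ z, IsOpen (C z) := fun z => (hU.preimage hf).connectedComponentIn
  have hsub : ∀ z, C z ⊆ f ⁻¹' U := fun z => connectedComponentIn_subset _ _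
  let ι : Type := range C
  let _ : TopologicalSpace ι := ⊥
  have : DiscreteTopology ι := ⟨rfl⟩
  have : Nonempty ι := ⟨⟨_, ⟨z₀, hz₀⟩, rfl⟩⟩
  have hinj : ∀ z, InjOn f (C z) := by
    intro z x hx y hy hxy
    obtain ⟨e, he⟩ := h z z.2
    have : e ⟨x, hx⟩ = e ⟨y, hy⟩ := Subtype.ext (by rw [he, he, hxy])
    exact congrArg Subtype.val (e.injective this)
  have hsurj : ∀ z, SurjOn f (C z) U := by
    intro z y hy
    obtain ⟨e, he⟩ := h z z.2
    exact ⟨e.symm ⟨y, hy⟩, (e.symm ⟨y, hy⟩).2, by rw [← he]; simp⟩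
  let t : Bundle.Trivialization ι f := IsOpen.trivializationDiscrete (f := f) (fun i : ι => i.1) U hU
    (by
      rintro ⟨_, z, rfl⟩ W hW
      refine ⟨fun ho => (ho.preimage hf).inter (hC z), fun ho => ?_⟩
      obtain ⟨e, he⟩ := h z z.2
      have h1 : IsOpen (Subtype.val '' (e '' (Subtype.val ⁻¹' (f ⁻¹' W ∩ C z))) : Set ℂ) :=
        hU.isOpenMap_subtype_val _ (e.isOpenMap _ (ho.preimage continuous_subtype_val))
      convert h1
      ext y
      constructor
      · intro hy
        obtain ⟨x, hx, rfl⟩ := hsurj z (hW hy)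
        exact ⟨e ⟨x, hx⟩, ⟨⟨x, hx⟩, ⟨hy, hx⟩, rfl⟩, he _⟩
      · rintro ⟨_, ⟨x, ⟨hx, -⟩, rfl⟩, rfl⟩
        rw [he]
        exact hx)
    (by rintro ⟨_, z, rfl⟩; exact hinj z)
    (by rintro ⟨_, z, rfl⟩; exact hsurj z)
    (by
      rintro ⟨_, z, rfl⟩ ⟨_, z', rfl⟩ hne
      refine disjoint_left.2 fun x hx hx' => hne (Subtype.ext ?_)
      exact (connectedComponentIn_eq hx).trans (connectedComponentIn_eq hx').symm)
    (fun x hx => mem_iUnion.2 ⟨⟨_, ⟨x, hx⟩, rfl⟩, mem_connectedComponentIn hx⟩)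
  exact (IsEvenlyCovered.of_trivialization (t := t) hwU).to_isEvenlyCovered_preimage

theorem eventually_notMem_nhds {E : Set ℂ} (hE : ∀ z, ∀ᶠ w in 𝓝[≠] z, w ∉ E) {z : ℂ} (hz : z ∉ E) :
    ∀ᶠ w in 𝓝 z, w ∉ E := by
  filter_upwards [eventually_nhdsWithin_iff.1 (hE z)] with w hw
  by_cases h : w = z
  · rwa [h]
  · exact hw h

theorem dense_compl_of_eventually_notMem {E : Set ℂ} (hE : ∀ z, ∀ᶠ w in 𝓝[≠] z, w ∉ E) :
    Dense Eᶜ := fun z =>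
  mem_closure_iff_frequently.2 ((hE z).frequently.filter_mono nhdsWithin_le_nhds)

theorem Differentiable.eventually_ne {g : ℂ → ℂ} (hg : Differentiable ℂ g)
    (hc : ¬ ∃ c, ∀ z, g z = c) (c z : ℂ) : ∀ᶠ w in 𝓝[≠] z, g w ≠ c := by
  rcases (hg.analyticAt z).eventually_eq_or_eventually_ne (analyticAt_const (v := c)) with h | h
  · refine absurd ⟨c, fun w => ?_⟩ hc
    have h1 : AnalyticOnNhd ℂ g univ := fun w _ => hg.analyticAt w
    exact h1.eqOn_of_preconnected_of_eventuallyEq (fun w _ => analyticAt_const) isPreconnected_univ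
      (mem_univ z) h (mem_univ w)
  · exact h

theorem Differentiable.eventually_deriv_ne_zero {g : ℂ → ℂ} (hg : Differentiable ℂ g)
    (hc : ¬ ∃ c, ∀ z, g z = c) (z : ℂ) : ∀ᶠ w in 𝓝[≠] z, _root_.deriv g w ≠ 0 := by
  have hd : AnalyticOnNhd ℂ (_root_.deriv g) univ := fun w _ => (hg.analyticAt w).deriv
  rcases (hd z (mem_univ z)).eventually_eq_or_eventually_ne (analyticAt_const (v := 0)) with h | h
  · refine absurd ⟨g 0, fun w => is_const_of_deriv_eq_zero hg (fun w => ?_) w 0⟩ hc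
    exact hd.eqOn_of_preconnected_of_eventuallyEq (fun w _ => analyticAt_const)
      isPreconnected_univ (mem_univ z) h (mem_univ w)
  · exact h

theorem Differentiable.exists_eq_const_of_eventually_norm_le {g : ℂ → ℂ} (hg : Differentiable ℂ g)
    {C : ℝ} (hC : ∀ᶠ z in cocompact ℂ, ‖g z‖ ≤ C) : ∃ c, ∀ z, g z = c := by
  refine hg.exists_const_forall_eq_of_bounded ?_
  obtain ⟨K, hK, hK'⟩ := mem_cocompact.1 hC
  obtain ⟨B, hB⟩ := hK.exists_bound_of_continuousOn hg.continuous.continuousOn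
  refine isBounded_iff_forall_norm_le.2 ⟨max B C, ?_⟩
  rintro _ ⟨w, rfl⟩
  by_cases hw : w ∈ K
  · exact (hB w hw).trans (le_max_left _ _)
  · exact (hK' hw).trans (le_max_right _ _)

section

variable {E : Set ℂ} {f g θ : ℂ → ℂ}

theorem differentiableAt_of_comp_eq (hE : ∀ z, ∀ᶠ w in 𝓝[≠] z, w ∉ E) (hf : Differentiable ℂ f)
    (hg : Differentiable ℂ g) (hg' : ∀ z, ∀ᶠ w in 𝓝[≠] z, deriv g w ≠ 0)
    (hθ : ∀ z ∉ E, ContinuousAt θ z) (hinj : InjOn θ Eᶜ) (hfg : ∀ z ∉ E, g (θ z) = f z) {z : ℂ}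
    (hz : z ∉ E) : DifferentiableAt ℂ θ z := by
  have key : ∀ z ∉ E, deriv g (θ z) ≠ 0 → DifferentiableAt ℂ θ z := by
    intro z hz hd
    have hs : HasStrictDerivAt g (deriv g (θ z)) (θ z) :=
      (hg.analyticAt (θ z)).hasStrictDerivAt
    have h1 : θ =ᶠ[𝓝 z] fun w => hs.localInverse g _ _ hd (f w) := by
      filter_upwards [(hθ z hz).eventually (hs.eventually_left_inverse hd),
        eventually_notMem_nhds hE hz] with w hw hw'
      rw [← hfg w hw', hw]
    refine DifferentiableAt.congr_of_eventuallyEq ?_ h1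
    have h2 := (hs.to_localInverse hd).hasDerivAt.differentiableAt
    rw [hfg z hz] at h2
    exact h2.comp z (hf z)
  refine (analyticAt_of_differentiable_on_punctured_nhds_of_continuousAt ?_
    (hθ z hz)).differentiableAt
  have h1 : Tendsto θ (𝓝[≠] z) (𝓝[≠] (θ z)) := by
    refine tendsto_nhdsWithin_iff.2 ⟨(hθ z hz).mono_left nhdsWithin_le_nhds, ?_⟩
    filter_upwards [hE z, self_mem_nhdsWithin] with w hw hw'
    exact fun h => hw' (hinj hw hz h)
  filter_upwards [hE z, h1.eventually (hg' _)] with w hw hw'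
  exact key w hw hw'

theorem nhds_le_map_of_injOn (hE : ∀ z, ∀ᶠ w in 𝓝[≠] z, w ∉ E)
    (hθ : ∀ z ∉ E, DifferentiableAt ℂ θ z) (hinj : InjOn θ Eᶜ) {z : ℂ} (hz : z ∉ E) :
    𝓝 (θ z) ≤ map θ (𝓝 z) := by
  have ha : AnalyticAt ℂ θ z := analyticAt_of_differentiable_on_punctured_nhds_of_continuousAt
    ((hE z).mono hθ) (hθ z hz).continuousAt
  refine ha.eventually_constant_or_nhds_le_map_nhds.resolve_left fun h => ?_
  obtain ⟨w, hw, hw', hw''⟩ := ((h.filter_mono nhdsWithin_le_nhds).and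
    ((hE z).and self_mem_nhdsWithin)).exists
  exact hw'' (hinj hw' hz hw)

theorem exists_tendsto_of_injOn (hE : ∀ z, ∀ᶠ w in 𝓝[≠] z, w ∉ E) (hf : Differentiable ℂ f)
    (hg : Differentiable ℂ g) (hc : ¬ ∃ c, ∀ z, g z = c)
    (hθ : ∀ z ∉ E, DifferentiableAt ℂ θ z) (hinj : InjOn θ Eᶜ) (hfg : ∀ z ∉ E, g (θ z) = f z)
    (e : ℂ) : ∃ ℓ, Tendsto θ (𝓝[≠] e) (𝓝 ℓ) := by
  obtain ⟨x, hx, hxe⟩ := ((hE e).and self_mem_nhdsWithin).exists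
  obtain ⟨V, W, hV, hW, hxV, heW, hVW⟩ := t2_separation hxe
  have hVn : θ '' (V ∩ Eᶜ) ∈ 𝓝 (θ x) := nhds_le_map_of_injOn hE hθ hinj hx
    (image_mem_map (inter_mem (hV.mem_nhds hxV) (eventually_notMem_nhds hE hx)))
  obtain ⟨r, hr, hball⟩ := Metric.mem_nhds_iff.1 hVn
  have hfar : ∀ᶠ z in 𝓝[≠] e, r ≤ ‖θ z - θ x‖ := by
    filter_upwards [hE e, mem_nhdsWithin_of_mem_nhds (hW.mem_nhds heW)] with z hz hzW
    by_contra! hlt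
    obtain ⟨y, ⟨hyV, hyE⟩, hy⟩ := hball (mem_ball_iff_norm.2 hlt)
    rw [hinj hyE hz hy] at hyV
    exact disjoint_left.1 hVW hyV hzW
  let u : ℂ → ℂ := fun z => (θ z - θ x)⁻¹
  have hne : ∀ᶠ z in 𝓝[≠] e, u z ≠ 0 := by
    filter_upwards [hfar] with z hz
    exact inv_ne_zero (norm_pos_iff.1 (hr.trans_le hz))
  have hud : ∀ᶠ z in 𝓝[≠] e, DifferentiableAt ℂ u z := by
    filter_upwards [hE e, hne] with z hz hz'
    exact ((hθ z hz).sub_const _).inv fun h => hz' (by simp [u, h])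
  have hub : IsBoundedUnder (· ≤ ·) (𝓝[≠] e) fun z => ‖u z - u e‖ := by
    refine ⟨r⁻¹ + ‖u e‖, ?_⟩
    rw [eventually_map]
    filter_upwards [hfar] with z hz
    refine norm_sub_le_of_le ?_ le_rfl
    rw [norm_inv]
    exact inv_anti₀ hr hz
  have hlim := tendsto_limUnder_of_differentiable_on_punctured_nhds_of_bounded_under hud hub
  set ℓ := limUnder (𝓝[≠] e) u
  by_cases hℓ : ℓ = 0
  · exfalso
    rw [hℓ] at hlim
    let v := Function.update u e 0
    have hve : v =ᶠ[𝓝[≠] e] u := by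
      filter_upwards [self_mem_nhdsWithin] with z hz
      exact Function.update_of_ne hz _ _
    have hv : AnalyticAt ℂ v e := by
      refine analyticAt_of_differentiable_on_punctured_nhds_of_continuousAt ?_ ?_
      · filter_upwards [hud, self_mem_nhdsWithin] with z hz hz'
        refine hz.congr_of_eventuallyEq ?_
        filter_upwards [isOpen_ne.mem_nhds hz'] with y hy
        exact Function.update_of_ne hy _ _
      · exact continuousAt_update_same.2 hlim
    have hv0 : v e = 0 := Function.update_self _ _ _
    have hmap : 𝓝 (0 : ℂ) ≤ map v (𝓝 e) := by
      have := hv.eventually_constant_or_nhds_le_map_nhds.resolve_left fun h => by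
        obtain ⟨z, h1, h2, h3⟩ := ((h.filter_mono nhdsWithin_le_nhds).and (hve.and hne)).exists
        exact h3 (h2 ▸ h1.trans hv0)
      rwa [hv0] at this
    let M := ‖f e‖ + 1
    have hM : ∀ᶠ z in 𝓝 e, ‖f z‖ < M :=
      hf.continuous.norm.continuousAt.eventually_lt_const (lt_add_one _)
    have hS : v '' {z | ‖f z‖ < M ∧ (z ≠ e → z ∉ E)} ∈ 𝓝 (0 : ℂ) :=
      hmap (image_mem_map (hM.and (eventually_nhdsWithin_iff.1 (hE e))))
    have hbig : ∀ᶠ w in cocompact ℂ, ‖g w‖ < M := by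
      have h1 : Tendsto (fun w : ℂ => (w - θ x)⁻¹) (cocompact ℂ) (𝓝 0) :=
        (Metric.cobounded_eq_cocompact (α := ℂ) ▸ tendsto_inv₀_cobounded).comp
          (Homeomorph.subRight (θ x)).isClosedEmbedding.tendsto_cocompact
      have h2 : ∀ᶠ w in cocompact ℂ, w ≠ θ x :=
        (isCompact_singleton (x := θ x)).compl_mem_cocompact
      filter_upwards [h1.eventually hS, h2] with w ⟨z, ⟨hz, hzE⟩, hzw⟩ hw
      have hw' := inv_ne_zero (sub_ne_zero.2 hw)
      have hze : z ≠ e := by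
        rintro rfl
        exact hw' (hzw.symm.trans hv0)
      rw [show v z = u z from Function.update_of_ne hze _ _] at hzw
      have : θ z = w := sub_left_injective (inv_injective hzw)
      rw [← this, hfg z (hzE hze)]
      exact hz
    exact hc (hg.exists_eq_const_of_eventually_norm_le (hbig.mono fun _ h => h.le))
  · refine ⟨ℓ⁻¹ + θ x, ((hlim.inv₀ hℓ).add_const (θ x)).congr fun z => ?_⟩
    simp [u]

theorem exists_entire_extension (hE : ∀ z, ∀ᶠ w in 𝓝[≠] z, w ∉ E) (hf : Differentiable ℂ f)
    (hg : Differentiable ℂ g) (hc : ¬ ∃ c, ∀ z, g z = c)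
    (hθ : ∀ z ∉ E, DifferentiableAt ℂ θ z) (hinj : InjOn θ Eᶜ) (hfg : ∀ z ∉ E, g (θ z) = f z) :
    ∃ Θ : ℂ → ℂ, Differentiable ℂ Θ ∧ ∀ z ∉ E, Θ z = θ z := by
  choose Θ hΘ using exists_tendsto_of_injOn hE hf hg hc hθ hinj hfg
  have heq : ∀ z ∉ E, Θ z = θ z := fun z hz =>
    tendsto_nhds_unique (hΘ z) ((hθ z hz).continuousAt.mono_left nhdsWithin_le_nhds)
  refine ⟨Θ, fun z => (analyticAt_of_differentiable_on_punctured_nhds_of_continuousAt ?_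
    ?_).differentiableAt, heq⟩
  · filter_upwards [hE z] with w hw
    exact (hθ w hw).congr_of_eventuallyEq ((eventually_notMem_nhds hE hw).mono heq)
  · rw [continuousAt_iff_punctured_nhds]
    exact (hΘ z).congr' ((hE z).mono fun w hw => (heq w hw).symm)

end

theorem exists_eq_affine_of_leftInverse {Θ Θ' : ℂ → ℂ} (h : Differentiable ℂ Θ)
    (h' : Differentiable ℂ Θ') (hl : ∀ z, Θ' (Θ z) = z) (hr : ∀ z, Θ (Θ' z) = z) :
    ∃ a b : ℂ, a ≠ 0 ∧ ∀ z, Θ z = a * z + b := by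
  have hinj : Function.Injective Θ := Function.LeftInverse.injective hl
  have hne : ∀ z, z ≠ 0 → Θ z - Θ 0 ≠ 0 := fun z hz h0 => hz (hinj (sub_eq_zero.1 h0))
  have hd0 : deriv Θ 0 ≠ 0 := by
    intro h0
    have h1 : HasDerivAt (Θ' ∘ Θ) (deriv Θ' (Θ 0) * deriv Θ 0) 0 :=
      (h' _).hasDerivAt.comp _ (h 0).hasDerivAt
    rw [show Θ' ∘ Θ = id from funext hl, h0, mul_zero] at h1
    exact zero_ne_one (h1.unique (hasDerivAt_id 0))
  let e : ℂ ≃ₜ ℂ := ⟨⟨Θ, Θ', hl, hr⟩, h.continuous, h'.continuous⟩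
  have hinf : Tendsto (fun z => (Θ z - Θ 0)⁻¹) (cocompact ℂ) (𝓝 0) :=
    (Metric.cobounded_eq_cocompact (α := ℂ) ▸ tendsto_inv₀_cobounded).comp
      (e.trans (Homeomorph.subRight (Θ 0))).isClosedEmbedding.tendsto_cocompact
  let u : ℂ → ℂ := fun s => (Θ s⁻¹ - Θ 0)⁻¹
  have hu0 : u 0 = 0 := by simp [u]
  have hu : DifferentiableAt ℂ u 0 := by
    refine (analyticAt_of_differentiable_on_punctured_nhds_of_continuousAt ?_
      ?_).differentiableAt
    · filter_upwards [self_mem_nhdsWithin] with s hs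
      exact (((h _).comp s (differentiableAt_inv hs)).sub_const _).inv (hne _ (inv_ne_zero hs))
    · rw [continuousAt_iff_punctured_nhds, hu0]
      exact hinf.comp (Metric.cobounded_eq_cocompact (α := ℂ) ▸ tendsto_inv₀_nhdsNE_zero)
  obtain ⟨C, hC⟩ := hu.isBigO_sub.bound
  have hq : Differentiable ℂ (dslope Θ 0) :=
    (differentiableOn_univ.1 ((Complex.differentiableOn_dslope univ_mem).2 h.differentiableOn))
  have hqz : ∀ z, z ≠ 0 → dslope Θ 0 z = z⁻¹ * (Θ z - Θ 0) := fun z hz => by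
    rw [dslope_of_ne _ hz, slope_def_field, sub_zero, div_eq_inv_mul]
  have hq0 : ∀ z, dslope Θ 0 z ≠ 0 := by
    intro z
    by_cases hz : z = 0
    · rwa [hz, dslope_same]
    · rw [hqz z hz]
      exact mul_ne_zero (inv_ne_zero hz) (hne z hz)
  have hqi : Differentiable ℂ fun z => (dslope Θ 0 z)⁻¹ := hq.inv hq0
  have hbig : ∀ᶠ z in cocompact ℂ, ‖(dslope Θ 0 z)⁻¹‖ ≤ C := by
    have h1 : Tendsto (fun z : ℂ => z⁻¹) (cocompact ℂ) (𝓝 0) :=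
      Metric.cobounded_eq_cocompact (α := ℂ) ▸ tendsto_inv₀_cobounded
    filter_upwards [h1.eventually hC, (isCompact_singleton (x := 0)).compl_mem_cocompact]
      with z hz hz0
    rw [hu0, sub_zero, sub_zero] at hz
    simp only [u, inv_inv, norm_inv] at hz
    rw [hqz z hz0, mul_inv, inv_inv, norm_mul, norm_inv]
    have hzp : 0 < ‖z‖ := norm_pos_iff.2 hz0
    calc ‖z‖ * ‖Θ z - Θ 0‖⁻¹ ≤ ‖z‖ * (C * ‖z‖⁻¹) := by gcongr
      _ = C := by field_simp
  obtain ⟨c, hc⟩ := hqi.exists_eq_const_of_eventually_norm_le hbig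
  refine ⟨c⁻¹, Θ 0, ?_, fun z => ?_⟩
  · rw [← hc 0, inv_inv]
    exact hq0 0
  · by_cases hz : z = 0
    · simp [hz]
    · rw [← hc z, inv_inv, hqz z hz]
      field_simp
      ring

theorem exists_affine_of_comp_eq {E E' : Set ℂ} {f g θ : ℂ → ℂ}
    (hE : ∀ z, ∀ᶠ w in 𝓝[≠] z, w ∉ E) (hE' : ∀ z, ∀ᶠ w in 𝓝[≠] z, w ∉ E')
    (hf : Differentiable ℂ f) (hg : Differentiable ℂ g)
    (hcf : ¬ ∃ c, ∀ z, f z = c) (hcg : ¬ ∃ c, ∀ z, g z = c) (hθ : ∀ z ∉ E, ContinuousAt θ z)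
    (hbij : BijOn θ Eᶜ E'ᶜ) (hfg : ∀ z ∉ E, g (θ z) = f z) :
    ∃ a b : ℂ, a ≠ 0 ∧ ∀ z, f z = g (a * z + b) := by
  have hd : ∀ z ∉ E, DifferentiableAt ℂ θ z := fun z hz =>
    differentiableAt_of_comp_eq hE hf hg (hg.eventually_deriv_ne_zero hcg) hθ hbij.injOn hfg hz
  let θ' := Function.invFunOn θ Eᶜ
  have hinv : InvOn θ' θ Eᶜ E'ᶜ := hbij.invOn_invFunOn
  have hbij' : BijOn θ' E'ᶜ Eᶜ := hbij.symm hinv.symm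
  have hgf : ∀ z ∉ E', f (θ' z) = g z := fun z hz => by
    rw [← hfg _ (hbij'.mapsTo hz), hinv.2 hz]
  have hθ' : ∀ z ∉ E', ContinuousAt θ' z := by
    intro z hz
    obtain ⟨x, hx, rfl⟩ := hbij.surjOn hz
    have h1 : Tendsto θ' (map θ (𝓝 x)) (𝓝 x) := by
      rw [tendsto_map'_iff]
      refine tendsto_id.congr' ?_
      filter_upwards [eventually_notMem_nhds hE hx] with y hy
      exact (hinv.1 hy).symm
    rw [ContinuousAt, hinv.1 hx]
    exact h1.mono_left (nhds_le_map_of_injOn hE hd hbij.injOn hx)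
  have hd' : ∀ z ∉ E', DifferentiableAt ℂ θ' z := fun z hz =>
    differentiableAt_of_comp_eq hE' hg hf (hf.eventually_deriv_ne_zero hcf) hθ' hbij'.injOn hgf hz
  obtain ⟨Θ, hΘ, hΘe⟩ := exists_entire_extension hE hf hg hcg hd hbij.injOn hfg
  obtain ⟨Θ', hΘ', hΘe'⟩ := exists_entire_extension hE' hg hf hcf hd' hbij'.injOn hgf
  have hD := dense_compl_of_eventually_notMem hE
  have hD' := dense_compl_of_eventually_notMem hE'
  obtain ⟨a, b, ha, hab⟩ := exists_eq_affine_of_leftInverse hΘ hΘ'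
    (congrFun (Continuous.ext_on hD (hΘ'.continuous.comp hΘ.continuous) continuous_id
      fun z hz => by
        rw [hΘe z hz, hΘe' _ (hbij.mapsTo hz), hinv.1 hz]))
    (congrFun (Continuous.ext_on hD' (hΘ.continuous.comp hΘ'.continuous) continuous_id
      fun z hz => by
        rw [hΘe' z hz, hΘe _ (hbij'.mapsTo hz), hinv.2 hz]))
  refine ⟨a, b, ha, fun z => ?_⟩
  rw [← hab]
  exact congrFun (Continuous.ext_on hD hf.continuous (hg.continuous.comp hΘ.continuous)
    fun z hz => by rw [Function.comp_apply, hΘe z hz, hfg z hz]) z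

theorem Real.posLog_mul_add_le {r s x : ℝ} :
    log⁺ (r * x + s) ≤ log⁺ x + (Real.log 2 + log⁺ r + log⁺ s) := by
  linarith [Real.posLog_add (x := r * x) (y := s), Real.posLog_mul (x := r) (y := x)]

theorem logPlus_eq_posLog : logPlus = Real.posLog := rfl

theorem logPlus_logPlus_mul_add_le (r s : ℝ) :
    ∃ C, 0 ≤ C ∧ ∀ x y, 0 ≤ y → y ≤ r * x + s →
      logPlus (logPlus y) ≤ logPlus (logPlus x) + C := by
  have h2 : 0 ≤ Real.log 2 := Real.log_nonneg one_le_two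
  refine ⟨Real.log 2 + log⁺ 1 + log⁺ (Real.log 2 + log⁺ r + log⁺ s), ?_, fun x y hy hxy => ?_⟩
  · have := Real.posLog_nonneg (x := (1 : ℝ))
    have := Real.posLog_nonneg (x := Real.log 2 + log⁺ r + log⁺ s)
    linarith
  rw [logPlus_eq_posLog]
  refine (Real.posLog_le_posLog Real.posLog_nonneg ?_).trans Real.posLog_mul_add_le
  rw [one_mul]
  exact (Real.posLog_le_posLog hy hxy).trans Real.posLog_mul_add_le

theorem entireOrder_le_of_norm_le {f g T : ℂ → ℂ} {r s r' s' : ℝ}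
    (hT : Tendsto T (Bornology.cobounded ℂ) (Bornology.cobounded ℂ))
    (hT' : ∀ z, ‖T z‖ ≤ r' * ‖z‖ + s') (hfg : ∀ z, ‖f z‖ ≤ r * ‖g (T z)‖ + s) :
    entireOrder f ≤ entireOrder g := by
  unfold entireOrder
  rw [comap_norm_atTop]
  obtain ⟨C, hC, hCb⟩ := logPlus_logPlus_mul_add_le r s
  set D := Real.log 2 + log⁺ r' + log⁺ s'
  let u : ℂ → ℝ≥0∞ := fun z => ENNReal.ofReal (logPlus (logPlus ‖g z‖) / Real.log ‖z‖)
  let v : ℂ → ℝ≥0∞ := fun z => ENNReal.ofReal (1 + D / Real.log ‖z‖)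
  let w : ℂ → ℝ≥0∞ := fun z => ENNReal.ofReal (C / Real.log ‖z‖)
  have hlog : Tendsto (fun z : ℂ => Real.log ‖z‖) (Bornology.cobounded ℂ) atTop :=
    Real.tendsto_log_atTop.comp tendsto_norm_cobounded_atTop
  have hv : Tendsto v (Bornology.cobounded ℂ) (𝓝 1) := by
    have := ENNReal.tendsto_ofReal ((hlog.const_div_atTop D).const_add 1)
    simpa using this
  have hw : Tendsto w (Bornology.cobounded ℂ) (𝓝 0) := by
    simpa using ENNReal.tendsto_ofReal (hlog.const_div_atTop C)
  have hle : ∀ᶠ z in Bornology.cobounded ℂ,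
      ENNReal.ofReal (logPlus (logPlus ‖f z‖) / Real.log ‖z‖) ≤ ((u ∘ T) * v + w) z := by
    filter_upwards [hlog.eventually_ge_atTop 1, hT.eventually (hlog.eventually_ge_atTop 1)]
      with z hz hTz
    have hz0 : 0 < Real.log ‖z‖ := zero_lt_one.trans_le hz
    have hTz0 : 0 < Real.log ‖T z‖ := zero_lt_one.trans_le hTz
    have h0 : 0 ≤ logPlus (logPlus ‖g (T z)‖) := le_max_left _ _
    have h1 : Real.log ‖T z‖ ≤ Real.log ‖z‖ + D := by
      have h2 := (Real.posLog_le_posLog (norm_nonneg _) (hT' z)).trans Real.posLog_mul_add_le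
      rw [Real.posLog_apply, Real.posLog_apply, max_eq_right hz0.le, max_eq_right hTz0.le] at h2
      exact h2
    simp only [Pi.add_apply, Pi.mul_apply, Function.comp_apply, u, v, w]
    rw [← ENNReal.ofReal_mul (by positivity), ← ENNReal.ofReal_add _ (by positivity)]
    · refine ENNReal.ofReal_le_ofReal ?_
      have h3 := hCb _ _ (norm_nonneg _) (hfg z)
      have h4 : logPlus (logPlus ‖g (T z)‖) / Real.log ‖T z‖ * (1 + D / Real.log ‖z‖)
          = logPlus (logPlus ‖g (T z)‖) * ((Real.log ‖z‖ + D) / Real.log ‖T z‖) / Real.log ‖z‖ := by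
        field_simp
      rw [h4, ← add_div]
      gcongr
      refine h3.trans ?_
      gcongr
      exact le_mul_of_one_le_right h0 ((one_le_div hTz0).2 h1)
    · refine mul_nonneg (by positivity) ?_
      have : 1 + D / Real.log ‖z‖ = (Real.log ‖z‖ + D) / Real.log ‖z‖ := by field_simp
      rw [this]
      exact div_nonneg (hTz0.le.trans h1) hz0.le
  calc _ ≤ limsup ((u ∘ T) * v + w) (Bornology.cobounded ℂ) := limsup_le_limsup hle
    _ = limsup ((u ∘ T) * v) (Bornology.cobounded ℂ) :=
      ENNReal.limsup_add_of_right_tendsto_zero hw _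
    _ ≤ limsup (u ∘ T) (Bornology.cobounded ℂ) * limsup v (Bornology.cobounded ℂ) :=
      ENNReal.limsup_mul_le' (Or.inr (by simp [hv.limsup_eq])) (Or.inr (by simp [hv.limsup_eq]))
    _ ≤ limsup u (Bornology.cobounded ℂ) := by
      rw [hv.limsup_eq, mul_one, limsup, ← map_map]
      exact limsup_le_limsup_of_le hT

theorem tendsto_affine_cobounded {a : ℂ} (ha : a ≠ 0) (b : ℂ) :
    Tendsto (fun z => a * z + b) (Bornology.cobounded ℂ) (Bornology.cobounded ℂ) := by
  rw [Metric.cobounded_eq_cocompact]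
  exact ((Homeomorph.mulLeft₀ a ha).trans (Homeomorph.addRight b)).isClosedEmbedding.tendsto_cocompact

theorem norm_affine_le (a b z : ℂ) : ‖a * z + b‖ ≤ ‖a‖ * ‖z‖ + ‖b‖ :=
  (norm_add_le _ _).trans_eq (by rw [norm_mul])

theorem entireOrder_conj (g : ℂ → ℂ) :
    entireOrder (fun z => starRingEnd ℂ (g (starRingEnd ℂ z))) = entireOrder g := by
  have ht : Tendsto (starRingEnd ℂ) (Bornology.cobounded ℂ) (Bornology.cobounded ℂ) := by
    rw [Metric.cobounded_eq_cocompact]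
    exact Complex.conjCLE.toHomeomorph.isClosedEmbedding.tendsto_cocompact
  refine le_antisymm ?_ ?_
  · exact entireOrder_le_of_norm_le (r := 1) (s := 0) (r' := 1) (s' := 0) ht (by simp) (by simp)
  · exact entireOrder_le_of_norm_le (r := 1) (s := 0) (r' := 1) (s' := 0) ht (by simp) (by simp)

theorem entireOrder_affine_comp {a : ℂ} (ha : a ≠ 0) (b : ℂ) (g : ℂ → ℂ) :
    entireOrder (fun z => a * g z + b) = entireOrder g := by
  refine le_antisymm (entireOrder_le_of_norm_le (r' := 1) (s' := 0) tendsto_id (by simp)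
    fun z => norm_affine_le a b (g z)) ?_
  refine entireOrder_le_of_norm_le (r' := 1) (s' := 0) tendsto_id (by simp)
    fun z => (norm_affine_le a⁻¹ (-a⁻¹ * b) (a * g z + b)).trans' (le_of_eq (congrArg norm ?_))
  field_simp
  ring

theorem entireOrder_comp_affine {a : ℂ} (ha : a ≠ 0) (b : ℂ) (g : ℂ → ℂ) :
    entireOrder (fun z => g (a * z + b)) = entireOrder g := by
  refine le_antisymm (entireOrder_le_of_norm_le (r := 1) (s := 0) (tendsto_affine_cobounded ha b)
    (norm_affine_le a b) (by simp)) ?_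
  refine entireOrder_le_of_norm_le (r := 1) (s := 0)
    (tendsto_affine_cobounded (inv_ne_zero ha) (-a⁻¹ * b)) (norm_affine_le _ _) fun z => ?_
  rw [one_mul, add_zero, show a * (a⁻¹ * z + -a⁻¹ * b) + b = z by field_simp; ring]

theorem countable_of_eventually_notMem {E : Set ℂ} (hE : ∀ z, ∀ᶠ w in 𝓝[≠] z, w ∉ E) :
    E.Countable := by
  have : DiscreteTopology E := discreteTopology_subtype_iff.2 fun z _ => by
    rw [← disjoint_iff, disjoint_principal_right]
    exact hE z
  exact (countable_of_Lindelof_of_discrete (X := E)).to_set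

theorem exists_eq_comp_affine_of_covering {f g : ℂ → ℂ} (hf : Differentiable ℂ f)
    (hg : Differentiable ℂ g) (hcf : ¬ ∃ c, ∀ z, f z = c) (hcg : ¬ ∃ c, ∀ z, g z = c)
    (φ h : ℂ ≃ₜ ℂ) (hor : PreservesOrientation h) (h0 : h 0 = 0) (h1 : h 1 = 1)
    (hfg : ∀ z, h (f z) = g (φ z)) (hcov : IsCoveringMapOn f {0, 1}ᶜ) :
    ∃ a b : ℂ, a ≠ 0 ∧ ∀ z, f z = g (a * z + b) := by
  have hE : ∀ z, ∀ᶠ w in 𝓝[≠] z, w ∉ f ⁻¹' {0, 1} := fun z => by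
    filter_upwards [hf.eventually_ne hcf 0 z, hf.eventually_ne hcf 1 z] with w hw hw'
    simp [hw, hw']
  have hE' : ∀ z, ∀ᶠ w in 𝓝[≠] z, w ∉ g ⁻¹' {0, 1} := fun z => by
    filter_upwards [hg.eventually_ne hcg 0 z, hg.eventually_ne hcg 1 z] with w hw hw'
    simp [hw, hw']
  have hX : IsPathConnected (f ⁻¹' {0, 1}ᶜ) := by
    rw [preimage_compl]
    exact (countable_of_eventually_notMem hE).isPathConnected_compl_of_one_lt_rank
      (by rw [Complex.rank_real_complex]; exact Cardinal.one_lt_two)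
  have : PathConnectedSpace (f ⁻¹' {0, 1}ᶜ) := isPathConnected_iff_pathConnectedSpace.1 hX
  have hmem : ∀ w, w ∈ ({0, 1}ᶜ : Set ℂ) ↔ h w ∈ ({0, 1}ᶜ : Set ℂ) := fun w => by
    simp [← h.injective.eq_iff (a := w), h0, h1]
  obtain ⟨θ, hθ, hθb, hθf⟩ := TwicePunctured.exists_lift_of_conj
    (hcov.isCoveringMap_restrictPreimage _)
    (q := (({0, 1}ᶜ : Set ℂ).restrictPreimage g))
    (φ.subtype (q := (· ∈ g ⁻¹' {0, 1}ᶜ)) fun x => by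
      rw [mem_preimage, mem_preimage, ← hfg, ← hmem])
    h hor h0 h1 (fun x => hfg x)
  classical
  let Θ : ℂ → ℂ := fun z => if hz : z ∈ f ⁻¹' {0, 1}ᶜ then θ ⟨z, hz⟩ else 0
  have hΘ : ∀ x : f ⁻¹' {0, 1}ᶜ, Θ x = θ x := fun x => dif_pos x.2
  refine exists_affine_of_comp_eq (θ := Θ) hE hE' hf hg hcf hcg ?_ ⟨?_, ?_, ?_⟩ ?_
  · intro z hz
    have hopen : IsOpen (f ⁻¹' {0, 1}ᶜ) :=
      (Set.toFinite ({0, 1} : Set ℂ)).isClosed.isOpen_compl.preimage hf.continuous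
    have : ContinuousOn Θ (f ⁻¹' {0, 1}ᶜ) := by
      rw [continuousOn_iff_continuous_domRestrict]
      exact (continuous_subtype_val.comp hθ).congr fun x => (hΘ x).symm
    exact this.continuousAt (hopen.mem_nhds hz)
  · intro z hz
    rw [hΘ ⟨z, hz⟩]
    exact (θ ⟨z, hz⟩).2
  · intro z hz w hw hzw
    rw [hΘ ⟨z, hz⟩, hΘ ⟨w, hw⟩] at hzw
    exact congrArg Subtype.val (hθb.1 (Subtype.ext hzw))
  · intro w hw
    obtain ⟨x, hx⟩ := hθb.2 ⟨w, hw⟩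
    exact ⟨x, x.2, by rw [hΘ, hx]⟩
  · intro z hz
    rw [hΘ ⟨z, hz⟩]
    exact congrArg Subtype.val (hθf ⟨z, hz⟩)

theorem entireOrder_eq_of_covering {f g : ℂ → ℂ} (hf : Differentiable ℂ f)
    (hg : Differentiable ℂ g) (hcf : ¬ ∃ c, ∀ z, f z = c) (hcg : ¬ ∃ c, ∀ z, g z = c)
    (φ h : ℂ ≃ₜ ℂ) (h0 : h 0 = 0) (h1 : h 1 = 1) (hfg : ∀ z, h (f z) = g (φ z))
    (hcov : IsCoveringMapOn f {0, 1}ᶜ) : entireOrder f = entireOrder g := by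
  rcases h.preservesOrientation_or with hor | hor
  · obtain ⟨a, b, ha, hab⟩ :=
      exists_eq_comp_affine_of_covering hf hg hcf hcg φ h hor h0 h1 hfg hcov
    rw [funext hab, entireOrder_comp_affine ha]
  · let c : ℂ ≃ₜ ℂ := Complex.conjCLE.toHomeomorph
    obtain ⟨a, b, ha, hab⟩ := exists_eq_comp_affine_of_covering
      (g := fun z => starRingEnd ℂ (g (starRingEnd ℂ z))) hf
      (fun z => by simpa [Function.comp_def] using (hg (starRingEnd ℂ z)).conj_conj) hcf
      (fun ⟨k, hk⟩ => hcg ⟨starRingEnd ℂ k, fun z => by simp [← hk (starRingEnd ℂ z)]⟩)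
      (φ.trans c) (h.trans c) hor (by simp [c, h0]) (by simp [c, h1])
      (fun z => by simp [c, hfg]) hcov
    rw [funext hab, entireOrder_comp_affine ha (g := fun z => starRingEnd ℂ (g (starRingEnd ℂ z))),
      entireOrder_conj]

theorem TranscendentalEntire.not_exists_eq_const {f : ℂ → ℂ} (hf : TranscendentalEntire f) :
    ¬ ∃ c, ∀ z, f z = c :=
  fun ⟨c, hc⟩ => hf.2 ⟨Polynomial.C c, by simpa using hc⟩

theorem exists_homeomorph_affine {a b : ℂ} (hab : a ≠ b) :
    ∃ (c d : ℂ) (A : ℂ ≃ₜ ℂ), c ≠ 0 ∧ (∀ z, A z = c * z + d) ∧ A a = 0 ∧ A b = 1 := by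
  have hc : b - a ≠ 0 := sub_ne_zero.2 hab.symm
  refine ⟨(b - a)⁻¹, -(b - a)⁻¹ * a, (Homeomorph.mulLeft₀ _ (inv_ne_zero hc)).trans
    (Homeomorph.addRight (-(b - a)⁻¹ * a)), inv_ne_zero hc, fun z => rfl, ?_, ?_⟩
  · simp
  · change (b - a)⁻¹ * b + -(b - a)⁻¹ * a = 1
    field_simp
    ring

theorem order_invariant_two_singular_values (f g : ℂ → ℂ)
    (hf : TranscendentalEntire f) (hg : TranscendentalEntire g)
    (heq : TopEquiv f g)
    (a b : ℂ) (hab : a ≠ b) (hS : singularSet f = {a, b}) :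
    entireOrder f = entireOrder g := by
  obtain ⟨φ, ψ, h⟩ := heq
  obtain ⟨c, d, A, hc, hA, hAa, hAb⟩ := exists_homeomorph_affine hab
  obtain ⟨c', d', A', hc', hA', hAa', hAb'⟩ := exists_homeomorph_affine (ψ.injective.ne hab)
  have hcf : ¬ ∃ k, ∀ z, c * f z + d = k := fun ⟨k, hk⟩ =>
    hf.not_exists_eq_const ⟨A.symm k, fun z => by rw [← hk z, ← hA, A.symm_apply_apply]⟩
  have hcg : ¬ ∃ k, ∀ z, c' * g z + d' = k := fun ⟨k, hk⟩ =>
    hg.not_exists_eq_const ⟨A'.symm k, fun z => by rw [← hk z, ← hA', A'.symm_apply_apply]⟩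
  have hcov : IsCoveringMapOn (A ∘ f) {0, 1}ᶜ := by
    have h1 := (isCoveringMapOn_singularSet_compl hf.1.continuous).homeomorph_comp A
    have h2 : A.symm ⁻¹' (singularSet f)ᶜ = {0, 1}ᶜ := by
      ext w
      simp [hS, A.symm_apply_eq, hAa, hAb]
    rwa [h2] at h1
  rw [← entireOrder_affine_comp hc d f, ← entireOrder_affine_comp hc' d' g]
  refine entireOrder_eq_of_covering ((hf.1.const_mul c).add_const d)
    ((hg.1.const_mul c').add_const d') hcf hcg φ ((A.symm.trans ψ).trans A') ?_ ?_ ?_ ?_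
  · simp [← hAa, hAa']
  · simp [← hAb, hAb']
  · intro z
    simp [← hA, ← hA', h]
  · rwa [show A ∘ f = fun z => c * f z + d from funext fun z => hA (f z)] at hcov
end

section
/- Let f be a transcendental entire function whose nonlinearity 𝒩_f = f″/f′ is a rational function; that is, there exist coprime polynomials P, Q over ℂ with Q ≠ 0 such that f″(z)·Q(z) = f′(z)·P(z) for all z ∈ ℂ. Then deg P ≥ deg Q and ρ(f) = 1 + deg P − deg Q. -/
open Complex Set Filter Topology Metric MeasureTheory
open scoped ENNReal Real

theorem Polynomial.exists_derivative_eq {K : Type*} [Field K] [CharZero K] (p : Polynomial K) :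
    ∃ q : Polynomial K, Polynomial.derivative q = p := by
  induction p using Polynomial.induction_on' with
  | add p q hp hq =>
    obtain ⟨u, rfl⟩ := hp
    obtain ⟨v, rfl⟩ := hq
    exact ⟨u + v, Polynomial.derivative_add⟩
  | monomial n a =>
    refine ⟨Polynomial.monomial (n + 1) (a / (n + 1)), ?_⟩
    have : (n : K) + 1 ≠ 0 := by exact_mod_cast n.succ_ne_zero
    rw [Polynomial.derivative_monomial]
    simp [this]

theorem exists_eval_of_deriv_eq_eval {f : ℂ → ℂ} (hf : Differentiable ℂ f) {p : Polynomial ℂ}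
    (h : ∀ z, deriv f z = p.eval z) : ∃ q : Polynomial ℂ, ∀ z, f z = q.eval z := by
  obtain ⟨q, rfl⟩ := p.exists_derivative_eq
  have hconst := is_const_of_deriv_eq_zero (f := fun z => f z - q.eval z)
    (hf.sub q.differentiable) fun z => by
      rw [deriv_fun_sub (hf z) q.differentiableAt, h, Polynomial.deriv, sub_self]
  refine ⟨q + Polynomial.C (f 0 - q.eval 0), fun z => ?_⟩
  rw [Polynomial.eval_add, Polynomial.eval_C, ← hconst z 0, add_sub_cancel]

theorem eq_of_sub_pow_mul_eq {u v : ℂ → ℂ} (hu : Continuous u) (hv : Continuous v) (a : ℂ) (n : ℕ)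
    (h : ∀ z, (z - a) ^ n * u z = (z - a) ^ n * v z) : u = v :=
  Continuous.ext_on (dense_compl_singleton a) hu hv fun z hz =>
    mul_left_cancel₀ (pow_ne_zero n (sub_ne_zero.mpr hz)) (h z)

theorem Differentiable.exists_eq_sub_pow_mul {g : ℂ → ℂ} (hg : Differentiable ℂ g) (hne : g ≠ 0)
    (a : ℂ) : ∃ (n : ℕ) (k : ℂ → ℂ), Differentiable ℂ k ∧ k a ≠ 0 ∧
      ∀ z, g z = (z - a) ^ n * k z := by
  obtain ⟨p, hp⟩ := hg.analyticAt a
  have hp0 : p ≠ 0 := fun h0 => hne <|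
    AnalyticOnNhd.eq_of_eventuallyEq (fun z _ => hg.analyticAt z) (fun _ _ => analyticAt_const)
      (hp.locally_zero_iff.mpr h0)
  refine ⟨p.order, (Function.swap dslope a)^[p.order] g, ?_,
    hp.iterate_dslope_fslope_ne_zero hp0, hp.eq_pow_order_mul_iterate_dslope⟩
  generalize p.order = n
  clear hp hp0 hne
  induction n generalizing g with
  | zero => exact hg
  | succ n ih =>
    refine ih (g := dslope g a) ?_
    rw [← differentiableOn_univ] at hg ⊢
    exact (Complex.differentiableOn_dslope Filter.univ_mem).mpr hg

theorem exists_eq_eval_mul_exp_eval {g : ℂ → ℂ} (hg : Differentiable ℂ g) (hne : g ≠ 0)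
    {P Q : Polynomial ℂ} (hQ : Q ≠ 0) (heq : ∀ z, deriv g z * Q.eval z = g z * P.eval z) :
    ∃ R h : Polynomial ℂ, R ≠ 0 ∧ ∀ z, g z = R.eval z * Complex.exp (h.eval z) := by
  induction hn : Q.natDegree generalizing g P Q with
  | zero =>
    obtain ⟨c, rfl⟩ := Polynomial.natDegree_eq_zero.mp hn
    have hc : c ≠ 0 := by simpa using hQ
    obtain ⟨h, hh⟩ := (Polynomial.C c⁻¹ * P).exists_derivative_eq
    have hd (z : ℂ) : deriv g z = g z * h.derivative.eval z := by
      have := heq z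
      rw [Polynomial.eval_C] at this
      rw [hh, Polynomial.eval_mul, Polynomial.eval_C]
      field_simp
      exact this
    have hconst := is_const_of_deriv_eq_zero
      (f := fun z => g z * Complex.exp (-h.eval z)) (by fun_prop) fun z => by
        have h1 := (hg z).hasDerivAt.mul (h.hasDerivAt z).neg.cexp
        refine h1.deriv.trans ?_
        rw [hd]
        ring
    have hg0 (z : ℂ) : g z = g 0 * Complex.exp (-h.eval 0) * Complex.exp (h.eval z) := by
      rw [← hconst z 0, mul_assoc, ← Complex.exp_add, neg_add_cancel, Complex.exp_zero, mul_one]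
    refine ⟨Polynomial.C (g 0 * Complex.exp (-h.eval 0)), h, fun h0 => hne ?_, fun z => ?_⟩
    · funext z
      rw [hg0, Polynomial.C_eq_zero.mp h0, zero_mul, Pi.zero_apply]
    · rw [Polynomial.eval_C, ← hg0]
  | succ d ih =>
    obtain ⟨a, ha⟩ := Complex.exists_root (f := Q)
      (Polynomial.natDegree_pos_iff_degree_pos.mp (by omega))
    obtain ⟨Q₁, rfl⟩ := Polynomial.dvd_iff_isRoot.mpr ha
    have hQ₁ : Q₁ ≠ 0 := right_ne_zero_of_mul hQ
    have hdeg : Q₁.natDegree = d := by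
      rw [Polynomial.natDegree_mul (Polynomial.X_sub_C_ne_zero a) hQ₁,
        Polynomial.natDegree_X_sub_C] at hn
      omega
    obtain ⟨n, k, hk, hka, hgk⟩ := hg.exists_eq_sub_pow_mul hne a
    have hk' : Differentiable ℂ (deriv k) := hk.deriv
    have hderiv (z : ℂ) :
        (z - a) * deriv g z = (z - a) ^ n * (n * k z + (z - a) * deriv k z) := by
      have h1 := ((((hasDerivAt_id z).sub_const a).pow n).mul (hk z).hasDerivAt).deriv
      have h2 : g = ((fun x => id x - a) ^ n) * k := funext hgk
      rw [h2, h1]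
      cases n with
      | zero => simp
      | succ m => simp; ring
    have hmul := eq_of_sub_pow_mul_eq
      (u := fun z => (n * k z + (z - a) * deriv k z) * Q₁.eval z)
      (v := fun z => k z * P.eval z)
      (by have := hk.continuous; have := hk'.continuous; fun_prop)
      (by have := hk.continuous; fun_prop) a n fun z => by
        have h1 := heq z
        simp only [Polynomial.eval_mul, Polynomial.eval_sub, Polynomial.eval_X,
          Polynomial.eval_C] at h1
        rw [← mul_assoc, ← hderiv, ← mul_assoc, ← hgk, ← h1]
        ring
    have hroot : (P - n * Q₁).IsRoot a := by
      have h1 := congrFun hmul a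
      simp only [sub_self, zero_mul, add_zero] at h1
      have h2 : k a * (P.eval a - n * Q₁.eval a) = 0 := by linear_combination -h1
      simpa using (mul_eq_zero.mp h2).resolve_left hka
    obtain ⟨P₁, hP₁⟩ := Polynomial.dvd_iff_isRoot.mpr hroot
    have hk_eq := eq_of_sub_pow_mul_eq (u := fun z => deriv k z * Q₁.eval z)
      (v := fun z => k z * P₁.eval z)
      (by have := hk'.continuous; fun_prop) (by have := hk.continuous; fun_prop) a 1 fun z => by
        have h1 := congrFun hmul z
        have h2 := congrArg (Polynomial.eval z) hP₁
        simp at h1 h2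
        linear_combination h1 + k z * h2
    obtain ⟨R, h, hR, hRh⟩ := ih hk (fun h0 => hka (congrFun h0 a)) hQ₁ (congrFun hk_eq) hdeg
    refine ⟨(Polynomial.X - Polynomial.C a) ^ n * R, h,
      mul_ne_zero (pow_ne_zero _ (Polynomial.X_sub_C_ne_zero a)) hR, fun z => ?_⟩
    rw [hgk, hRh]
    simp [mul_assoc]

theorem natDegree_eq_of_deriv_eval_mul_exp {R h P Q : Polynomial ℂ} (hR : R ≠ 0) (hQ : Q ≠ 0)
    (hh : h.natDegree ≠ 0)
    (heq : ∀ z, deriv (fun w => R.eval w * Complex.exp (h.eval w)) z * Q.eval z =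
      R.eval z * Complex.exp (h.eval z) * P.eval z) :
    P.natDegree + 1 = h.natDegree + Q.natDegree := by
  have hpoly : (R.derivative + R * h.derivative) * Q = R * P := by
    refine Polynomial.funext fun z => ?_
    have h1 := heq z
    have h2 : deriv (fun w => R.eval w * Complex.exp (h.eval w)) z = _ :=
      ((R.hasDerivAt z).mul (h.hasDerivAt z).cexp).deriv
    rw [h2] at h1
    refine mul_left_cancel₀ (Complex.exp_ne_zero (h.eval z)) ?_
    simp only [Polynomial.eval_mul, Polynomial.eval_add]
    linear_combination h1
  have hh' : h.derivative ≠ 0 := mt Polynomial.derivative_eq_zero.mp hh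
  have hlt : R.derivative.degree < (R * h.derivative).degree := by
    refine (Polynomial.degree_derivative_lt hR).trans_le ?_
    exact Polynomial.degree_le_mul_left R hh'
  have hsum : (R.derivative + R * h.derivative).natDegree = R.natDegree + h.derivative.natDegree := by
    rw [Polynomial.natDegree_add_eq_right_of_degree_lt hlt, Polynomial.natDegree_mul hR hh']
  have hsum0 : R.derivative + R * h.derivative ≠ 0 := fun h0 => by
    have := Polynomial.degree_add_eq_right_of_degree_lt hlt
    rw [h0, Polynomial.degree_zero] at this
    exact mul_ne_zero hR hh' (Polynomial.degree_eq_bot.mp this.symm)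
  have hP : P ≠ 0 := by
    rintro rfl
    rw [mul_zero] at hpoly
    exact mul_ne_zero hsum0 hQ hpoly
  have hdeg := congrArg Polynomial.natDegree hpoly
  rw [Polynomial.natDegree_mul hsum0 hQ, Polynomial.natDegree_mul hR hP, hsum,
    Polynomial.natDegree_derivative] at hdeg
  omega

theorem Polynomial.exists_norm_eval_le (p : Polynomial ℂ) {n : ℕ} (hn : p.natDegree ≤ n) :
    ∃ C : ℝ, 0 ≤ C ∧ ∀ (r : ℝ) (z : ℂ), 1 ≤ r → ‖z‖ ≤ r → ‖p.eval z‖ ≤ C * r ^ n := by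
  refine ⟨∑ i ∈ Finset.range (n + 1), ‖p.coeff i‖, by positivity, fun r z hr hz => ?_⟩
  rw [Polynomial.eval_eq_sum_range' (Nat.lt_succ_of_le hn), Finset.sum_mul]
  refine norm_sum_le_of_le _ fun i hi => ?_
  rw [norm_mul, norm_pow]
  have hi' : i ≤ n := Nat.lt_succ_iff.mp (Finset.mem_range.mp hi)
  gcongr
  calc ‖z‖ ^ i ≤ r ^ i := by gcongr
    _ ≤ r ^ n := pow_le_pow_right₀ hr hi'

theorem exists_norm_le_exp_of_deriv_eq {f : ℂ → ℂ} (hf : Differentiable ℂ f) {R h : Polynomial ℂ}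
    (hd : h.natDegree ≠ 0) (hfd : ∀ z, deriv f z = R.eval z * Complex.exp (h.eval z)) :
    ∃ B : ℝ, 1 ≤ B ∧ ∀ z : ℂ, 1 ≤ ‖z‖ → ‖f z‖ ≤ Real.exp (B * ‖z‖ ^ h.natDegree) := by
  obtain ⟨C₁, hC₁, hR⟩ := R.exists_norm_eval_le le_rfl
  obtain ⟨C₂, hC₂, hh⟩ := h.exists_norm_eval_le le_rfl
  set d := h.natDegree
  set m := R.natDegree
  refine ⟨1 + (‖f 0‖ + C₁) + ((m + 1) + C₂), by linarith [norm_nonneg (f 0), m.cast_nonneg (α := ℝ)],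
    fun z hz => ?_⟩
  set r := ‖z‖
  have hderiv (w : ℂ) (hw : w ∈ closedBall (0 : ℂ) r) :
      ‖deriv f w‖ ≤ C₁ * r ^ m * Real.exp (C₂ * r ^ d) := by
    have hw' : ‖w‖ ≤ r := by simpa using hw
    rw [hfd, norm_mul]
    refine mul_le_mul (hR r w hz hw') ?_ (norm_nonneg _) (by positivity)
    exact (Complex.norm_exp_le_exp_norm _).trans (Real.exp_le_exp.mpr (hh r w hz hw'))
  have hmv := (convex_closedBall (0 : ℂ) r).norm_image_sub_le_of_norm_deriv_le
    (fun w _ => hf w) hderiv (mem_closedBall_self (by positivity)) (y := z) (by simp [r])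
  rw [sub_zero] at hmv
  have hrd : r ≤ r ^ d := le_self_pow₀ hz hd
  have h1d : 1 ≤ r ^ d := one_le_pow₀ hz
  have hpow : r ^ m * r ≤ Real.exp ((m + 1) * r ^ d) := by
    calc r ^ m * r = r ^ (m + 1) := (pow_succ r m).symm
      _ ≤ Real.exp (r ^ d) ^ (m + 1) := by
        gcongr
        linarith [Real.add_one_le_exp (r ^ d)]
      _ = _ := by rw [← Real.exp_nat_mul]; push_cast; rfl
  have hexp1 : 1 ≤ Real.exp (((m + 1) + C₂) * r ^ d) := Real.one_le_exp (by positivity)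
  calc ‖f z‖ ≤ ‖f 0‖ + ‖f z - f 0‖ := by simpa using norm_add_le (f 0) (f z - f 0)
    _ ≤ ‖f 0‖ + C₁ * r ^ m * Real.exp (C₂ * r ^ d) * r := by gcongr
    _ = ‖f 0‖ + C₁ * ((r ^ m * r) * Real.exp (C₂ * r ^ d)) := by ring
    _ ≤ ‖f 0‖ + C₁ * (Real.exp ((m + 1) * r ^ d) * Real.exp (C₂ * r ^ d)) := by gcongr
    _ = ‖f 0‖ + C₁ * Real.exp (((m + 1) + C₂) * r ^ d) := by rw [← Real.exp_add, add_mul _ C₂]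
    _ ≤ (‖f 0‖ + C₁) * Real.exp (((m + 1) + C₂) * r ^ d) := by
      nlinarith [norm_nonneg (f 0)]
    _ ≤ Real.exp ((1 + (‖f 0‖ + C₁)) * r ^ d) * Real.exp (((m + 1) + C₂) * r ^ d) := by
      gcongr
      have := Real.add_one_le_exp ((1 + (‖f 0‖ + C₁)) * r ^ d)
      nlinarith [norm_nonneg (f 0)]
    _ = _ := by rw [← Real.exp_add, ← add_mul]

theorem logPlus_le {x y : ℝ} (hx : 0 ≤ x) (hy : 0 ≤ y) (h : x ≤ Real.exp y) : logPlus x ≤ y := by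
  refine max_le hy ?_
  rcases hx.eq_or_lt with rfl | hx
  · simpa using hy
  · exact (Real.log_le_iff_le_exp hx).mpr h

theorem le_exp_logPlus {x : ℝ} (hx : 0 ≤ x) : x ≤ Real.exp (logPlus x) := by
  rcases hx.eq_or_lt with rfl | hx
  · positivity
  · exact (Real.log_le_iff_le_exp hx).mp (le_max_right _ _)

theorem logPlus_nonneg (x : ℝ) : 0 ≤ logPlus x := le_max_left _ _

theorem entireOrder_le_of_norm_le_exp {f : ℂ → ℂ} {B : ℝ} {d : ℕ} (hB : 1 ≤ B)
    (hf : ∀ z : ℂ, 1 ≤ ‖z‖ → ‖f z‖ ≤ Real.exp (B * ‖z‖ ^ d)) : entireOrder f ≤ d := by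
  have hne : (comap (fun z : ℂ => ‖z‖) atTop).NeBot := by
    rw [comap_norm_atTop]; infer_instance
  have hlim : Tendsto (fun z : ℂ => ENNReal.ofReal (Real.log B / Real.log ‖z‖ + d))
      (comap (fun z : ℂ => ‖z‖) atTop) (𝓝 d) := by
    have h1 : Tendsto (fun z : ℂ => Real.log B / Real.log ‖z‖ + d)
        (comap (fun z : ℂ => ‖z‖) atTop) (𝓝 (0 + d)) :=
      ((Real.tendsto_log_atTop.comp tendsto_comap).const_div_atTop _).add_const _
    have h2 := ENNReal.tendsto_ofReal h1
    rwa [zero_add, ENNReal.ofReal_natCast] at h2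
  rw [entireOrder, ← hlim.limsup_eq]
  refine limsup_le_limsup ?_
  filter_upwards [tendsto_comap.eventually (eventually_gt_atTop (1 : ℝ))] with z hz
  have hlog : 0 < Real.log ‖z‖ := Real.log_pos hz
  have hz0 : ‖z‖ ^ d ≠ 0 := by positivity
  refine ENNReal.ofReal_le_ofReal ?_
  rw [div_add' _ _ _ hlog.ne']
  gcongr
  refine logPlus_le (logPlus_nonneg _)
    (add_nonneg (Real.log_nonneg hB) (by positivity)) ?_
  rw [Real.exp_add, Real.exp_log (by positivity), ← Real.log_pow, Real.exp_log (by positivity)]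
  exact logPlus_le (norm_nonneg _) (by positivity) (hf z hz.le)

theorem Polynomial.exists_pos_le_norm_eval_ray {R : Polynomial ℂ} (hR : R ≠ 0) {ω : ℂ}
    (hω : ‖ω‖ = 1) : ∃ δ : ℝ, 0 < δ ∧ ∀ᶠ t : ℝ in atTop, δ ≤ ‖R.eval (t * ω)‖ := by
  by_cases h : 0 < R.degree
  · have := R.tendsto_norm_atTop h (l := atTop) (z := fun t : ℝ => (t : ℂ) * ω)
      (by simpa [hω] using tendsto_abs_atTop_atTop)
    exact ⟨1, one_pos, this.eventually_ge_atTop 1⟩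
  · obtain ⟨c, rfl⟩ : ∃ c, R = Polynomial.C c :=
      ⟨_, Polynomial.eq_C_of_degree_le_zero (not_lt.mp h)⟩
    exact ⟨‖c‖, by simpa using hR, by simp⟩

theorem Polynomial.exists_le_re_eval_ray {h : Polynomial ℂ} (hd : h.natDegree ≠ 0) :
    ∃ (ω : ℂ) (C : ℝ), ‖ω‖ = 1 ∧ ∀ t : ℝ, 1 ≤ t →
      ‖h.leadingCoeff‖ * t ^ h.natDegree - C * t ^ (h.natDegree - 1) ≤ (h.eval (t * ω)).re := by
  have ha : h.leadingCoeff ≠ 0 := by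
    rw [Ne, Polynomial.leadingCoeff_eq_zero]
    rintro rfl
    simp at hd
  obtain ⟨ω, hω⟩ := IsAlgClosed.exists_pow_nat_eq ((‖h.leadingCoeff‖ : ℂ) / h.leadingCoeff)
    (Nat.pos_of_ne_zero hd)
  obtain ⟨C, -, hC⟩ := h.eraseLead.exists_norm_eval_le h.eraseLead_natDegree_le
  have hω1 : ‖ω‖ = 1 := by
    have := congrArg norm hω
    rw [norm_pow, norm_div, Complex.norm_real, norm_norm, div_self (norm_ne_zero_iff.mpr ha)] at this
    exact (pow_eq_one_iff_of_nonneg (norm_nonneg _) hd).mp this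
  refine ⟨ω, C, hω1, fun t ht => ?_⟩
  have ht0 : 0 ≤ t := by linarith
  have hnorm : ‖(t : ℂ) * ω‖ ≤ t := by simp [hω1, abs_of_nonneg ht0]
  have herase := (abs_le.mp ((Complex.abs_re_le_norm _).trans (hC t (t * ω) ht hnorm))).1
  have hsplit : h.eval (t * ω) =
      h.eraseLead.eval (t * ω) + ((‖h.leadingCoeff‖ * t ^ h.natDegree : ℝ) : ℂ) := by
    conv_lhs => rw [← h.eraseLead_add_C_mul_X_pow]
    simp only [Polynomial.eval_add, Polynomial.eval_mul, Polynomial.eval_C, Polynomial.eval_pow,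
      Polynomial.eval_X, mul_pow, hω]
    push_cast
    field_simp
  rw [hsplit, Complex.add_re, Complex.ofReal_re]
  linarith

theorem not_eventually_norm_le_exp_rpow {f : ℂ → ℂ} (hf : Differentiable ℂ f) {R h : Polynomial ℂ}
    (hR : R ≠ 0) (hd : h.natDegree ≠ 0)
    (hfd : ∀ z, deriv f z = R.eval z * Complex.exp (h.eval z)) {c : ℝ} (hc : 0 ≤ c)
    (hcd : c < h.natDegree) :
    ¬ ∀ᶠ z in comap (fun z : ℂ => ‖z‖) atTop, ‖f z‖ ≤ Real.exp (‖z‖ ^ c) := by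
  intro hev
  rw [eventually_comap, eventually_atTop] at hev
  obtain ⟨r₀, hr₀⟩ := hev
  obtain ⟨ω, C, hω, hre⟩ := Polynomial.exists_le_re_eval_ray hd
  obtain ⟨δ, hδ, hRδ⟩ := Polynomial.exists_pos_le_norm_eval_ray hR hω
  set d := h.natDegree
  set a := ‖h.leadingCoeff‖
  have ha : 0 < a := by
    rw [norm_pos_iff, Ne, Polynomial.leadingCoeff_eq_zero]
    rintro rfl
    simp [d] at hd
  have hmain : ∀ᶠ t : ℝ in atTop,
      a ≤ 2 ^ c * t ^ (c - d) + C * t⁻¹ - Real.log δ * (t ^ d)⁻¹ := by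
    filter_upwards [hRδ, eventually_ge_atTop (1 : ℝ), eventually_ge_atTop (r₀ + 1)] with t hδt ht htr
    have ht0 : 0 < t := by linarith
    have hnorm : ‖(t : ℂ) * ω‖ = t := by simp [hω, ht0.le]
    have hcauchy : ‖deriv f (t * ω)‖ ≤ Real.exp ((2 * t) ^ c) / 1 := by
      refine Complex.norm_deriv_le_of_forall_mem_sphere_norm_le one_pos
        hf.diffContOnCl fun w hw => ?_
      rw [mem_sphere_iff_norm] at hw
      have h1 := norm_sub_norm_le ((t : ℂ) * ω) w
      have h2 := norm_sub_norm_le w ((t : ℂ) * ω)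
      rw [norm_sub_rev] at h1
      refine (hr₀ ‖w‖ (by linarith) w rfl).trans ?_
      gcongr
      linarith
    rw [div_one, hfd, norm_mul, Complex.norm_exp] at hcauchy
    have hlow : Real.exp (Real.log δ + (a * t ^ d - C * t ^ (d - 1))) ≤ Real.exp ((2 * t) ^ c) := by
      rw [Real.exp_add, Real.exp_log hδ]
      refine le_trans ?_ hcauchy
      gcongr
      exact hre t ht
    rw [Real.exp_le_exp, Real.mul_rpow zero_le_two ht0.le] at hlow
    have htd : 0 < t ^ d := by positivity
    have hpow : t ^ d = t ^ (d - 1) * t := by rw [← pow_succ, Nat.sub_add_cancel (by omega)]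
    rw [Real.rpow_sub ht0, Real.rpow_natCast]
    have : 2 ^ c * (t ^ c / t ^ d) + C * t⁻¹ - Real.log δ * (t ^ d)⁻¹ =
        (2 ^ c * t ^ c + C * t ^ (d - 1) - Real.log δ) / t ^ d := by
      rw [hpow]
      field_simp
    rw [this, le_div_iff₀ htd]
    linarith
  have hlim : Tendsto (fun t : ℝ => 2 ^ c * t ^ (c - d) + C * t⁻¹ - Real.log δ * (t ^ d)⁻¹) atTop
      (𝓝 (2 ^ c * 0 + C * 0 - Real.log δ * 0)) := by
    have h1 : Tendsto (fun t : ℝ => t ^ (c - d)) atTop (𝓝 0) := by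
      simpa using tendsto_rpow_neg_atTop (sub_pos.mpr hcd)
    exact ((h1.const_mul _).add (tendsto_inv_atTop_zero.const_mul _)).sub
      ((tendsto_inv_atTop_zero.comp (tendsto_pow_atTop hd)).const_mul _)
  have := ge_of_tendsto hlim hmain
  simp at this
  linarith

theorem le_entireOrder_of_deriv_eq {f : ℂ → ℂ} (hf : Differentiable ℂ f) {R h : Polynomial ℂ}
    (hR : R ≠ 0) (hd : h.natDegree ≠ 0)
    (hfd : ∀ z, deriv f z = R.eval z * Complex.exp (h.eval z)) :
    (h.natDegree : ℝ≥0∞) ≤ entireOrder f := by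
  by_contra! hlt
  obtain ⟨c, hc, hcd⟩ := exists_between hlt
  have hctop : c ≠ ⊤ := ne_top_of_lt hcd
  have hcd' : c.toReal < h.natDegree := by
    simpa using (ENNReal.toReal_lt_toReal hctop (ENNReal.natCast_ne_top _)).mpr hcd
  refine not_eventually_norm_le_exp_rpow hf hR hd hfd ENNReal.toReal_nonneg hcd' ?_
  filter_upwards [eventually_lt_of_limsup_lt hc,
    tendsto_comap.eventually (eventually_gt_atTop (1 : ℝ))] with z hz hz1
  have hlog : 0 < Real.log ‖z‖ := Real.log_pos hz1
  have hz' := (ENNReal.ofReal_le_iff_le_toReal hctop).mp hz.le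
  rw [div_le_iff₀ hlog] at hz'
  refine (le_exp_logPlus (norm_nonneg _)).trans (Real.exp_le_exp.mpr ?_)
  refine (le_exp_logPlus (logPlus_nonneg _)).trans ?_
  rw [Real.rpow_def_of_pos (by linarith), mul_comm (Real.log ‖z‖)]
  exact Real.exp_le_exp.mpr hz'

theorem order_of_rational_nonlinearity (f : ℂ → ℂ)
    (hf : TranscendentalEntire f)
    (P Q : Polynomial ℂ) (hcop : IsCoprime P Q) (hQ : Q ≠ 0)
    (heq : ∀ z : ℂ, deriv (deriv f) z * Q.eval z = deriv f z * P.eval z) :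
    Q.natDegree ≤ P.natDegree ∧
      entireOrder f = ((1 + P.natDegree - Q.natDegree : ℕ) : ℝ≥0∞) := by
  obtain ⟨hdiff, htrans⟩ := hf
  have hne : deriv f ≠ 0 := fun h0 =>
    htrans (exists_eval_of_deriv_eq_eval hdiff (p := 0) fun z => by simp [h0])
  obtain ⟨R, h, hR, hfd⟩ := exists_eq_eval_mul_exp_eval hdiff.deriv hne hQ heq
  have hd : h.natDegree ≠ 0 := fun h0 => by
    obtain ⟨c, rfl⟩ := Polynomial.natDegree_eq_zero.mp h0
    exact htrans (exists_eval_of_deriv_eq_eval hdiff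
      (p := R * Polynomial.C (Complex.exp c)) fun z => by simp [hfd])
  have hdeg := natDegree_eq_of_deriv_eval_mul_exp (P := P) hR hQ hd fun z => by
    rw [← funext hfd, ← hfd, heq]
  refine ⟨by omega, ?_⟩
  rw [show 1 + P.natDegree - Q.natDegree = h.natDegree by omega]
  obtain ⟨B, hB, hfB⟩ := exists_norm_le_exp_of_deriv_eq hdiff hd hfd
  exact le_antisymm (entireOrder_le_of_norm_le_exp hB hfB)
    (le_entireOrder_of_deriv_eq hdiff hR hd hfd)
end

section
/- Let f and g be nonconstant entire functions and φ, ψ : ℂ → ℂ homeomorphisms with ψ ∘ f = g ∘ φ. Then the set of critical values of g equals the ψ-image of the set of critical values of f, i.e. C(g) = ψ(C(f)), and the set of finite asymptotic values of g equals the ψ-image of the set of finite asymptotic values of f, i.e. A(g) = ψ(A(f)). -/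
open Complex Set Filter Topology Metric MeasureTheory
open scoped ENNReal Real

def criticalValues (f : ℂ → ℂ) : Set ℂ := {w : ℂ | ∃ z : ℂ, deriv f z = 0 ∧ f z = w}

def asymptoticValues (f : ℂ → ℂ) : Set ℂ :=
  {a : ℂ | ∃ γ : ℝ → ℂ, ContinuousOn γ (Set.Ico 0 1) ∧
    Filter.Tendsto (fun t => ‖γ t‖) (nhdsWithin 1 (Set.Ico (0 : ℝ) 1)) Filter.atTop ∧
    Filter.Tendsto (fun t => f (γ t)) (nhdsWithin 1 (Set.Ico (0 : ℝ) 1)) (nhds a)}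

/-- A holomorphic function with vanishing derivative at a point is not injective near it. -/
lemma AnalyticAt.deriv_ne_zero_of_injOn {f : ℂ → ℂ} {z : ℂ} {U : Set ℂ}
    (hf : AnalyticAt ℂ f z) (hU : U ∈ 𝓝 z) (hinj : InjOn f U) : deriv f z ≠ 0 := by
  intro hd
  have hfa : AnalyticAt ℂ (f · - f z) z := by fun_prop
  by_cases htop : analyticOrderAt (f · - f z) z = ⊤
  · rw [analyticOrderAt_eq_top] at htop
    have h1 : ∀ᶠ w in 𝓝[≠] z, f w - f z = 0 ∧ w ∈ U ∧ w ≠ z :=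
      (htop.filter_mono nhdsWithin_le_nhds).and
      ((Filter.Eventually.filter_mono nhdsWithin_le_nhds hU).and self_mem_nhdsWithin)
    obtain ⟨w, hw, hwU, hwz⟩ := h1.exists
    exact hwz (hinj hwU (mem_of_mem_nhds hU) (sub_eq_zero.mp hw))
  obtain ⟨n, hn⟩ := ENat.ne_top_iff_exists.mp htop
  obtain ⟨F, hFa, hF0, hfF⟩ := (hfa.analyticOrderAt_eq_natCast).mp hn.symm
  have hn2 : 1 < n := by
    by_contra! hlt
    interval_cases n
    · have := hfF.self_of_nhds
      simp_all
    · have hev : f =ᶠ[𝓝 z] fun w => (w - z) * F w + f z := by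
        filter_upwards [hfF] with w hw
        simp only [pow_one, smul_eq_mul] at hw
        rw [← hw]; ring
      have hd' : HasDerivAt (fun w => (w - z) * F w + f z) (1 * F z + (z - z) * deriv F z) z :=
        (((hasDerivAt_id z).sub_const z).mul hFa.differentiableAt.hasDerivAt).add_const _
      rw [hev.deriv_eq, hd'.deriv] at hd
      simp_all
  have hn0 : n ≠ 0 := by omega
  obtain ⟨c, hc⟩ := IsAlgClosed.exists_pow_nat_eq (F z) (Nat.pos_of_ne_zero hn0)
  have hc0 : c ≠ 0 := by
    rintro rfl
    exact hF0 (by rw [← hc, zero_pow hn0])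
  have hq : AnalyticAt ℂ (fun w => F w / F z) z := by fun_prop (disch := assumption)
  set h : ℂ → ℂ := fun w => c * Complex.exp (Complex.log (F w / F z) / n) with hh
  have hha : AnalyticAt ℂ h z :=
    analyticAt_const.mul ((hq.clog (by simp [hF0])).div analyticAt_const (by simpa)).cexp
  have hhz : h z = c := by simp [hh, hF0]
  have hpow : ∀ᶠ w in 𝓝 z, h w ^ n = F w := by
    filter_upwards [hFa.continuousAt.eventually_ne hF0] with w hw
    rw [hh]
    simp only
    rw [mul_pow, ← Complex.exp_nat_mul, mul_div_cancel₀ _ (by simpa), Complex.exp_log (by positivity),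
      hc, mul_div_cancel₀ _ hF0]
  have hGa : AnalyticAt ℂ (fun w => (w - z) * h w) z := by fun_prop
  have hGd : HasStrictDerivAt (fun w => (w - z) * h w) c z := by
    have h1 : HasDerivAt (fun w => (w - z) * h w) (1 * h z + (z - z) * deriv h z) z :=
      ((hasDerivAt_id z).sub_const z).mul hha.differentiableAt.hasDerivAt
    have h2 := hGa.hasStrictDerivAt
    rw [h1.deriv, hhz] at h2
    simpa using h2
  have hmap := hGd.map_nhds_eq hc0
  simp only [sub_self, zero_mul] at hmap
  have hV : {w | w ∈ U ∧ f w - f z = ((w - z) * h w) ^ n} ∈ 𝓝 z := by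
    filter_upwards [hU, hpow, hfF] with w h1 h2 h3
    exact ⟨h1, by rw [h3, mul_pow, h2, smul_eq_mul]⟩
  have himg := hmap ▸ image_mem_map hV
  obtain ⟨ε, hε, hball⟩ := Metric.mem_nhds_iff.mp himg
  obtain ⟨ζ, hζ⟩ : ∃ ζ : ℂ, IsPrimitiveRoot ζ n := ⟨_, Complex.isPrimitiveRoot_exp n hn0⟩
  have hu0 : ((ε / 2 : ℝ) : ℂ) ≠ 0 := by
    exact_mod_cast (half_pos hε).ne'
  have hnorm : ‖((ε / 2 : ℝ) : ℂ)‖ < ε := by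
    rw [Complex.norm_real, Real.norm_of_nonneg (half_pos hε).le]
    exact half_lt_self hε
  obtain ⟨w₁, ⟨hw₁U, hw₁⟩, hw₁'⟩ := hball (mem_ball_zero_iff.mpr hnorm)
  have hnorm' : ‖ζ * ((ε / 2 : ℝ) : ℂ)‖ < ε := by
    rwa [norm_mul, hζ.norm'_eq_one hn0, one_mul]
  obtain ⟨w₂, ⟨hw₂U, hw₂⟩, hw₂'⟩ := hball (mem_ball_zero_iff.mpr hnorm')
  simp only at hw₁' hw₂'
  have hww : w₁ = w₂ := by
    refine hinj hw₁U hw₂U (sub_left_injective (b := f z) ?_)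
    simp only
    rw [hw₁, hw₂, hw₁', hw₂', mul_pow, hζ.pow_eq_one, one_mul]
  rw [hww, hw₂'] at hw₁'
  exact hζ.ne_one hn2 (mul_right_cancel₀ hu0 (hw₁'.trans (one_mul _).symm))

lemma HasStrictDerivAt.exists_mem_nhds_injOn {f : ℂ → ℂ} {f' z : ℂ}
    (hf : HasStrictDerivAt f f' z) (hf' : f' ≠ 0) : ∃ U ∈ 𝓝 z, InjOn f U := by
  have hF := hf.hasStrictFDerivAt_equiv hf'
  refine ⟨(hF.toOpenPartialHomeomorph f).source,
    (hF.toOpenPartialHomeomorph f).open_source.mem_nhds hF.mem_toOpenPartialHomeomorph_source, ?_⟩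
  simpa using (hF.toOpenPartialHomeomorph f).injOn

/-- Topological equivalence maps critical values to critical values. -/
lemma image_criticalValues_subset {f g : ℂ → ℂ} (hf : Differentiable ℂ f)
    (hg : Differentiable ℂ g) (φ ψ : ℂ ≃ₜ ℂ) (hequiv : ∀ z, ψ (f z) = g (φ z)) :
    ψ '' criticalValues f ⊆ criticalValues g := by
  rintro _ ⟨_, ⟨z, hz, rfl⟩, rfl⟩
  refine ⟨φ z, ?_, (hequiv z).symm⟩
  by_contra hne
  obtain ⟨U, hU, hinj⟩ := (hg.analyticAt (φ z)).hasStrictDerivAt.exists_mem_nhds_injOn hne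
  refine (hf.analyticAt z).deriv_ne_zero_of_injOn (φ.continuous.continuousAt hU) ?_ hz
  intro a ha b hb hab
  exact φ.injective (hinj ha hb (by rw [← hequiv, ← hequiv, hab]))

/-- Topological equivalence maps asymptotic values to asymptotic values. -/
lemma image_asymptoticValues_subset {f g : ℂ → ℂ} (φ ψ : ℂ ≃ₜ ℂ)
    (hequiv : ∀ z, ψ (f z) = g (φ z)) :
    ψ '' asymptoticValues f ⊆ asymptoticValues g := by
  rintro _ ⟨a, ⟨γ, hγ, hγ', hfγ⟩, rfl⟩
  refine ⟨φ ∘ γ, φ.continuous.comp_continuousOn hγ, ?_, ?_⟩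
  · rw [tendsto_norm_atTop_iff_cobounded, cobounded_eq_cocompact] at hγ'
    exact (tendsto_norm_cocompact_atTop.comp
      φ.isClosedEmbedding.tendsto_cocompact).comp hγ'
  · simp only [Function.comp_apply, ← hequiv]
    exact (ψ.continuous.tendsto a).comp hfγ

theorem equivalence_respects_critical_and_asymptotic_values (f g : ℂ → ℂ)
    (hf : Differentiable ℂ f) (hg : Differentiable ℂ g)
    (hfnc : ∃ a b : ℂ, f a ≠ f b) (hgnc : ∃ a b : ℂ, g a ≠ g b)
    (φ ψ : ℂ ≃ₜ ℂ) (hequiv : ∀ z : ℂ, ψ (f z) = g (φ z)) :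
    criticalValues g = ψ '' criticalValues f ∧
      asymptoticValues g = ψ '' asymptoticValues f := by
  have hequiv' : ∀ z, ψ.symm (g z) = f (φ.symm z) := fun z => by
    rw [ψ.symm_apply_eq, hequiv, φ.apply_symm_apply]
  have pull : ∀ {s t : Set ℂ}, ψ.symm '' s ⊆ t → s ⊆ ψ '' t := fun h w hw =>
    ⟨ψ.symm w, h (mem_image_of_mem _ hw), ψ.apply_symm_apply w⟩
  exact ⟨(pull (image_criticalValues_subset hg hf φ.symm ψ.symm hequiv')).antisymm
      (image_criticalValues_subset hf hg φ ψ hequiv),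
    (pull (image_asymptoticValues_subset φ.symm ψ.symm hequiv')).antisymm
      (image_asymptoticValues_subset φ ψ hequiv)⟩
end

section
/- Let h : ℂ → ℂ be an entire function with a repelling fixed point ζ, i.e. h(ζ) = ζ and |λ| > 1 where λ = h′(ζ). Then there exists a unique entire function f : ℂ → ℂ such that f(0) = ζ, f′(0) = 1, and f(λz) = h(f(z)) for all z ∈ ℂ. -/
open Complex Set Filter Topology Metric MeasureTheory
open scoped ENNReal Real

/-- Scaling induction: a property that holds near `0` and passes from `z / a` to `z`, where
`1 < ‖a‖`, holds everywhere. -/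
theorem forall_of_forall_norm_lt_of_div {a : ℂ} (ha : 1 < ‖a‖) {r : ℝ} (hr : 0 < r)
    {P : ℂ → Prop} (hball : ∀ z, ‖z‖ < r → P z) (hdiv : ∀ z, P (z / a) → P z) (z : ℂ) :
    P z := by
  obtain ⟨n, hn⟩ := pow_unbounded_of_one_lt (‖z‖ / r) ha
  have key : ∀ n : ℕ, ∀ z, ‖z‖ < ‖a‖ ^ n * r → P z := by
    intro n
    induction n with
    | zero => simpa using hball
    | succ n ih =>
      intro z hz
      refine hdiv z (ih _ ?_)
      rw [norm_div, div_lt_iff₀ (by positivity)]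
      calc ‖z‖ < ‖a‖ ^ (n + 1) * r := hz
        _ = _ := by ring
  exact key n z ((div_lt_iff₀ hr).1 hn)

/-- The first order Taylor estimate for an entire function. -/
theorem exists_norm_sub_sub_le_mul_sq {f : ℂ → ℂ} (hf : Differentiable ℂ f)
    (c : ℂ) : ∃ C r : ℝ, 0 < C ∧ 0 < r ∧
      ∀ z, ‖z‖ < r → ‖f (c + z) - f c - deriv f c * z‖ ≤ C * ‖z‖ ^ 2 := by
  have hd : Differentiable ℂ (dslope (dslope f c) c) := by
    have aux : ∀ g : ℂ → ℂ, Differentiable ℂ g → Differentiable ℂ (dslope g c) := fun g hg =>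
      differentiableOn_univ.1 ((differentiableOn_dslope univ_mem).2 hg.differentiableOn)
    exact aux _ (aux _ hf)
  have hb : ∀ᶠ z in 𝓝 c, ‖dslope (dslope f c) c z‖ < ‖dslope (dslope f c) c c‖ + 1 :=
    hd.continuous.norm.continuousAt.eventually_lt continuousAt_const (lt_add_one _)
  obtain ⟨r, hr, hball⟩ := Metric.eventually_nhds_iff.1 hb
  refine ⟨‖dslope (dslope f c) c c‖ + 1, r, by positivity, hr, fun z hz => ?_⟩
  have h1 := sub_smul_dslope f c (c + z)
  have h2 := sub_smul_dslope (dslope f c) c (c + z)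
  simp only [add_sub_cancel_left, smul_eq_mul, dslope_same] at h1 h2
  have h3 : f (c + z) - f c - deriv f c * z = dslope (dslope f c) c (c + z) * z ^ 2 := by
    rw [← h1]
    linear_combination -z * h2
  rw [h3, norm_mul, norm_pow]
  gcongr
  exact (hball (by simpa using hz)).le

/-- An entire function is Lipschitz near a repelling point, with a constant smaller than the
square of the modulus of the multiplier. -/
theorem exists_lipschitz_lt_norm_deriv_sq {h : ℂ → ℂ} (hh : Differentiable ℂ h)
    {c : ℂ} (hrep : 1 < ‖deriv h c‖) :
    ∃ L δ : ℝ, 0 < L ∧ L < ‖deriv h c‖ ^ 2 ∧ 0 < δ ∧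
      ∀ x y, ‖x - c‖ < δ → ‖y - c‖ < δ → ‖h x - h y‖ ≤ L * ‖x - y‖ := by
  have hsq : ‖deriv h c‖ < ‖deriv h c‖ ^ 2 := by nlinarith
  obtain ⟨L, hL, hL'⟩ := exists_between hsq
  have hL0 : 0 < L := by linarith
  lift L to NNReal using hL0.le
  have hs : HasStrictDerivAt h (deriv h c) c := (hh.analyticAt c).hasStrictDerivAt
  obtain ⟨s, hs, hlip⟩ := hs.hasStrictFDerivAt.exists_lipschitzOnWith_of_nnnorm_lt L
    (by rw [← NNReal.coe_lt_coe]; simpa using hL)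
  obtain ⟨δ, hδ, hball⟩ := Metric.mem_nhds_iff.1 hs
  refine ⟨L, δ, hL0, hL', hδ, fun x y hx hy => ?_⟩
  have := hlip.dist_le_mul x (hball (by simpa [dist_eq_norm] using hx)) y
    (hball (by simpa [dist_eq_norm] using hy))
  simpa [dist_eq_norm] using this

/-- The iterative approximations to the Poincaré function, starting from `z ↦ ζ + z`. -/
noncomputable def poincareApprox (h : ℂ → ℂ) (ζ : ℂ) : ℕ → ℂ → ℂ
  | 0 => fun z => ζ + z
  | n + 1 => fun z => h (poincareApprox h ζ n (z / deriv h ζ))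

theorem differentiable_poincareApprox {h : ℂ → ℂ} (hh : Differentiable ℂ h) (ζ : ℂ) (n : ℕ) :
    Differentiable ℂ (poincareApprox h ζ n) := by
  induction n with
  | zero => exact differentiable_id.const_add ζ
  | succ n ih => exact hh.comp (ih.comp (differentiable_id.div_const _))

theorem exists_poincareApprox_estimates {h : ℂ → ℂ} (hh : Differentiable ℂ h) {ζ : ℂ}
    (hfix : h ζ = ζ) (hrep : 1 < ‖deriv h ζ‖) :
    ∃ K q r : ℝ, 0 < K ∧ 0 < q ∧ q < 1 ∧ 0 < r ∧ ∀ z, ‖z‖ < r → ∀ n,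
      ‖poincareApprox h ζ n z - (ζ + z)‖ ≤ K * ‖z‖ ^ 2 ∧
      ‖poincareApprox h ζ (n + 1) z - poincareApprox h ζ n z‖ ≤ K * ‖z‖ ^ 2 * q ^ n := by
  obtain ⟨L, δ, hL0, hL, hδ, hlip⟩ := exists_lipschitz_lt_norm_deriv_sq hh hrep
  obtain ⟨C, ρ, hC, hρ, htaylor⟩ := exists_norm_sub_sub_le_mul_sq hh ζ
  rw [hfix] at htaylor
  generalize hl : deriv h ζ = l at *
  have hl0 : l ≠ 0 := norm_pos_iff.1 (by linarith)
  have hl2 : 0 < ‖l‖ ^ 2 := by positivity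
  obtain ⟨q, rfl⟩ : ∃ q, L = q * ‖l‖ ^ 2 := ⟨L / ‖l‖ ^ 2, by field_simp⟩
  have hq0 : 0 < q := pos_of_mul_pos_left hL0 hl2.le
  have hq1 : q < 1 := by nlinarith
  obtain ⟨K, hK0, hK⟩ : ∃ K : ℝ, 0 < K ∧ q * K + C = K := by
    have : 0 < 1 - q := by linarith
    exact ⟨C / (1 - q), by positivity, by field_simp; ring⟩
  obtain ⟨r, hr0, hrρ, hr1, hrδ⟩ : ∃ r : ℝ, 0 < r ∧ r ≤ ρ ∧ r ≤ 1 ∧ r * (1 + K) ≤ δ := by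
    refine ⟨min ρ (min 1 (δ / (1 + K))), by positivity, min_le_left _ _,
      (min_le_right _ _).trans (min_le_left _ _), ?_⟩
    rw [← le_div_iff₀ (by positivity)]
    exact (min_le_right _ _).trans (min_le_right _ _)
  have hdiv : ∀ z, ‖z‖ < r → ‖z / l‖ < r := fun z hz => by
    rw [norm_div]
    exact (div_le_self (norm_nonneg z) hrep.le).trans_lt hz
  have hsq : ∀ z, ‖z / l‖ ^ 2 * ‖l‖ ^ 2 = ‖z‖ ^ 2 := fun z => by
    rw [← mul_pow, ← norm_mul, div_mul_cancel₀ z hl0]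
  have hclose : ∀ z w, ‖z‖ < r → ‖w - (ζ + z)‖ ≤ K * ‖z‖ ^ 2 → ‖w - ζ‖ < δ := by
    intro z w hz hw
    have h1 : ‖w - ζ‖ ≤ ‖w - (ζ + z)‖ + ‖z‖ := by
      calc ‖w - ζ‖ = ‖(w - (ζ + z)) + z‖ := by ring_nf
        _ ≤ _ := norm_add_le _ _
    have h2 : K * ‖z‖ ^ 2 ≤ K * ‖z‖ := by
      gcongr
      nlinarith [norm_nonneg z]
    nlinarith
  have hstep : ∀ z x y B, ‖z‖ < r → ‖x - (ζ + z / l)‖ ≤ K * ‖z / l‖ ^ 2 →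
      ‖y - (ζ + z / l)‖ ≤ K * ‖z / l‖ ^ 2 → ‖x - y‖ ≤ B * ‖z / l‖ ^ 2 →
      ‖h x - h y‖ ≤ q * B * ‖z‖ ^ 2 := by
    intro z x y B hz hx hy hxy
    calc ‖h x - h y‖ ≤ q * ‖l‖ ^ 2 * ‖x - y‖ :=
          hlip x y (hclose _ _ (hdiv z hz) hx) (hclose _ _ (hdiv z hz) hy)
      _ ≤ q * ‖l‖ ^ 2 * (B * ‖z / l‖ ^ 2) := by gcongr
      _ = q * B * ‖z‖ ^ 2 := by rw [← hsq z]; ring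
  have hsucc : ∀ n z, poincareApprox h ζ (n + 1) z = h (poincareApprox h ζ n (z / l)) :=
    fun n z => by rw [← hl]; rfl
  have hA : ∀ n z, ‖z‖ < r → ‖poincareApprox h ζ n z - (ζ + z)‖ ≤ K * ‖z‖ ^ 2 := by
    intro n
    induction n with
    | zero =>
      intro z _
      simp only [poincareApprox, sub_self, norm_zero]
      positivity
    | succ n ih =>
      intro z hz
      have h1 := ih _ (hdiv z hz)
      have h2 := hstep z _ (ζ + z / l) K hz h1 (by simp only [sub_self, norm_zero]; positivity) h1
      have h3 := htaylor _ ((hdiv z hz).trans_le hrρ)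
      rw [mul_div_cancel₀ z hl0] at h3
      have h4 : C * ‖z / l‖ ^ 2 ≤ C * ‖z‖ ^ 2 := by
        rw [norm_div]
        gcongr
        exact div_le_self (norm_nonneg z) hrep.le
      rw [hsucc]
      calc ‖h (poincareApprox h ζ n (z / l)) - (ζ + z)‖
          = ‖(h (poincareApprox h ζ n (z / l)) - h (ζ + z / l)) +
              (h (ζ + z / l) - ζ - z)‖ := by ring_nf
        _ ≤ q * K * ‖z‖ ^ 2 + C * ‖z‖ ^ 2 := (norm_add_le _ _).trans (add_le_add h2 (h3.trans h4))
        _ = (q * K + C) * ‖z‖ ^ 2 := by ring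
        _ = K * ‖z‖ ^ 2 := by rw [hK]
  refine ⟨K, q, r, hK0, hq0, hq1, hr0, fun z hz n => ⟨hA n z hz, ?_⟩⟩
  induction n generalizing z with
  | zero => simpa [poincareApprox] using hA 1 z hz
  | succ n ih =>
    rw [hsucc (n + 1) z, hsucc n z]
    calc _ ≤ q * (K * q ^ n) * ‖z‖ ^ 2 :=
          hstep z _ _ _ hz (hA _ _ (hdiv z hz)) (hA _ _ (hdiv z hz))
            ((ih _ (hdiv z hz)).trans_eq (by ring))
      _ = K * ‖z‖ ^ 2 * q ^ (n + 1) := by ring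

theorem exists_poincare_function {h : ℂ → ℂ} (hh : Differentiable ℂ h) {ζ : ℂ}
    (hfix : h ζ = ζ) (hrep : 1 < ‖deriv h ζ‖) :
    ∃ f : ℂ → ℂ, Differentiable ℂ f ∧ f 0 = ζ ∧ deriv f 0 = 1 ∧
      ∀ z : ℂ, f (deriv h ζ * z) = h (f z) := by
  obtain ⟨K, q, r, hK, hq0, hq1, hr, hest⟩ := exists_poincareApprox_estimates hh hfix hrep
  have hl0 : deriv h ζ ≠ 0 := norm_pos_iff.1 (by linarith)
  have hdist : ∀ z, ‖z‖ < r → ∀ n, dist (poincareApprox h ζ n z) (poincareApprox h ζ (n + 1) z) ≤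
      K * ‖z‖ ^ 2 * q ^ n := fun z hz n => by
    rw [dist_comm, dist_eq_norm]
    exact (hest z hz n).2
  have hlim : ∀ z, ∃ w, Tendsto (fun n => poincareApprox h ζ n z) atTop (𝓝 w) := by
    refine forall_of_forall_norm_lt_of_div hrep hr (fun z hz => ?_) fun z ⟨w, hw⟩ => ?_
    · exact cauchySeq_tendsto_of_complete (cauchySeq_of_le_geometric q _ hq1 (hdist z hz))
    · exact ⟨h w, (tendsto_add_atTop_iff_nat 1).1 ((hh.continuous.tendsto w).comp hw)⟩
  choose f hf using hlim
  have hfdiv : ∀ z, f z = h (f (z / deriv h ζ)) := fun z =>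
    tendsto_nhds_unique ((tendsto_add_atTop_iff_nat 1).2 (hf z))
      ((hh.continuous.tendsto _).comp (hf (z / deriv h ζ)))
  have hunif : TendstoUniformlyOn (poincareApprox h ζ) f atTop (ball 0 r) := by
    have hgeom : Tendsto (fun n : ℕ => K * r ^ 2 * q ^ n / (1 - q)) atTop (𝓝 0) := by
      simpa using ((tendsto_pow_atTop_nhds_zero_of_lt_one hq0.le hq1).const_mul
        (K * r ^ 2)).div_const (1 - q)
    rw [Metric.tendstoUniformlyOn_iff]
    intro ε hε
    filter_upwards [hgeom.eventually_lt_const hε] with n hn z hz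
    rw [mem_ball_zero_iff] at hz
    rw [dist_comm]
    refine (dist_le_of_le_geometric_of_tendsto q _ hq1 (hdist z hz) (hf z) n).trans_lt
      (lt_of_le_of_lt ?_ hn)
    have : 0 < 1 - q := by linarith
    gcongr
  have hdiff : ∀ z, DifferentiableAt ℂ f z := by
    refine forall_of_forall_norm_lt_of_div hrep hr (fun z hz => ?_) fun z hz => ?_
    · exact (hunif.tendstoLocallyUniformlyOn.differentiableOn
        (.of_forall fun n => (differentiable_poincareApprox hh ζ n).differentiableOn)
        isOpen_ball).differentiableAt (isOpen_ball.mem_nhds (by simpa using hz))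
    · rw [funext hfdiv]
      exact (hh _).comp z (hz.comp z (differentiableAt_id.div_const _))
  have hquad : ∀ z, ‖z‖ < r → ‖f z - (ζ + z)‖ ≤ K * ‖z‖ ^ 2 := fun z hz =>
    le_of_tendsto ((hf z).sub_const _).norm (.of_forall fun n => (hest z hz n).1)
  have hf0 : f 0 = ζ := by
    simpa [sub_eq_zero] using hquad 0 (by simpa using hr)
  have hderiv : HasDerivAt f 1 0 := by
    rw [hasDerivAt_iff_isLittleO]
    have hO : (fun z => f z - f 0 - (z - 0) • (1 : ℂ)) =O[𝓝 0] fun z => z ^ 2 := by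
      refine .of_bound K ?_
      filter_upwards [ball_mem_nhds (0 : ℂ) hr] with z hz
      simpa [hf0, sub_sub] using hquad z (by simpa using hz)
    simpa using hO.trans_isLittleO (Asymptotics.isLittleO_pow_id one_lt_two)
  exact ⟨f, hdiff, hf0, hderiv.deriv, fun z => by
    rw [hfdiv, mul_div_cancel_left₀ z hl0]⟩

theorem eq_of_poincare_functional_equation {h : ℂ → ℂ} (hh : Differentiable ℂ h) {ζ : ℂ}
    (hrep : 1 < ‖deriv h ζ‖) {f g : ℂ → ℂ}
    (hf : Differentiable ℂ f) (hf0 : f 0 = ζ) (hf1 : deriv f 0 = 1)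
    (hfh : ∀ z, f (deriv h ζ * z) = h (f z))
    (hg : Differentiable ℂ g) (hg0 : g 0 = ζ) (hg1 : deriv g 0 = 1)
    (hgh : ∀ z, g (deriv h ζ * z) = h (g z)) : f = g := by
  obtain ⟨L, δ, hL0, hL, hδ, hlip⟩ := exists_lipschitz_lt_norm_deriv_sq hh hrep
  obtain ⟨C, ρ, hC, hρ, htaylor⟩ := exists_norm_sub_sub_le_mul_sq (hf.sub hg) 0
  have hquad : ∀ z, ‖z‖ < ρ → ‖f z - g z‖ ≤ C * ‖z‖ ^ 2 := fun z hz => by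
    simpa [hf0, hg0, deriv_sub hf.differentiableAt hg.differentiableAt, hf1, hg1]
      using htaylor z hz
  have hnear : ∀ᶠ z in 𝓝 (0 : ℂ), ‖f z - ζ‖ < δ ∧ ‖g z - ζ‖ < δ := by
    have aux : ∀ k : ℂ → ℂ, Differentiable ℂ k → k 0 = ζ → ∀ᶠ z in 𝓝 (0 : ℂ), ‖k z - ζ‖ < δ :=
      fun k hk hk0 => (hk.continuous.sub continuous_const).norm.continuousAt.eventually_lt
        continuousAt_const (by simpa [hk0] using hδ)
    exact (aux f hf hf0).and (aux g hg hg0)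
  obtain ⟨ε, hε, hball⟩ := Metric.eventually_nhds_iff.1 hnear
  generalize deriv h ζ = l at *
  have hl0 : l ≠ 0 := norm_pos_iff.1 (by linarith)
  have hl2 : 0 < ‖l‖ ^ 2 := by positivity
  have hdiv : ∀ k : ℂ → ℂ, (∀ z, k (l * z) = h (k z)) → ∀ z, k z = h (k (z / l)) :=
    fun k hk z => by rw [← hk, mul_div_cancel₀ z hl0]
  have hpow : ∀ (n : ℕ) z, ‖z‖ < min ρ ε → ‖f z - g z‖ ≤ (L / ‖l‖ ^ 2) ^ n * (C * ‖z‖ ^ 2) := by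
    intro n
    induction n with
    | zero => exact fun z hz => by simpa using hquad z (hz.trans_le (min_le_left _ _))
    | succ n ih =>
      intro z hz
      have hz' : ‖z / l‖ < min ρ ε := by
        rw [norm_div]
        exact (div_le_self (norm_nonneg z) hrep.le).trans_lt hz
      obtain ⟨h1, h2⟩ := hball (y := z / l)
        (by simpa [-norm_div] using hz'.trans_le (min_le_right _ _))
      rw [hdiv f hfh, hdiv g hgh]
      calc _ ≤ L * ‖f (z / l) - g (z / l)‖ := hlip _ _ h1 h2
        _ ≤ L * ((L / ‖l‖ ^ 2) ^ n * (C * ‖z / l‖ ^ 2)) := by gcongr; exact ih _ hz'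
        _ = _ := by rw [norm_div]; ring
  refine funext (forall_of_forall_norm_lt_of_div hrep (lt_min hρ hε) (fun z hz => ?_)
    fun z hz => by rw [hdiv f hfh, hdiv g hgh, hz])
  have hlim : Tendsto (fun n : ℕ => (L / ‖l‖ ^ 2) ^ n * (C * ‖z‖ ^ 2)) atTop (𝓝 0) := by
    simpa using (tendsto_pow_atTop_nhds_zero_of_lt_one (by positivity)
      ((div_lt_one hl2).2 hL)).mul_const (C * ‖z‖ ^ 2)
  exact sub_eq_zero.1 (norm_le_zero_iff.1 (ge_of_tendsto' hlim fun n => hpow n z hz))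

theorem existence_uniqueness_poincare_function (h : ℂ → ℂ)
    (hh : Differentiable ℂ h) (ζ : ℂ)
    (hfix : h ζ = ζ) (hrep : 1 < ‖deriv h ζ‖) :
    ∃! f : ℂ → ℂ, Differentiable ℂ f ∧ f 0 = ζ ∧ deriv f 0 = 1 ∧
      ∀ z : ℂ, f (deriv h ζ * z) = h (f z) := by
  obtain ⟨f, hf, hf0, hf1, hfh⟩ := exists_poincare_function hh hfix hrep
  exact ⟨f, ⟨hf, hf0, hf1, hfh⟩, fun g ⟨hg, hg0, hg1, hgh⟩ =>
    eq_of_poincare_functional_equation hh hrep hg hg0 hg1 hgh hf hf0 hf1 hfh⟩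
end

section
/- Let p be a polynomial of degree D ≥ 2 with a repelling fixed point ζ, i.e. p(ζ) = ζ and |λ| > 1 where λ = p′(ζ), and let f : ℂ → ℂ be the Poincaré function of p at ζ (the entire function with f(0) = ζ, f′(0) = 1 and f(λz) = p(f(z)) for all z). Then f has finite order ρ(f) = log D / log |λ|. -/
open Complex Set Filter Topology Metric MeasureTheory
open scoped ENNReal Real

theorem exists_norm_eval_le (q : Polynomial ℂ) {n : ℕ} (hn : q.natDegree ≤ n) :
    ∃ C : ℝ, 1 ≤ C ∧ ∀ w : ℂ, ‖q.eval w‖ ≤ C * max 1 ‖w‖ ^ n := by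
  refine ⟨1 + ∑ i ∈ Finset.range (q.natDegree + 1), ‖q.coeff i‖,
    le_add_of_nonneg_right (by positivity), fun w => ?_⟩
  rw [Polynomial.eval_eq_sum_range]
  have h1 : (1 : ℝ) ≤ max 1 ‖w‖ := le_max_left _ _
  calc ‖∑ i ∈ Finset.range (q.natDegree + 1), q.coeff i * w ^ i‖
      ≤ ∑ i ∈ Finset.range (q.natDegree + 1), ‖q.coeff i‖ * max 1 ‖w‖ ^ n := by
        refine norm_sum_le_of_le _ fun i hi => ?_
        rw [norm_mul, norm_pow]
        gcongr
        calc ‖w‖ ^ i ≤ max 1 ‖w‖ ^ i := by gcongr; exact le_max_right _ _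
          _ ≤ max 1 ‖w‖ ^ n :=
            pow_le_pow_right₀ h1 ((Nat.lt_succ_iff.mp (Finset.mem_range.mp hi)).trans hn)
    _ ≤ _ := by
        rw [← Finset.sum_mul]
        gcongr
        linarith

theorem exists_le_norm_eval (p : Polynomial ℂ) (hp : 1 ≤ p.natDegree) :
    ∃ c R : ℝ, 0 < c ∧ c ≤ 1 ∧ ∀ w : ℂ, R ≤ ‖w‖ → c * ‖w‖ ^ p.natDegree ≤ ‖p.eval w‖ := by
  obtain ⟨C, hC1, hC⟩ := exists_norm_eval_le p.eraseLead p.eraseLead_natDegree_le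
  have ha : 0 < ‖p.leadingCoeff‖ := by
    rw [norm_pos_iff, Polynomial.leadingCoeff_ne_zero]
    rintro rfl
    simp at hp
  refine ⟨min 1 (‖p.leadingCoeff‖ / 2), max 1 (2 * C / ‖p.leadingCoeff‖), by positivity,
    min_le_left _ _, fun w hw => ?_⟩
  have hw1 : 1 ≤ ‖w‖ := (le_max_left _ _).trans hw
  have hw2 : 2 * C ≤ ‖p.leadingCoeff‖ * ‖w‖ := by
    have := (le_max_right _ _).trans hw
    rwa [div_le_iff₀' ha] at this
  have hE := hC w
  rw [max_eq_right hw1] at hE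
  have hsplit : p.eval w = p.eraseLead.eval w + p.leadingCoeff * w ^ p.natDegree := by
    have h := congrArg (Polynomial.eval w) p.eraseLead_add_C_mul_X_pow.symm
    rwa [Polynomial.eval_add, Polynomial.eval_mul_X_pow, Polynomial.eval_C] at h
  have htri : ‖p.leadingCoeff‖ * ‖w‖ ^ p.natDegree ≤ ‖p.eval w‖ + ‖p.eraseLead.eval w‖ := by
    rw [← norm_pow, ← norm_mul, eq_sub_of_add_eq' hsplit.symm]
    exact norm_sub_le _ _
  have hpow : ‖w‖ ^ p.natDegree = ‖w‖ ^ (p.natDegree - 1) * ‖w‖ := by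
    rw [← pow_succ, Nat.sub_add_cancel hp]
  have hmain : 2 * (C * ‖w‖ ^ (p.natDegree - 1)) ≤ ‖p.leadingCoeff‖ * ‖w‖ ^ p.natDegree := by
    rw [hpow]
    nlinarith [mul_le_mul_of_nonneg_right hw2 (by positivity : 0 ≤ ‖w‖ ^ (p.natDegree - 1))]
  have hmin : min 1 (‖p.leadingCoeff‖ / 2) * ‖w‖ ^ p.natDegree ≤
      ‖p.leadingCoeff‖ / 2 * ‖w‖ ^ p.natDegree := by
    gcongr
    exact min_le_right _ _
  linarith

theorem exists_norm_le_pow_of_semiconj {p : Polynomial ℂ} (hD : 2 ≤ p.natDegree) {l : ℂ}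
    (hl : 1 < ‖l‖) {f : ℂ → ℂ} (hf : Continuous f) (hfun : ∀ z, f (l * z) = p.eval (f z)) :
    ∃ K : ℝ, Real.exp 1 ≤ K ∧
      ∀ (n : ℕ) (z : ℂ), ‖z‖ ≤ ‖l‖ ^ n → ‖f z‖ ≤ K ^ p.natDegree ^ n := by
  obtain ⟨C, hC1, hC⟩ := exists_norm_eval_le p le_rfl
  obtain ⟨M, hM⟩ := (isCompact_closedBall (0 : ℂ) 1).exists_bound_of_continuousOn hf.continuousOn
  set K := max (Real.exp 1) (C * max 1 M)
  refine ⟨K, le_max_left _ _, fun n z hz => ?_⟩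
  have hl0 : l ≠ 0 := norm_pos_iff.mp (one_pos.trans hl)
  have key : ∀ (n : ℕ) (z : ℂ), ‖z‖ ≤ ‖l‖ ^ n → C * max 1 ‖f z‖ ≤ K ^ p.natDegree ^ n := by
    intro n
    induction n with
    | zero =>
      intro z hz
      have hb := hM z (by simpa using hz)
      calc C * max 1 ‖f z‖ ≤ C * max 1 M := by gcongr
        _ ≤ K ^ p.natDegree ^ 0 := by simp [K]
    | succ n ih =>
      intro z hz
      have hz' : ‖z / l‖ ≤ ‖l‖ ^ n := by
        rw [norm_div, div_le_iff₀ (one_pos.trans hl), ← pow_succ]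
        exact hz
      have hzl : f z = p.eval (f (z / l)) := by rw [← hfun, mul_div_cancel₀ z hl0]
      have h1 : (1 : ℝ) ≤ max 1 ‖f (z / l)‖ := le_max_left _ _
      have h2 : max 1 ‖f z‖ ≤ C * max 1 ‖f (z / l)‖ ^ p.natDegree := by
        refine max_le (one_le_mul_of_one_le_of_one_le hC1 (one_le_pow₀ h1)) ?_
        rw [hzl]
        exact hC _
      calc C * max 1 ‖f z‖ ≤ C * (C * max 1 ‖f (z / l)‖ ^ p.natDegree) := by gcongr
        _ = C ^ 2 * max 1 ‖f (z / l)‖ ^ p.natDegree := by ring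
        _ ≤ C ^ p.natDegree * max 1 ‖f (z / l)‖ ^ p.natDegree := by gcongr
        _ = (C * max 1 ‖f (z / l)‖) ^ p.natDegree := by rw [mul_pow]
        _ ≤ (K ^ p.natDegree ^ n) ^ p.natDegree := by gcongr; exact ih _ hz'
        _ = K ^ p.natDegree ^ (n + 1) := by rw [← pow_mul, pow_succ]
  calc ‖f z‖ ≤ 1 * max 1 ‖f z‖ := by rw [one_mul]; exact le_max_right _ _
    _ ≤ C * max 1 ‖f z‖ := by gcongr
    _ ≤ _ := key n z hz

theorem exists_exp_pow_le_norm_of_semiconj {p : Polynomial ℂ} (hD : 2 ≤ p.natDegree) {l : ℂ}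
    {f : ℂ → ℂ} (hf : Differentiable ℂ f) (hf1 : deriv f 0 ≠ 0)
    (hfun : ∀ z, f (l * z) = p.eval (f z)) :
    ∃ z : ℂ, z ≠ 0 ∧ ∀ n : ℕ, Real.exp ((p.natDegree : ℝ) ^ n) ≤ ‖f (l ^ n * z)‖ := by
  obtain ⟨c, R, hc0, hc1, hc⟩ := exists_le_norm_eval p (by omega)
  set A := max (Real.exp 1) (c * R)
  have hA : 1 ≤ A := (Real.one_le_exp zero_le_one).trans (le_max_left _ _)
  obtain ⟨z, hz⟩ : ∃ z, A / c + ‖f 0‖ < ‖f z‖ := by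
    by_contra! hbound
    obtain ⟨a, ha⟩ := hf.exists_eq_const_of_bounded
      (isBounded_iff_forall_norm_le.mpr ⟨_, Set.forall_mem_range.mpr hbound⟩)
    exact hf1 (by rw [ha]; exact deriv_const 0 a)
  have hAc : 0 < A / c := by positivity
  refine ⟨z, ?_, fun n => ?_⟩
  · rintro rfl
    linarith
  have key : ∀ n : ℕ, A ^ p.natDegree ^ n ≤ c * ‖f (l ^ n * z)‖ := by
    intro n
    induction n with
    | zero =>
      have := norm_nonneg (f 0)
      have : A / c ≤ ‖f z‖ := by linarith
      rw [div_le_iff₀' hc0] at this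
      simpa using this
    | succ n ih =>
      have hAle : A ≤ c * ‖f (l ^ n * z)‖ :=
        (le_self_pow₀ hA (pow_ne_zero _ (by omega))).trans ih
      have hR : R ≤ ‖f (l ^ n * z)‖ :=
        le_of_mul_le_mul_left ((le_max_right _ _).trans hAle) hc0
      calc A ^ p.natDegree ^ (n + 1) = (A ^ p.natDegree ^ n) ^ p.natDegree := by
            rw [← pow_mul, pow_succ]
        _ ≤ (c * ‖f (l ^ n * z)‖) ^ p.natDegree := by gcongr
        _ = c ^ p.natDegree * ‖f (l ^ n * z)‖ ^ p.natDegree := mul_pow _ _ _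
        _ ≤ c ^ 2 * ‖f (l ^ n * z)‖ ^ p.natDegree := by
            gcongr ?_ * _
            exact pow_le_pow_of_le_one hc0.le hc1 hD
        _ = c * (c * ‖f (l ^ n * z)‖ ^ p.natDegree) := by ring
        _ ≤ c * ‖p.eval (f (l ^ n * z))‖ := by gcongr; exact hc _ hR
        _ = c * ‖f (l ^ (n + 1) * z)‖ := by rw [← hfun, pow_succ', mul_assoc]
  calc Real.exp ((p.natDegree : ℝ) ^ n) = Real.exp 1 ^ p.natDegree ^ n := by
        rw [← Real.exp_nat_mul]; simp
    _ ≤ A ^ p.natDegree ^ n := by gcongr; exact le_max_left _ _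
    _ ≤ c * ‖f (l ^ n * z)‖ := key n
    _ ≤ _ := mul_le_of_le_one_left (norm_nonneg _) hc1

theorem logPlus_mono {x y : ℝ} (hx : 0 ≤ x) (hxy : x ≤ y) : logPlus x ≤ logPlus y := by
  rcases hx.eq_or_lt with rfl | hx
  · simp [logPlus]
  · exact max_le_max le_rfl (Real.log_le_log hx hxy)

theorem logPlus_eq_log {x : ℝ} (hx : 1 ≤ x) : logPlus x = Real.log x :=
  max_eq_right (Real.log_nonneg hx)

theorem entireOrder_le_of_norm_le_s10 {f : ℂ → ℂ} {D : ℕ} (hD : 1 ≤ D) {r K : ℝ} (hr : 1 < r)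
    (hK : Real.exp 1 ≤ K) (hf : ∀ (n : ℕ) (z : ℂ), ‖z‖ ≤ r ^ n → ‖f z‖ ≤ K ^ D ^ n) :
    entireOrder f ≤ ENNReal.ofReal (Real.log D / Real.log r) := by
  have hlr : 0 < Real.log r := Real.log_pos hr
  have hD1 : (1 : ℝ) ≤ D := by exact_mod_cast hD
  have hlD : 0 ≤ Real.log D := Real.log_nonneg hD1
  have hlK : 1 ≤ Real.log K := by
    rw [← Real.log_exp 1]
    exact Real.log_le_log (Real.exp_pos _) hK
  have hK1 : 1 ≤ K := (Real.one_le_exp zero_le_one).trans hK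
  set B := Real.log D + Real.log (Real.log K)
  have hlog : Tendsto (fun z : ℂ => Real.log ‖z‖) (comap (fun z : ℂ => ‖z‖) atTop) atTop :=
    Real.tendsto_log_atTop.comp tendsto_comap
  have hlim : Tendsto
      (fun z : ℂ => ENNReal.ofReal (Real.log D / Real.log r + B / Real.log ‖z‖))
      (comap (fun z : ℂ => ‖z‖) atTop) (𝓝 (ENNReal.ofReal (Real.log D / Real.log r))) := by
    refine ENNReal.tendsto_ofReal ?_
    simpa using (hlog.const_div_atTop B).const_add (Real.log D / Real.log r)
  have : (comap (fun z : ℂ => ‖z‖) atTop).NeBot := by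
    rw [comap_norm_atTop]; infer_instance
  rw [← hlim.limsup_eq, entireOrder]
  refine limsup_le_limsup ?_
  filter_upwards [hlog.eventually_gt_atTop 0] with z hz
  refine ENNReal.ofReal_le_ofReal ?_
  set n := ⌈Real.log ‖z‖ / Real.log r⌉₊
  have hn1 : Real.log ‖z‖ ≤ n * Real.log r := (div_le_iff₀ hlr).mp (Nat.le_ceil _)
  have hn2 : (n : ℝ) < Real.log ‖z‖ / Real.log r + 1 := Nat.ceil_lt_add_one (by positivity)
  have hz0 : 0 < ‖z‖ := by
    refine (norm_nonneg z).lt_of_ne fun h => ?_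
    simp [← h] at hz
  have hzn : ‖z‖ ≤ r ^ n := by
    rw [← Real.log_le_log_iff hz0 (by positivity), Real.log_pow]
    exact hn1
  have hDn : (1 : ℝ) ≤ (D : ℝ) ^ n := one_le_pow₀ hD1
  have h1 : logPlus ‖f z‖ ≤ (D : ℝ) ^ n * Real.log K := by
    refine (logPlus_mono (norm_nonneg _) (hf n z hzn)).trans_eq ?_
    rw [logPlus_eq_log (one_le_pow₀ hK1), Real.log_pow]
    push_cast
    rfl
  have h2 : logPlus (logPlus ‖f z‖) ≤ n * Real.log D + Real.log (Real.log K) := by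
    refine (logPlus_mono (logPlus_nonneg _) h1).trans_eq ?_
    rw [logPlus_eq_log (one_le_mul_of_one_le_of_one_le hDn hlK),
      Real.log_mul (by positivity) (by positivity), Real.log_pow]
  calc logPlus (logPlus ‖f z‖) / Real.log ‖z‖
      ≤ (n * Real.log D + Real.log (Real.log K)) / Real.log ‖z‖ := by gcongr
    _ ≤ ((Real.log ‖z‖ / Real.log r + 1) * Real.log D + Real.log (Real.log K)) /
          Real.log ‖z‖ := by gcongr
    _ = Real.log D / Real.log r + B / Real.log ‖z‖ := by
        simp only [B]
        field_simp
        ring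

theorem le_entireOrder_of_exp_pow_le {f : ℂ → ℂ} {D : ℕ} (hD : 1 ≤ D) {l z : ℂ} (hl : 1 < ‖l‖)
    (hz : z ≠ 0) (hf : ∀ n : ℕ, Real.exp ((D : ℝ) ^ n) ≤ ‖f (l ^ n * z)‖) :
    ENNReal.ofReal (Real.log D / Real.log ‖l‖) ≤ entireOrder f := by
  have hlr : 0 < Real.log ‖l‖ := Real.log_pos hl
  have hl0 : 0 < ‖l‖ := one_pos.trans hl
  have hz0 : 0 < ‖z‖ := norm_pos_iff.mpr hz
  have hD1 : (1 : ℝ) ≤ D := by exact_mod_cast hD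
  have hlog : ∀ n : ℕ, Real.log ‖l ^ n * z‖ = n * Real.log ‖l‖ + Real.log ‖z‖ := fun n => by
    rw [norm_mul, norm_pow, Real.log_mul (by positivity) hz0.ne', Real.log_pow]
  have hseq : Tendsto (fun n : ℕ => l ^ n * z) atTop (comap (fun z : ℂ => ‖z‖) atTop) := by
    rw [tendsto_comap_iff]
    simpa [Function.comp_def] using
      (tendsto_pow_atTop_atTop_of_one_lt hl).atTop_mul_const hz0
  have hlogseq : Tendsto (fun n : ℕ => Real.log ‖l ^ n * z‖) atTop atTop :=
    Real.tendsto_log_atTop.comp (tendsto_comap_iff.mp hseq)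
  have hlim : Tendsto
      (fun n : ℕ => ENNReal.ofReal (n * Real.log D / Real.log ‖l ^ n * z‖)) atTop
      (𝓝 (ENNReal.ofReal (Real.log D / Real.log ‖l‖))) := by
    refine ENNReal.tendsto_ofReal ?_
    have h : Tendsto (fun n : ℕ => Real.log D / Real.log ‖l‖ -
        Real.log D / Real.log ‖l‖ * Real.log ‖z‖ / Real.log ‖l ^ n * z‖) atTop
        (𝓝 (Real.log D / Real.log ‖l‖)) := by
      simpa using (hlogseq.const_div_atTop
        (Real.log D / Real.log ‖l‖ * Real.log ‖z‖)).const_sub (Real.log D / Real.log ‖l‖)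
    refine h.congr' ?_
    filter_upwards [hlogseq.eventually_gt_atTop 0] with n hn
    rw [sub_eq_iff_eq_add, ← add_div, eq_div_iff hn.ne', hlog]
    field_simp
  rw [← hlim.limsup_eq]
  refine le_trans ?_ (limsup_le_limsup_of_le hseq)
  rw [← limsup_comp]
  refine limsup_le_limsup ?_
  filter_upwards [hlogseq.eventually_gt_atTop 0] with n hn
  refine ENNReal.ofReal_le_ofReal ?_
  have hDn : (1 : ℝ) ≤ (D : ℝ) ^ n := one_le_pow₀ hD1
  have h1 : (D : ℝ) ^ n ≤ logPlus ‖f (l ^ n * z)‖ := by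
    refine le_trans ?_ (logPlus_mono (Real.exp_pos _).le (hf n))
    exact (Real.log_exp _).symm.trans_le (le_max_right _ _)
  have h2 : n * Real.log D ≤ logPlus (logPlus ‖f (l ^ n * z)‖) := by
    refine le_trans ?_ (logPlus_mono (by positivity) h1)
    exact (Real.log_pow _ _).symm.trans_le (le_max_right _ _)
  gcongr

theorem order_of_poincare_function (p : Polynomial ℂ) (hD : 2 ≤ p.natDegree)
    (ζ : ℂ) (hfix : p.eval ζ = ζ) (hrep : 1 < ‖p.derivative.eval ζ‖)
    (f : ℂ → ℂ) (hf : Differentiable ℂ f)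
    (hf0 : f 0 = ζ) (hf1 : deriv f 0 = 1)
    (hfun : ∀ z : ℂ, f (p.derivative.eval ζ * z) = p.eval (f z)) :
    entireOrder f =
      ENNReal.ofReal (Real.log p.natDegree / Real.log ‖p.derivative.eval ζ‖) := by
  apply le_antisymm
  · obtain ⟨K, hK, hbound⟩ := exists_norm_le_pow_of_semiconj hD hrep hf.continuous hfun
    exact entireOrder_le_of_norm_le_s10 (by omega) hrep hK hbound
  · obtain ⟨z, hz, hbound⟩ := exists_exp_pow_le_norm_of_semiconj hD hf (by simp [hf1]) hfun
    exact le_entireOrder_of_exp_pow_le (by omega) hrep hz hbound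
end

section
/- Let h₁, h₂ be nonconstant, nonlinear entire functions and ψ : ℂ → ℂ a homeomorphism with ψ ∘ h₁ = h₂ ∘ ψ. Let x₁ be a repelling fixed point of h₁ (h₁(x₁) = x₁, |h₁′(x₁)| > 1), set x₂ := ψ(x₁), and assume x₂ is a repelling fixed point of h₂ (|h₂′(x₂)| > 1). Let f₁ and f₂ be the Poincaré functions of h₁ at x₁ and of h₂ at x₂, respectively. Then there exists a homeomorphism φ : ℂ → ℂ such that ψ ∘ f₁ = f₂ ∘ φ. -/
open Complex Set Filter Topology Metric MeasureTheory
open scoped ENNReal Real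

/-- A continuous function satisfying the same functional equation as a locally invertible
linearizer `f` factors continuously and equivariantly through `f`. -/
theorem exists_continuous_equivariant_lift {u f h : ℂ → ℂ} {a b f' : ℂ} (ha : 1 < ‖a‖)
    (hu : Continuous u) (hf : HasStrictDerivAt f f' 0) (hf' : f' ≠ 0) (h0 : u 0 = f 0)
    (hua : ∀ z, u (a * z) = h (u z)) (hfb : ∀ z, f (b * z) = h (f z)) :
    ∃ φ : ℂ → ℂ, Continuous φ ∧ φ 0 = 0 ∧ (∀ z, φ (a * z) = b * φ z) ∧ ∀ z, u z = f (φ z) := by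
  have ha0 : a ≠ 0 := by
    rintro rfl
    norm_num at ha
  have hF := hf.hasStrictFDerivAt_equiv hf'
  set e := hF.toOpenPartialHomeomorph f with he
  have hef : ∀ z, e z = f z := fun z => by rw [he, hF.toOpenPartialHomeomorph_coe]
  have hsrc : (0 : ℂ) ∈ e.source := hF.mem_toOpenPartialHomeomorph_source
  have htgt : u 0 ∈ e.target := by
    rw [h0, ← hef]
    exact e.map_source hsrc
  have hs0 : e.symm (u 0) = 0 := by rw [h0, ← hef, e.left_inv hsrc]
  have hcont0 : ContinuousAt (fun z => e.symm (u z)) 0 :=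
    ContinuousAt.comp (f := u) (e.continuousAt_symm htgt) hu.continuousAt
  have hev : ∀ᶠ z in 𝓝 (0 : ℂ), u z ∈ e.target ∧ b * e.symm (u z) ∈ e.source := by
    refine (hu.continuousAt.eventually (e.open_target.mem_nhds htgt)).and ?_
    refine (continuousAt_const.mul hcont0).eventually (e.open_source.mem_nhds ?_)
    simpa [hs0] using hsrc
  obtain ⟨r, hr, hball⟩ := Metric.eventually_nhds_iff.1 hev
  have hequiv : ∀ z, ‖z‖ < r → e.symm (u (a * z)) = b * e.symm (u z) := by
    intro z hz
    obtain ⟨h1, h2⟩ := hball (y := z) (by simpa using hz)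
    rw [hua, ← e.right_inv h1, hef, ← hfb, ← hef, e.left_inv h2, ← hef, e.right_inv h1]
  have hsmall : ∀ z : ℂ, ∃ n : ℕ, ‖a⁻¹ ^ n * z‖ < r := by
    intro z
    have hlt : ‖a⁻¹‖ < 1 := by
      rw [norm_inv]
      exact inv_lt_one_of_one_lt₀ ha
    have ht : Tendsto (fun n : ℕ => a⁻¹ ^ n * z) atTop (𝓝 0) := by
      simpa using (tendsto_pow_atTop_nhds_zero_of_norm_lt_one hlt).mul_const z
    obtain ⟨n, hn⟩ := (ht.eventually (Metric.ball_mem_nhds 0 hr)).exists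
    exact ⟨n, by simpa using hn⟩
  have hshrink : ∀ z : ℂ, ‖z‖ < r → ‖a⁻¹ * z‖ < r := by
    intro z hz
    rw [norm_mul, norm_inv]
    exact (mul_le_of_le_one_left (norm_nonneg _) (inv_le_one_of_one_le₀ ha.le)).trans_lt hz
  let F : ℕ → ℂ → ℂ := fun n z => b ^ n * e.symm (u (a⁻¹ ^ n * z))
  have hstep : ∀ n z, ‖a⁻¹ ^ n * z‖ < r →
      ‖a⁻¹ ^ (n + 1) * z‖ < r ∧ F (n + 1) z = F n z := by
    intro n z hz
    have hw : a⁻¹ ^ (n + 1) * z = a⁻¹ * (a⁻¹ ^ n * z) := by ring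
    have hw' : a * (a⁻¹ ^ (n + 1) * z) = a⁻¹ ^ n * z := by
      rw [hw, mul_inv_cancel_left₀ ha0]
    have hlt : ‖a⁻¹ ^ (n + 1) * z‖ < r := hw ▸ hshrink _ hz
    refine ⟨hlt, ?_⟩
    have := hequiv _ hlt
    rw [hw'] at this
    simp only [F]
    rw [this]
    ring
  have hmono : ∀ n m z, n ≤ m → ‖a⁻¹ ^ n * z‖ < r → ‖a⁻¹ ^ m * z‖ < r ∧ F m z = F n z := by
    intro n m z hnm hz
    induction m, hnm using Nat.le_induction with
    | base => exact ⟨hz, rfl⟩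
    | succ m _ ih => exact ⟨(hstep m z ih.1).1, (hstep m z ih.1).2.trans ih.2⟩
  choose N hN using hsmall
  let φ : ℂ → ℂ := fun z => F (N z) z
  have hφ : ∀ n z, ‖a⁻¹ ^ n * z‖ < r → φ z = F n z := by
    intro n z hz
    rw [← (hmono n (max n (N z)) z (le_max_left _ _) hz).2,
      (hmono (N z) (max n (N z)) z (le_max_right _ _) (hN z)).2]
  refine ⟨φ, ?_, ?_, ?_, ?_⟩
  · rw [continuous_iff_continuousAt]
    intro z
    have hpow : Continuous fun w : ℂ => a⁻¹ ^ N z * w := by fun_prop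
    have hloc : ∀ᶠ w in 𝓝 z, φ w = F (N z) w := by
      have hopen : IsOpen {w : ℂ | ‖a⁻¹ ^ N z * w‖ < r} :=
        isOpen_lt hpow.norm continuous_const
      filter_upwards [hopen.mem_nhds (hN z)] with w hw using hφ _ _ hw
    refine ContinuousAt.congr ?_ (hloc.mono fun w hw => hw.symm)
    have hmem : u (a⁻¹ ^ N z * z) ∈ e.target :=
      (hball (y := a⁻¹ ^ N z * z) (by simpa using hN z)).1
    exact continuousAt_const.mul (ContinuousAt.comp (f := fun w => u (a⁻¹ ^ N z * w))
      (e.continuousAt_symm hmem) (hu.comp hpow).continuousAt)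
  · rw [hφ 0 0 (by simpa using hr)]
    simp [F, hs0]
  · intro z
    have hw : a⁻¹ ^ (N z + 1) * (a * z) = a⁻¹ ^ N z * z := by
      rw [pow_succ, mul_assoc, inv_mul_cancel_left₀ ha0]
    rw [hφ (N z + 1) (a * z) (hw ▸ hN z)]
    simp only [φ, F]
    rw [hw]
    ring
  · intro z
    have hiter : ∀ (g : ℂ → ℂ) (c : ℂ), (∀ w, g (c * w) = h (g w)) →
        ∀ (n : ℕ) (w : ℂ), g (c ^ n * w) = h^[n] (g w) := by
      intro g c hg n w
      induction n with
      | zero => simp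
      | succ n ih => rw [pow_succ', mul_assoc, hg, ih, Function.iterate_succ_apply']
    have hmem : u (a⁻¹ ^ N z * z) ∈ e.target :=
      (hball (y := a⁻¹ ^ N z * z) (by simpa using hN z)).1
    simp only [φ, F]
    rw [hiter f b hfb, ← hef, e.right_inv hmem, ← hiter u a hua, inv_pow,
      mul_inv_cancel_left₀ (pow_ne_zero _ ha0)]

/-- A continuous map fixing `0`, commuting with an expanding linear map and preserving a function
that is locally invertible at `0` is the identity. -/
theorem eq_self_of_equivariant_of_comp_eq {f χ : ℂ → ℂ} {a f' : ℂ} (ha : 1 < ‖a‖)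
    (hf : HasStrictDerivAt f f' 0) (hf' : f' ≠ 0) (hχ : Continuous χ) (h0 : χ 0 = 0)
    (hχa : ∀ z, χ (a * z) = a * χ z) (hfχ : ∀ z, f (χ z) = f z) (z : ℂ) : χ z = z := by
  have ha0 : a ≠ 0 := by
    rintro rfl
    norm_num at ha
  have hF := hf.hasStrictFDerivAt_equiv hf'
  have hsrc := hF.mem_toOpenPartialHomeomorph_source
  set e := hF.toOpenPartialHomeomorph f with he
  have hef : ∀ z, e z = f z := fun z => by rw [he, hF.toOpenPartialHomeomorph_coe]
  have hloc : ∀ᶠ w in 𝓝 (0 : ℂ), χ w = w := by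
    have hsrc' : e.source ∈ 𝓝 (χ 0) := by
      rw [h0]
      exact e.open_source.mem_nhds hsrc
    filter_upwards [e.open_source.mem_nhds hsrc, hχ.continuousAt.eventually hsrc'] with w h1 h2
    exact e.injOn h2 h1 (by rw [hef, hef, hfχ])
  have hlt : ‖a⁻¹‖ < 1 := by
    rw [norm_inv]
    exact inv_lt_one_of_one_lt₀ ha
  have ht : Tendsto (fun n : ℕ => a⁻¹ ^ n * z) atTop (𝓝 0) := by
    simpa using (tendsto_pow_atTop_nhds_zero_of_norm_lt_one hlt).mul_const z
  obtain ⟨n, hn⟩ := (ht.eventually hloc).exists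
  have hiter : ∀ (n : ℕ) (w : ℂ), χ (a ^ n * w) = a ^ n * χ w := by
    intro n w
    induction n with
    | zero => simp
    | succ n ih => rw [pow_succ', mul_assoc, hχa, ih, mul_assoc]
  have := hiter n (a⁻¹ ^ n * z)
  rwa [hn, inv_pow, mul_inv_cancel_left₀ (pow_ne_zero _ ha0)] at this

theorem conjugacy_implies_equivalence_of_poincare_functions (h₁ h₂ : ℂ → ℂ)
    (hh₁ : Differentiable ℂ h₁) (hh₂ : Differentiable ℂ h₂)
    (hnl₁ : ¬ ∃ a b : ℂ, h₁ = fun z => a * z + b)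
    (hnl₂ : ¬ ∃ a b : ℂ, h₂ = fun z => a * z + b)
    (ψ : ℂ ≃ₜ ℂ) (hconj : ∀ z : ℂ, ψ (h₁ z) = h₂ (ψ z))
    (x₁ : ℂ) (hfix₁ : h₁ x₁ = x₁) (hrep₁ : 1 < ‖deriv h₁ x₁‖)
    (hfix₂ : h₂ (ψ x₁) = ψ x₁) (hrep₂ : 1 < ‖deriv h₂ (ψ x₁)‖)
    (f₁ f₂ : ℂ → ℂ) (hf₁ : Differentiable ℂ f₁) (hf₂ : Differentiable ℂ f₂)
    (hf₁0 : f₁ 0 = x₁) (hf₁1 : deriv f₁ 0 = 1)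
    (hfun₁ : ∀ z : ℂ, f₁ (deriv h₁ x₁ * z) = h₁ (f₁ z))
    (hf₂0 : f₂ 0 = ψ x₁) (hf₂1 : deriv f₂ 0 = 1)
    (hfun₂ : ∀ z : ℂ, f₂ (deriv h₂ (ψ x₁) * z) = h₂ (f₂ z)) :
    ∃ φ : ℂ ≃ₜ ℂ, ∀ z : ℂ, ψ (f₁ z) = f₂ (φ z) := by
  have hs₁ : HasStrictDerivAt f₁ 1 0 :=
    hf₁1 ▸ (hf₁.analyticAt 0).hasStrictDerivAt
  have hs₂ : HasStrictDerivAt f₂ 1 0 :=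
    hf₂1 ▸ (hf₂.analyticAt 0).hasStrictDerivAt
  obtain ⟨φ, hφc, hφ0, hφe, hφf⟩ := exists_continuous_equivariant_lift (u := fun z => ψ (f₁ z))
    hrep₁ (ψ.continuous.comp hf₁.continuous) hs₂ one_ne_zero (by simp only [hf₁0, hf₂0])
    (fun z => by rw [hfun₁, hconj]) hfun₂
  obtain ⟨χ, hχc, hχ0, hχe, hχf⟩ := exists_continuous_equivariant_lift
    (u := fun z => ψ.symm (f₂ z)) (h := h₁)
    hrep₂ (ψ.symm.continuous.comp hf₂.continuous) hs₁ one_ne_zero (by simp [hf₁0, hf₂0])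
    (fun z => by rw [hfun₂, ψ.symm_apply_eq, hconj, ψ.apply_symm_apply]) hfun₁
  have hleft : ∀ z, χ (φ z) = z :=
    eq_self_of_equivariant_of_comp_eq (χ := fun z => χ (φ z)) hrep₁ hs₁ one_ne_zero
      (hχc.comp hφc) (by rw [hφ0, hχ0]) (fun z => by rw [hφe, hχe])
      (fun z => by rw [← hχf, ← hφf, ψ.symm_apply_apply])
  have hright : ∀ z, φ (χ z) = z :=
    eq_self_of_equivariant_of_comp_eq (χ := fun z => φ (χ z)) hrep₂ hs₂ one_ne_zero
      (hφc.comp hχc) (by rw [hχ0, hφ0]) (fun z => by rw [hχe, hφe])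
      (fun z => by rw [← hφf, ← hχf, ψ.apply_symm_apply])
  exact ⟨⟨⟨φ, χ, hleft, hright⟩, hφc, hχc⟩, hφf⟩
end
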